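/- Let q be a prime power, let n ≥ 2, and suppose that G = PSL_n(q) is a simple group (equivalently, (n,q) ∉ {(2,2),(2,3)}). Then Σ_{p ∈ π(G)} Q_p(G) < 1, where the sum is over all prime divisors p of |G|. -/

import Mathlib

open Nat renaming card -> cat, card_eq_fintype_card -> cup, mul_le_mul_right -> car, pow_le_pow_left -> tea, pow_le_pow_right -> arm, exists_eq_add_of_le -> ear, card_coe_set_eq -> jaw, mul_le_mul -> bed, cast_sub -> jar, prime_dvd_prime_iff_eq -> pot, mul_le_mul_left -> tax, card_le_card_of_injective -> club, card_congr -> ball, prime_two -> kick, cast_le -> stone, one_le_pow -> wood, zero_le -> lamb, div_one -> duck, card_pos -> mouse, le_of_dvd -> hair, cast_one -> head, prime_three -> face, card_prod -> uncle, prime_of_mem_primeFactors -> war, eq_of_mul_eq_mul_right -> mall, add_le_add_right -> room, one_lt_pow -> storm, le_div_iff_mul_le -> year, add_sub_cancel' -> noon, add_sub_cancel -> soup, div_mul_le_self -> medal, Prime -> coal, cast_mul -> mile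
open Module renaming End -> dog, finrank -> fox, finrank_fin_fun -> toe, finite_of_finite -> road, natCard_eq_pow_finrank -> bird
open LinearMap renaming range -> red, ker -> bat, congr_fun -> tub, det -> lid, finrank_range_add_finrank_ker -> win, ext -> fish, range_eq_bot -> foot, sub_apply -> east, mem_ker -> west, det_toLin' -> snow, ker_eq_bot -> dawn, det_smul -> rude
open _root_ renaming mul_assoc -> sun, mul_le_mul_of_nonneg_right -> egg, pow_mul -> leg, pow_add -> eye, sub_eq_zero -> hip, mul_one -> box, map_mul -> pan, one_mul -> tin, le_rfl -> rug, mul_le_mul_of_nonneg_left -> axe, padicValNat -> bow, pow_two -> gun, congrArg -> van, mul_mem -> cab, mul_comm -> bid, pow_succ' -> lose, le_trans -> ride, mul_left_cancel -> river, pow_succ -> ocean, one_smul -> beach, orderOf_dvd_of_pow_eq_one -> leaf, dvd_pow_self -> tree, lt_of_le_of_lt -> rose, eq_bot_iff -> goose, one_pow -> sheep, pow_ne_zero -> wing, one_mem -> horn, pow_le_pow_right₀ -> skin, pow_le_pow_left₀ -> bone, pow_one -> nose, finrank_bot -> neck, pow_orderOf_eq_one -> knee, inv_mul_cancel_left ->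 king, inv_smul_smul₀ -> queen, smul_mul_assoc -> men, exists_prime_orderOf_dvd_card' -> dad, inv_mem -> nurse, lt_of_le_of_ne -> peace, mul_inv_cancel_right -> bomb, map_one -> tank, zero_ne_one -> ship, mul_smul_comm -> boat, add_le_add_left -> train, mul_pow -> door, smul_eq_zero -> cloud, mul_right_cancel -> star, inf_le_inf_right -> winter, inf_le_inf_left -> hot, orderOf_one -> cold, inv_mul_cancel₀ -> warm, padicValNat_self -> cool, add_le_add_right -> dry, map_pow -> rich, div_le_div_iff₀ -> old, if_neg -> young, add_le_add -> new, mul_eq_right -> fresh, mul_le_mul -> sweet, charP_of_card_eq_prime -> sour, mul_sub -> crime, sup_le -> jail, zero_mul -> thief, zpow_natCast -> cop, smul_pow -> fire, add_assoc -> smoke, sub_pos -> ash, le_of_eq -> mind, mul_inv_cancel -> soul, le_inf -> heart, one_pos -> brain, zero_pow -> blood, smul_smul -> nerve, smul_eq_mul -> lung, zero_add -> liver, add_zero -> tooth, mul_inv_eq_one -> thumb, zero_smul -> wrist, smul_mul_smul_comm -> elbow, orderOf_eq_one_iff -> chest, two_pos -> waist, map_neg -> ankle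
open Subgroup renaming center -> hat, mem_center_iff -> sea, zpowers -> goat, map -> dusk, subset_closure -> sad, mem_zpowers -> mad, closure_le -> bread, mem_zpowers_iff -> wheel, card_mul_index -> brake, pow_mem -> pound
open Set renaming ncard_le_ncard -> sky, ncard_le_ncard_of_injOn -> bee, toFinite -> ant, ncard_union_le -> team, mem_setOf_eq -> hill, ncard_coe_finset -> lion, ncard_insert_of_notMem -> tiger, ncard_prod -> wife, mem_toFinset -> south, eq_empty_of_forall_notMem -> hour, ncard_singleton -> angry, ncard_image_of_injective -> nice, ncard_insert_le -> cake, ncard_image_le -> salad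
open Units renaming val_pow_eq_pow_val -> ice, val_mul -> pig, ext -> goal, val_one -> aunt, mul_inv -> ounce, ext_iff -> ton
open Module.End renaming mul_apply -> oil, one_apply -> army
open Matrix renaming ProjectiveSpecialLinearGroup -> cow, SpecialLinearGroup -> lip, permMatrixHom -> hall, diagonal -> tire, det_fin_two -> thigh
open Finset renaming prod_range_succ -> rat, sum_range_succ -> lake, range -> girl, sum_le_sum_of_subset_of_nonneg -> maid, prod_ne_zero_iff -> roof, sum_le_sum -> rain, mem_range -> summer, sum_le_card_nsmul -> law, Icc -> jury, sum_congr -> pump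
open Submodule renaming eq_of_le_of_finrank_le -> rib, finrank_sup_add_finrank_inf_eq -> bag, eq_of_le_of_finrank_eq -> pay, finrank_eq_zero -> sand, map_le_iff_le_comap -> hand, finrank_map_subtype_eq -> baby, finrank_lt_finrank_of_lt -> sale, finrank_mono -> wind, mem_comap -> happy, one_le_finrank_iff -> calm, equivMapOfInjective -> water
open QuotientGroup renaming mk' -> mat, eq_one_iff -> jump
open ZMod renaming natCast_eq_zero_iff -> saw, natCast_eq_natCast_iff -> steel
open FiniteField renaming pow_card_sub_one_eq_one -> buy
open Fintype renaming ofFinite -> sell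
open Finite renaming one_lt_card -> game, of_injective -> pork
open Function renaming Injective -> park
open Matrix.GeneralLinearGroup renaming mkOfDetNeZero -> rock, toLin -> man
open Or renaming inl -> rice, inr -> horse
open Subtype renaming ext -> beef, val -> shop
open Equiv.Perm renaming sign_swap -> nest
open CharP renaming charP_iff_prime_eq_zero -> son
open Fin renaming sum_univ_succ -> judge
open MulAction renaming exists_smul_eq -> navy
open Sylow renaming coe_subgroup_smul -> spring
open MulAut renaming conj -> gray
open Matrix.SpecialLinearGroup renaming mem_center_iff -> poor, toGL_injective -> vote, toGL -> floor
open Projectivization renaming card_of_finrank -> flag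
open SetLike renaming coe_injective -> motor
open Matrix
set_option linter.all false
set_option linter.deprecated false
section
variable {F : Type*} [Field F] [Finite F] {n : Nat}
local notation "om" => (by omega)
local notation "nu" => (by norm_num)
local notation "pz" => (by positivity)
local notation "sm" => (by simp)
local notation "rg" => (by ring)
local notation "tf" => (ant _)
local notation:max x:max "~R" => (x : Real)
local notation:max x:max "~" => (x - 1)
local notation:max x:max "~2" => (x - 2)
local notation:max x:max "~i" => x⁻¹
local notation "qF" => cat F
local notation "nz" x:max => (x : F) ≠ 0
local notation "ndv" x:max => ¬ x ∣ cat F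
local notation "VN" => (Fin n -> F)
local notation "EN" => dog F (Fin n -> F)
local notation "GN" => (dog F (Fin n -> F))ˣ
local notation "SN" => lip (Fin n) F
local notation "PN" => cow (Fin n) F
local notation "MN" => Matrix (Fin n) (Fin n) F
local notation "E2" => dog F (Fin 2 -> F)
local notation "G2" => (dog F (Fin 2 -> F))ˣ
local notation "V4" => ((Fin 2 -> F) × (Fin 2 -> F))
local notation "GV" => (dog F ((Fin 2 -> F) × (Fin 2 -> F)))ˣ
local notation "E4" => dog F (Fin 4 -> F)
def gas {F A : Type*} [Field F] [AddCommGroup A] [Module F A] (α : A →ₗ[F] A) (e : Nat) : Prop :=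
  forall U U' : Submodule F A, U <= U.comap α -> U' <= U'.comap α -> U < U' ->
    fox F U + e <= fox F U'
def bus (q e k : Nat) : Nat := ∏ i ∈ girl (k / e), (q ^ k - q ^ (e * i))
section
variable {A B : Type*} [AddCommGroup A] [Module F A] [Module.Finite F A]
  [AddCommGroup B] [Module F B] [Module.Finite F B]
theorem greedy13 (α : A →ₗ[F] A) (β : B →ₗ[F] B) (e k : Nat) (he : 0 < e)
    (hA : fox F A = k) (hB : fox F B = k) (hg : gas α e) (j : Nat) :
    forall i, k / e <= i + j -> forall U : Submodule F A, U <= U.comap α -> e * i <= fox F U ->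
    forall φ₀ : A →ₗ[F] B,
    {φ : A →ₗ[F] B | park φ /\ β ∘ₗ φ = φ ∘ₗ α /\ ∀ x ∈ U, φ x = φ₀ x}.ncard <=
      ∏ l ∈ Finset.Ico i (k / e), (qF ^ k - qF ^ (e * l)) := by
  classical
  have : Finite B := road F
  have : Finite A := road F
  have : Finite (A →ₗ[F] B) := pork _ DFunLike.coe_injective
  have : Fintype B := sell _
  have : Fintype (A →ₗ[F] B) := sell _
  have hq : 1 < qF := game
  have hpos : forall i, 1 <= ∏ l ∈ Finset.Ico i (k / e), (qF ^ k - qF ^ (e * l)) := by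
    intro i
    apply Finset.one_le_prod'
    intro l hl
    have : l < k / e := (Finset.mem_Ico.1 hl).2
    have h2 : e * l < k := by
      have := medal k e
      nlinarith
    have := Nat.pow_lt_pow_right hq h2
    omega
  have htop : forall U : Submodule F A, U = ⊤ -> forall φ₀ : A →ₗ[F] B,
    {φ : A →ₗ[F] B | park φ /\ β ∘ₗ φ = φ ∘ₗ α /\ ∀ x ∈ U, φ x = φ₀ x}.ncard <= 1 := by
    rintro U rfl φ₀
    rw [Set.ncard_le_one]
    rintro a ⟨_, _, ha⟩ b ⟨_, _, hb⟩
    ext x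
    rw [ha x trivial, hb x trivial]
  induction j with
  | zero =>
    intro i hi U hU hd φ₀
    refine (htop U ?_ φ₀).trans (hpos i)
    by_contra hne
    have h1 := hg U ⊤ hU sm (lt_top_iff_ne_top.2 hne)
    rw [finrank_top, hA] at h1
    have : k / e < i + 1 := om
    rw [Nat.div_lt_iff_lt_mul he] at this
    nlinarith
  | succ j ih =>
    intro i hi U hU hd φ₀
    by_cases hT : U = ⊤
    · exact (htop U hT φ₀).trans (hpos i)
    obtain ⟨v, hv⟩ : exists v, v ∉ U := by
      by_contra h
      push Not at h
      exact hT (eq_top_iff.2 fun x _ => h x)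
    set U' : Submodule F A := U ⊔ ⨆ m : Nat, Submodule.span F {(α ^ m) v} with hU'
    have hvU' : v ∈ U' := by
      refine Submodule.mem_sup_right (Submodule.mem_iSup_of_mem 0 ?_)
      simp
    have hinv : U' <= U'.comap α := by
      rw [hU', sup_le_iff]
      refine ⟨hU.trans (Submodule.comap_mono le_sup_left), iSup_le fun m => ?_⟩
      rw [Submodule.span_singleton_le_iff_mem, happy]
      refine Submodule.mem_sup_right (Submodule.mem_iSup_of_mem (m+1) ?_)
      rw [lose]
      exact Submodule.mem_span_singleton_self _
    have hlt : U < U' := peace le_sup_left (fun h => hv (h ▸ hvU'))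
    have hdim := hg U U' hU hinv hlt
    have hle : fox F U' <= k := hA ▸ Submodule.finrank_le U'
    have hi' : i + 1 <= k / e := by
      rw [year he]; nlinarith
    rw [Finset.prod_eq_prod_Ico_succ_bot (by omega : i < k / e), bid]
    rw [Set.ncard_eq_toFinset_card']
    by_cases hne : (exists φ₁ : A →ₗ[F] B, park φ₁ /\ ∀ x ∈ U, φ₁ x = φ₀ x)
    swap
    · rw [Finset.card_eq_zero.2]
      · exact lamb _
      · ext φ
        simp only [south, hill, Finset.notMem_empty, iff_false]
        rintro ⟨a, b, c⟩
        exact hne ⟨φ, a, c⟩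
    obtain ⟨φ₁, hinj, hφ₁⟩ := hne
    have key := Finset.card_le_mul_card_image_of_maps_to (f := fun φ : A →ₗ[F] B => φ v)
      (s := {φ : A →ₗ[F] B | park φ /\ β ∘ₗ φ = φ ∘ₗ α /\ ∀ x ∈ U, φ x = φ₀ x}.toFinset)
      (t := Finset.univ \ (U.map φ₁ : Set B).toFinset) (by
        intro φ hφ
        simp only [south, hill] at hφ
        simp only [Finset.mem_sdiff, Finset.mem_univ, true_and, south, SetLike.mem_coe, Submodule.mem_map, not_exists, not_and]
        intro x hx h
        rw [hφ₁ x hx, <- hφ.2.2 x hx] at h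
        exact hv (hφ.1 h ▸ hx))
      (∏ l ∈ Finset.Ico (i+1) (k / e), (qF ^ k - qF ^ (e * l))) (by
        intro w _
        by_cases hex : ∃ φ₂ ∈ {φ : A →ₗ[F] B | park φ /\ β ∘ₗ φ = φ ∘ₗ α /\ ∀ x ∈ U, φ x = φ₀ x}, φ₂ v = w
        swap
        · rw [Finset.card_eq_zero.2]
          · exact lamb _
          · ext φ
            simp only [Finset.mem_filter, south, Finset.notMem_empty, iff_false]
            rintro ⟨a, b⟩
            exact hex ⟨φ, a, b⟩
        obtain ⟨φ₂, ⟨hi2, hc2, hu2⟩, hw2⟩ := hex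
        have := ih (i+1) om U' hinv (by rw [mul_add]; omega) φ₂
        refine ride ?_ this
        rw [<- lion]
        apply sky _ tf
        intro φ hφ
        simp only [Finset.coe_filter, south, hill] at hφ
        obtain ⟨⟨h1, h2, h3⟩, h4⟩ := hφ
        refine ⟨h1, h2, ?_⟩
        suffices U' <= LinearMap.eqLocus φ φ₂ from fun x hx => this hx
        rw [hU', sup_le_iff]
        refine ⟨fun x hx => by simp [h3 x hx, hu2 x hx], iSup_le fun m => ?_⟩
        rw [Submodule.span_singleton_le_iff_mem]
        have hm : ∀ (ψ : A →ₗ[F] B), β ∘ₗ ψ = ψ ∘ₗ α -> forall m, ψ ((α ^ m) v) = (β ^ m) (ψ v) := by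
          intro ψ hψ m
          induction m with
          | zero => simp
          | succ m ihm =>
            rw [lose, lose, oil, oil, <- ihm]
            exact (tub hψ _).symm
        simp [hm φ h2, hm φ₂ hc2, h4, hw2])
    refine key.trans (tax _ ?_)
    rw [Finset.card_sdiff_of_subset (Finset.subset_univ _), Finset.card_univ]
    have c1 : Fintype.card B = qF ^ k := by
      rw [<- cup, bird (K := F), hB]
    have c2 : (U.map φ₁ : Set B).toFinset.card = qF ^ (fox F U) := by
      rw [Set.toFinset_card, <- cup]
      rw [(water φ₁ hinj U).finrank_eq]
      exact bird (K := F)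
    rw [c1, c2]
    exact Nat.sub_le_sub_left (arm om hd) _
theorem pizza (α : A →ₗ[F] A) (β : B →ₗ[F] B) (e k : Nat) (he : 0 < e)
    (hA : fox F A = k) (hB : fox F B = k) (hg : gas α e) :
    {φ : A →ₗ[F] B | park φ /\ β ∘ₗ φ = φ ∘ₗ α}.ncard <= bus qF e k := by
  have := greedy13 α β e k he hA hB hg (k / e) 0 om ⊥ sm sm 0
  rw [bus, Finset.range_eq_Ico]
  refine ride (mind ?_) this
  congr 1
  ext φ
  simp
end
section
variable {V : Type*} [AddCommGroup V] [Module F V] [Module.Finite F V]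
local notation "EV" => dog F V
local notation "GU" => (dog F V)ˣ
local notation "dl" x:max => (x : dog F V) - 1
theorem lunch (α : V →ₗ[F] V) : gas α 1 :=
  fun _ _ _ _ h => sale h
theorem mom : Finite EV := by
  have : Finite V := road F
  exact pork _ DFunLike.coe_injective
theorem owl : Finite GU := by
  have : Finite EV := mom
  infer_instance
theorem dinner (a : dog F V) (K R : Submodule F V) (hKR : K ⊔ R = ⊤)
    (hK : K <= K.comap a) (hR : R <= R.comap a)
    (hK' : forall y : dog F V, a * y = y * a -> K <= K.comap y)
    (hR' : forall y : dog F V, a * y = y * a -> R <= R.comap y) (e₁ e₂ : Nat) (h₁ : 0 < e₁) (h₂ : 0 < e₂)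
    (g₁ : gas (a.restrict hK) e₁) (g₂ : gas (a.restrict hR) e₂) :
    {y : (dog F V)ˣ | a * y = y * a}.ncard <=
      bus (cat F) e₁ (fox F K) * bus (cat F) e₂ (fox F R) := by
  classical
  have := owl (F := F) (V := V)
  have := mom (F := F) (V := K)
  have := mom (F := F) (V := R)
  have c1 := pizza (a.restrict hK) (a.restrict hK) e₁ _ h₁ rfl rfl g₁
  have c2 := pizza (a.restrict hR) (a.restrict hR) e₂ _ h₂ rfl rfl g₂
  refine ride ?_ (bed c1 c2)
  rw [<- wife]
  refine bee
    (fun y : (dog F V)ˣ => if h : a * y = y * a then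
      ((y : dog F V).restrict (hK' y h), (y : dog F V).restrict (hR' y h)) else 0)
    ?_ ?_ tf
  · intro y hy
    have hy : a * y = y * a := hy
    have hinj : park (y : dog F V) := by
      intro u v huv
      have := van (fun w => ((y~i : (dog F V)ˣ) : dog F V) w) huv
      simpa [<- oil] using this
    simp only [dif_pos hy, Set.mem_prod]
    refine ⟨⟨?_, ?_⟩, ⟨?_, ?_⟩⟩
    · intro u v h; exact beef (hinj (van shop h))
    · ext x; exact tub hy x
    · intro u v h; exact beef (hinj (van shop h))
    · ext x; exact tub hy x
  · intro y hy z hz h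
    have hy : a * y = y * a := hy
    have hz : a * z = z * a := hz
    simp only [dif_pos hy, dif_pos hz, Prod.mk.injEq] at h
    ext1
    suffices (⊤ : Submodule F V) <= LinearMap.eqLocus (y : dog F V) z from
      fish fun x => this trivial
    rw [<- hKR, sup_le_iff]
    exact ⟨fun x hx => van shop (tub h.1 ⟨x, hx⟩),
      fun x hx => van shop (tub h.2 ⟨x, hx⟩)⟩
theorem heel {G : Type*} [Group G] [Finite G] (a b : G) :
    {y : G | b * y = y * a}.ncard <= {y : G | a * y = y * a}.ncard := by
  by_cases h : exists y₀ : G, b * y₀ = y₀ * a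
  · obtain ⟨y₀, h₀⟩ := h
    refine bee (fun y => y₀~i * y) ?_ (fun _ _ _ _ h => river h)
    intro y hy
    have hy : b * y = y * a := hy
    have h1 : a * y₀~i = y₀~i * b := by
      rw [eq_inv_mul_iff_mul_eq, <- sun, <- h₀, sun, soul, box]
    change a * (y₀~i * y) = y₀~i * y * a
    rw [<- sun, h1, sun, hy, sun]
  · rw [show {y : G | b * y = y * a} = ∅ from hour fun y hy => h ⟨y, hy⟩]
    simp
theorem week (p : Nat) (a : EV) (ha : a ^ p = 1) (hpF : nz p) :
    Disjoint (bat a~) (red a~) := by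
  rw [Submodule.disjoint_def]
  rintro x hx ⟨w, rfl⟩
  set x := a~ w
  have h1 : a x = x := by
    have : a~ x = 0 := hx
    rwa [east, hip] at this
  have h2 : forall i, (a ^ i) x = x := by
    intro i
    induction i with
    | zero => simp
    | succ i ih => rw [ocean, oil, h1, ih]
  have h3 : (∑ i ∈ girl p, a ^ i) x = 0 := by
    change (∑ i ∈ girl p, a ^ i) (a~ w) = 0
    rw [<- oil, geom_sum_mul, ha]; simp
  rw [LinearMap.sum_apply, pump rfl (fun i _ => h2 i), Finset.sum_const, Finset.card_range,
    <- Nat.cast_smul_eq_nsmul F] at h3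
  exact (cloud.1 h3).resolve_left hpF
variable (p : Nat) [hp : Fact p.Prime]
theorem compl13 (a : EV) (ha : a ^ p = 1) (hpF : nz p) :
    bat a~ ⊔ red a~ = ⊤ := by
  have := week p a ha hpF
  refine Submodule.eq_top_of_disjoint _ _ ?_ this
  rw [add_comm, win]
theorem plate (a : EV) {j : Nat} (ha : a ^ p ^ j = 1) (U : Submodule F V) (hU : U <= U.comap a) :
    qF ^ (fox F U) ≡
      qF ^ (fox F (U ⊓ bat a~ : Submodule F V)) [MOD p] := by
  classical
  have : Finite V := road F
  have : Fintype V := sell _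
  obtain ⟨f, hf⟩ : exists f : Function.End U, forall x : U, (((f : U -> U) x : U) : V) = a x :=
    ⟨fun x => ⟨a x, hU x.2⟩, fun x => rfl⟩
  have h := Equiv.Perm.card_fixedPoints_modEq (p := p) (n := j) (α := U) (f := f) (by
    have h2 : ∀ (i : Nat) (x : U), ((((f ^ i : Function.End U) : U -> U) x : U) : V) = (a ^ i) x := by
      intro i
      induction i with
      | zero => intro x; rfl
      | succ i ih =>
        intro x
        rw [ocean, ocean, oil, <- hf]
        exact ih _
    refine funext fun x => beef ?_
    rw [h2, ha]; rfl)
  rw [<- cup, @Fintype.card_eq_nat_card, bird (K := F)] at h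
  rw [<- bird (K := F) (V := (U ⊓ bat a~ : Submodule F V))]
  refine h.trans (van (· % p) ?_)
  refine ball ⟨fun x => ⟨x.1.1, x.1.2, ?_⟩, fun x => ⟨⟨x.1, x.2.1⟩, ?_⟩, fun x => rfl, fun x => rfl⟩
  · have h3 := x.2
    have this := van shop (show (f : U -> U) x.1 = x.1 from h3)
    rw [hf] at this
    simp only [SetLike.mem_coe, west, east, army]
    rw [hip]; exact this
  · have h3 := x.2.2
    simp only [SetLike.mem_coe, west, east, army] at h3
    rw [hip] at h3
    exact beef ((hf _).trans h3)
theorem fork (a : EV) {j : Nat} (ha : a ^ p ^ j = 1) (hq : ndv p)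
    (U U' : Submodule F V) (hU : U <= U.comap a) (hU' : U' <= U'.comap a) (hle : U <= U')
    (hK : U' ⊓ bat a~ <= U) :
    orderOf (qF : ZMod p) ∣ fox F U' - fox F U := by
  have h1 := plate p a ha U hU
  have h2 := plate p a ha U' hU'
  have h3 : U' ⊓ bat a~ = U ⊓ bat a~ :=
    le_antisymm (heart hK inf_le_right) (winter _ hle)
  rw [h3] at h2
  have h4 := h2.trans h1.symm
  have hle' : fox F U <= fox F U' := wind hle
  rw [<- steel] at h4
  push_cast at h4
  have hne : (qF : ZMod p) ≠ 0 := by rwa [Ne, saw]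
  apply leaf
  have : (qF : ZMod p) ^ fox F U ≠ 0 := wing _ hne
  apply mul_left_cancel₀ this
  rw [<- eye, noon hle', box]
  exact h4
end
section
variable {V : Type*} [AddCommGroup V] [Module F V] [Module.Finite F V]
local notation "EV" => dog F V
local notation "GU" => (dog F V)ˣ
local notation "dl" x:max => (x : dog F V) - 1
variable (p : Nat) [hp : Fact p.Prime]
theorem spoon (a : EV) (e : Nat) (R : Submodule F V) (hR : R <= R.comap a)
    (h : forall U U' : Submodule F V, U <= U.comap a -> U' <= U'.comap a -> U < U' -> U' <= R ->
      fox F U + e <= fox F U') : gas (a.restrict hR) e := by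
  intro U U' hU hU' hlt
  have h1 : forall X : Submodule F R, X <= X.comap (a.restrict hR) -> X.map R.subtype <= (X.map R.subtype).comap a := by
    rintro X hX _ ⟨x, hx, rfl⟩
    exact ⟨_, hX hx, rfl⟩
  have := h (U.map R.subtype) (U'.map R.subtype) (h1 U hU) (h1 U' hU')
    (Submodule.map_strictMono_of_injective R.injective_subtype hlt) (Submodule.map_subtype_le _ _)
  rwa [baby, baby] at this
theorem wet (a : EV) (ha : a ^ p = 1) (hpF : nz p) (hq : ndv p)
    (U U' : Submodule F V) (hU : U <= U.comap a) (hU' : U' <= U'.comap a) (hlt : U < U')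
    (hR : U' <= red a~) :
    fox F U + orderOf (qF : ZMod p) <= fox F U' := by
  have hd := week p a ha hpF
  have h := fork p a (j := 1) (by simpa using ha) hq U U' hU hU' hlt.le (by
    have : U' ⊓ bat a~ = ⊥ := by
      rw [goose, <- hd.eq_bot, inf_comm]
      exact hot _ hR
    rw [this]; exact bot_le)
  have h2 := sale hlt
  have := hair om h
  omega
theorem wolf (hq : ndv p) : 0 < orderOf (qF : ZMod p) := by
  rw [orderOf_pos_iff]
  have : (qF : ZMod p) ≠ 0 := by rwa [Ne, saw]
  exact isOfFinOrder_iff_pow_eq_one.2 ⟨p - 1, Nat.sub_pos_of_lt hp.out.one_lt, ZMod.pow_card_sub_one_eq_one this⟩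
theorem fast {a y : EV} (f : EV) (h : f * y = y * f) :
    bat f <= (bat f).comap y := by
  intro x hx
  have := tub h x
  simp only [oil] at this
  rw [happy, west, this, west.1 hx, map_zero]
theorem slow {y : EV} (f : EV) (h : f * y = y * f) :
    red f <= (red f).comap y := by
  rintro _ ⟨x, rfl⟩
  exact ⟨y x, tub h x⟩
theorem plane (a : EV) (ha : a ^ p = 1) (hpF : nz p) (hq : ndv p) :
    {y : GU | a * y = y * a}.ncard <=
      bus qF 1 (fox F (bat a~)) *
      bus qF (orderOf (qF : ZMod p)) (fox F (red a~)) := by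
  have hc : forall y : EV, a * y = y * a -> a~ * y = y * a~ := by
    intro y h; rw [sub_mul, crime, h, tin, box]
  exact dinner a _ _ (compl13 p a ha hpF) (fast (a := a) _ (hc a rfl)) (slow _ (hc a rfl))
    (fun y h => fast (a := a) _ (hc y h)) (fun y h => slow _ (hc y h)) _ _ brain (wolf p hq)
    (lunch _) (spoon a _ _ _ fun U U' h1 h2 h3 h4 => wet p a ha hpF hq U U' h1 h2 h3 h4)
theorem big (a : EV) (μ : F) (ha : a ^ p = μ • 1) (hμ : forall c : F, c ^ p ≠ μ)
    (hq : qF ≡ 1 [MOD p]) (U : Submodule F V) (hU : U <= U.comap a) :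
    p ∣ fox F U := by
  classical
  have : Finite V := road F
  have : Fintype (Projectivization F U) := sell _
  have hμ0 : μ ≠ 0 := fun h => hμ 0 (by rw [h, blood hp.out.ne_zero])
  have hinj : park (a.restrict hU) := by
    rw [<- dawn, LinearMap.ker_eq_bot']
    intro x hx
    have h1 : a (x : V) = 0 := van shop hx
    have h2 := tub ha (x : V)
    rw [<- Nat.sub_add_cancel hp.out.one_le, ocean, oil, h1, map_zero] at h2
    have h3 : μ • (x : V) = 0 := h2.symm
    exact beef ((cloud.1 h3).resolve_left hμ0)
  obtain ⟨f, hf⟩ : exists f : Function.End (Projectivization F U), forall x, (f : Projectivization F U -> Projectivization F U) x = Projectivization.map (a.restrict hU) hinj x :=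
    ⟨fun x => _, fun x => rfl⟩
  have hpow : ∀ (i : Nat) (v : U) (hv : v ≠ 0) , exists hv' : (a.restrict hU ^ i) v ≠ 0, ((f ^ i : Function.End (Projectivization F U)) : Projectivization F U -> Projectivization F U) (Projectivization.mk F v hv)
      = Projectivization.mk F ((a.restrict hU ^ i) v) hv' := by
    intro i
    induction i with
    | zero => intro v hv; exact ⟨hv, rfl⟩
    | succ i ih =>
      intro v hv
      have hv1 : a.restrict hU v ≠ 0 := fun h => hv (hinj (h.trans (map_zero _).symm))
      obtain ⟨h1, h2⟩ := ih _ hv1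
      refine ⟨by rw [ocean]; exact h1, ?_⟩
      rw [ocean]
      change ((f ^ i : Function.End (Projectivization F U)) : Projectivization F U -> Projectivization F U) ((f : Projectivization F U -> Projectivization F U) _) = _
      rw [hf]
      exact h2
  have hval : ∀ i (x : U), (((a.restrict hU ^ i : U →ₗ[F] U) x : U) : V) = (a ^ i) x := by
    intro i
    induction i with
    | zero => intro x; rfl
    | succ i ih => intro x; rw [lose, lose, oil, oil, <- ih]; rfl
  have h := Equiv.Perm.card_fixedPoints_modEq (p := p) (n := 1) (α := Projectivization F U) (f := f) (by
    rw [nose]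
    refine funext fun x => ?_
    induction x using Projectivization.ind with
    | h v hv =>
      obtain ⟨h1, h2⟩ := hpow p v hv
      refine h2.trans ?_
      change _ = Projectivization.mk F v hv
      rw [Projectivization.mk_eq_mk_iff']
      refine ⟨μ, beef ?_⟩
      rw [hval, ha]; rfl)
  have h0 : IsEmpty (Function.fixedPoints f) := by
    refine ⟨fun ⟨x, hx⟩ => ?_⟩
    induction x using Projectivization.ind with
    | h v hv =>
      have hx : (f : Projectivization F U -> Projectivization F U) _ = _ := hx
      rw [hf, Projectivization.map_mk, Projectivization.mk_eq_mk_iff'] at hx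
      obtain ⟨c, hc⟩ := hx
      have hc : c • (v : V) = a v := van shop hc
      have h3 : forall i, (a ^ i) (v : V) = c ^ i • (v : V) := by
        intro i
        induction i with
        | zero => simp
        | succ i ih => rw [ocean, oil, <- hc, map_smul, ih, nerve, ocean, bid]
      have h4 := h3 p
      rw [ha] at h4
      have h4 : μ • (v : V) = c ^ p • (v : V) := h4
      rw [<- hip, <- sub_smul] at h4
      have := (cloud.1 h4).resolve_right (fun h => hv (beef h))
      exact hμ c (hip.1 this).symm
  have e2 := @Fintype.card_eq_zero_iff (Function.fixedPoints f) _ |>.2 h0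
  have h : cat (Projectivization F U) ≡ 0 [MOD p] := by
    rw [cup]
    exact h.trans (by exact van (· % p) e2)
  rw [flag F U rfl] at h
  have h5 : ∑ i ∈ girl (fox F U), qF ^ i ≡ ∑ i ∈ girl (fox F U), 1 [MOD p] := by
    rw [<- steel] at hq ⊢
    push_cast at hq ⊢
    rw [hq]; simp
  have h6 := h5.symm.trans h
  simp only [Finset.sum_const, Finset.card_range, lung, box] at h6
  exact (Nat.modEq_zero_iff_dvd).1 h6
theorem small (a : EV) (μ : F) (ha : a ^ p = μ • 1) (hμ : forall c : F, c ^ p ≠ μ)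
    (hq : qF ≡ 1 [MOD p]) :
    {y : GU | a * y = y * a}.ncard <= bus qF p (fox F V) := by
  have := dinner a ⊥ ⊤ sm sm sm sm sm 1 p brain hp.out.pos (lunch _)
    (spoon a _ _ _ fun U U' h1 h2 h3 _ => by
      have := Nat.dvd_sub (big p a μ ha hμ hq U' h2) (big p a μ ha hμ hq U h1)
      have h2 := sale h3
      have := hair om this
      omega)
  rw [neck, finrank_top] at this
  simpa [bus] using this
end
section
variable {V : Type*} [AddCommGroup V] [Module F V] [Module.Finite F V]
local notation "EV" => dog F V
local notation "GU" => (dog F V)ˣ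
local notation "dl" x:max => (x : dog F V) - 1
variable (p : Nat) [hp : Fact p.Prime]
theorem jet (a : EV) (Y : Submodule F V) (h : red a~ <= Y) :
    Y <= Y.comap a := by
  intro x hx
  have h1 : a x = a~ x + x := sm
  rw [happy, h1]
  exact Y.add_mem (h ⟨x, rfl⟩) hx
theorem palm (a : EV) (ha : a ^ p = 1) (hpF : nz p) (hq : ndv p)
    (hr : fox F (red a~) = orderOf (qF : ZMod p))
    (X : Submodule F V) (hX : X <= X.comap a) :
    X <= bat a~ \/ red a~ <= X := by
  by_cases h : X ⊓ red a~ = ⊥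
  · left
    intro x hx
    have h1 : a~ x ∈ X ⊓ red a~ := ⟨X.sub_mem (hX hx) hx, ⟨x, rfl⟩⟩
    rw [h] at h1
    exact h1
  · right
    have hinv : red a~ <= (red a~).comap a := jet _ _ rug
    have h1 := wet p a ha hpF hq ⊥ (X ⊓ red a~) sm
      (fun x hx => ⟨hX hx.1, hinv hx.2⟩) (bot_lt_iff_ne_bot.2 h) inf_le_right
    rw [neck, liver, <- hr] at h1
    have := rib (inf_le_right : X ⊓ red a~ <= _) h1
    rw [<- this]; exact inf_le_left
theorem modfix13 {G α : Type*} [Group G] [MulAction G α] [Finite α] (Q : Subgroup G) (hQ : IsPGroup p Q)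
    (Ω : Set α) (hΩ : ∀ g ∈ Q, ∀ x ∈ Ω, g • x ∈ Ω) :
    Ω.ncard ≡ {x | x ∈ Ω /\ ∀ g ∈ Q, g • x = x}.ncard [MOD p] := by
  let Ω' : SubMulAction Q α := ⟨Ω, fun {c x} hx => hΩ c.1 c.2 x hx⟩
  have h := hQ.card_modEq_card_fixedPoints Ω'
  have e1 : cat Ω' = Ω.ncard := rfl
  have e2 : cat (MulAction.fixedPoints Q Ω') = {x | x ∈ Ω /\ ∀ g ∈ Q, g • x = x}.ncard := by
    rw [<- jaw]
    refine ball ⟨fun x => ⟨x.1.1, x.1.2, fun g hg => van shop (x.2 ⟨g, hg⟩)⟩,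
      fun x => ⟨⟨x.1, x.2.1⟩, fun g => beef (x.2.2 g.1 g.2)⟩, fun x => rfl, fun x => rfl⟩
  rwa [e1, e2] at h
def bean (T : Subgroup GU) : Set GU :=
  {h | h ∈ T /\ (h : EV) ^ p = 1 /\
    fox F (red (dl h)) = orderOf (qF : ZMod p)}
open Pointwise in
theorem pair13 (hp2 : p ≠ 2) (hpF : nz p) (hq : ndv p)
    (T : Subgroup GU) (hT : IsPGroup p T) (h h' : GU)
    (hh : h ∈ bean p T) (hh' : h' ∈ bean p T) :
    red (dl h) = red ((h' : EV) - 1) \/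
    red (dl h) <= bat ((h' : EV) - 1) := by
  classical
  have : Finite V := road F
  have : Finite (Submodule F V) := pork _ motor
  set W := red (dl h) with hW
  set W' := red ((h' : EV) - 1) with hW'
  set Q := Subgroup.closure {h, h'} with hQ
  have hQT : Q <= T := (bread _).2 (by rintro x (rfl | rfl); exacts [hh.1, hh'.1])
  have hQp : IsPGroup p Q := hT.to_le hQT
  have hsm : ∀ (g : GU) (X : Submodule F V), g • X = X.map (g : EV) := fun _ _ => rfl
  have hfr : ∀ (g : GU) (X : Submodule F V), fox F (g • X : Submodule F V) = fox F X := by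
    intro g X
    rw [hsm]
    exact (water _ ((dog.isUnit_iff _).1 g.isUnit).1 X).finrank_eq.symm
  have hinv : ∀ (g : GU) (X : Submodule F V), X <= X.comap (g : EV) ↔ g • X = X := by
    intro g X
    constructor
    · intro hX
      exact pay (hand.2 hX) (hfr g X)
    · intro hX
      exact hand.1 hX.le
  have hY : h • (W ⊔ W') = W ⊔ W' := (hinv _ _).1 (jet _ _ le_sup_left)
  have hY' : h' • (W ⊔ W') = W ⊔ W' := (hinv _ _).1 (jet _ _ le_sup_right)
  have hQY : Q <= MulAction.stabilizer _ (W ⊔ W') := (bread _).2 (by rintro x (rfl | rfl); exacts [hY, hY'])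
  have hΩ : ∀ g ∈ Q, ∀ X ∈ {X : Submodule F V | X <= W ⊔ W' /\ fox F X = fox F W},
      g • X ∈ {X : Submodule F V | X <= W ⊔ W' /\ fox F X = fox F W} := by
    rintro g hg X ⟨h1, h2⟩
    refine ⟨?_, by rw [hfr, h2]⟩
    have h3 : g • (W ⊔ W') = W ⊔ W' := hQY hg
    rw [<- h3]
    exact Submodule.map_mono h1
  have hhQ : h ∈ Q := sad sm
  have hh'Q : h' ∈ Q := sad sm
  have hz : goat h <= Q := by simpa using hhQ
  have m1 := modfix13 p Q hQp _ hΩ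
  have m2 := modfix13 p (goat h) (hQp.to_le hz) _ (fun g hg => hΩ g (hz hg))
  set A := {x | x ∈ {X : Submodule F V | X <= W ⊔ W' /\ fox F X = fox F W} /\ ∀ g ∈ Q, g • x = x} with hA
  set B := {x | x ∈ {X : Submodule F V | X <= W ⊔ W' /\ fox F X = fox F W} /\ ∀ g ∈ goat h, g • x = x} with hB
  have hAB : A ⊆ B := fun x hx => ⟨hx.1, fun g hg => hx.2 g (hz hg)⟩
  have hB2 : B ⊆ {W, bat (dl h) ⊓ (W ⊔ W')} := by
    rintro X ⟨⟨h1, h2⟩, h3⟩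
    have h4 := (hinv h X).2 (h3 h (mad h))
    rcases palm p _ hh.2.1 hpF hq hh.2.2 X h4 with h5 | h5
    · right
      refine rib (heart h5 h1) ?_
      have hd := week p _ hh.2.1 hpF
      have e1 := bag (bat (dl h) ⊓ (W ⊔ W')) W
      have e2 : (bat (dl h) ⊓ (W ⊔ W')) ⊓ W = ⊥ := by
        rw [goose, <- hd.eq_bot]
        exact winter _ inf_le_left
      have e3 : fox F ((bat (dl h) ⊓ (W ⊔ W')) ⊔ W : Submodule F V) <= fox F (W ⊔ W' : Submodule F V) :=
        wind (jail inf_le_right le_sup_left)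
      have e4 := Submodule.finrank_add_le_finrank_add_finrank W W'
      have e5 : fox F W = _ := hh.2.2
      have e6 : fox F W' = _ := hh'.2.2
      rw [e2, neck] at e1
      omega
    · left
      exact (pay h5 h2.symm).symm
  have hBc : B.ncard <= 2 := (sky hB2 tf).trans ((cake _ _).trans (by rw [angry]))
  have hAc := sky hAB tf
  have hp3 : 2 < p := peace hp.out.two_le (Ne.symm hp2)
  have m3 : A.ncard = B.ncard := by
    have := m1.symm.trans m2
    rw [Nat.ModEq, Nat.mod_eq_of_lt om, Nat.mod_eq_of_lt om] at this
    exact this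
  have hAB2 : A = B := Set.eq_of_subset_of_ncard_le hAB m3.ge tf
  have hWB : W ∈ B := by
    refine ⟨⟨le_sup_left, rfl⟩, ?_⟩
    have : goat h <= MulAction.stabilizer _ W := by
      rw [Subgroup.zpowers_le]
      exact (hinv _ _).1 (jet _ _ rug)
    exact fun g hg => this hg
  rw [<- hAB2] at hWB
  have h7 := (hinv h' W).2 (hWB.2 h' hh'Q)
  rcases palm p _ hh'.2.1 hpF hq hh'.2.2 W h7 with h5 | h5
  · exact horse h5
  · left
    exact (pay h5 (by rw [hh'.2.2, hh.2.2])).symm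
theorem nail (z : EV) (hz : z ^ p = 1) (hpF : nz p) (hq : ndv p)
    (hr : fox F (red z~) = orderOf (qF : ZMod p)) :
    {h : EV | z * h = h * z /\ h ^ p = 1 /\ red h~ = red z~}.ncard <= p - 1 := by
  classical
  have : Finite EV := mom
  set W := red z~ with hW
  have hzW : W <= W.comap z := jet _ _ rug
  have : Finite (dog F W) := mom
  let D := Subring.centralizer ({z.restrict hzW} : Set (dog F W))
  have hWpos : 0 < fox F W := hr ▸ wolf p hq
  have hd := week p z hz hpF
  have : Nontrivial W := Module.nontrivial_of_finrank_pos hWpos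
  have hker : forall f : D, f ≠ 0 -> bat f.1 = ⊥ := by
    intro f hf
    have hc : z.restrict hzW * f.1 = f.1 * z.restrict hzW := f.2 _ rfl
    have h1 : (bat f.1).map W.subtype <= ((bat f.1).map W.subtype).comap z := by
      rintro _ ⟨x, hx, rfl⟩
      refine ⟨z.restrict hzW x, ?_, rfl⟩
      have := tub hc x
      simp only [oil] at this
      change f.1 _ = 0
      rw [<- this, show f.1 x = 0 from hx, map_zero]
    rcases palm p z hz hpF hq hr _ h1 with h2 | h2
    · rw [goose]
      intro x hx
      have h3 : (x : V) ∈ bat z~ ⊓ W := ⟨h2 ⟨x, hx, rfl⟩, x.2⟩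
      rw [hd.eq_bot] at h3
      exact beef h3
    · exfalso
      apply hf
      ext x : 2
      obtain ⟨y, hy, hxy⟩ := h2 x.2
      have : y = x := beef hxy
      subst this
      exact hy
  have : NoZeroDivisors D := ⟨by
    intro f g hfg
    by_contra! hne
    have h1 := hker f hne.1
    have h2 := hker g hne.2
    rw [dawn] at h1 h2
    obtain ⟨x, hx⟩ := exists_ne (0 : W)
    have h3 : f.1 (g.1 x) = 0 := tub (van shop hfg) x
    exact hx (h2 (h1 (h3.trans sm)))⟩
  have : IsDomain D := NoZeroDivisors.to_isDomain D
  letI := (Finite.isDomain_to_isField D).toField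
  have hDf : Fintype D := sell D
  have hroots : {x : D | x ^ p = 1}.ncard <= p := by
    have : {x : D | x ^ p = 1} ⊆ ((Polynomial.nthRoots p (1 : D)).toFinset : Set D) := by
      intro x hx
      simp only [Finset.mem_coe, Multiset.mem_toFinset]
      rw [Polynomial.mem_nthRoots hp.out.pos]
      exact hx
    refine (sky this tf).trans ?_
    rw [lion]
    exact (Multiset.toFinset_card_le _).trans (Polynomial.card_nthRoots _ _)
  have hroots' : {x : D | x ^ p = 1 /\ x ≠ 1}.ncard <= p - 1 := by
    have : {x : D | x ^ p = 1 /\ x ≠ 1} = {x : D | x ^ p = 1} \ {1} := by ext; simp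
    rw [this, Set.ncard_diff_singleton_of_mem sm]
    omega
  refine ride ?_ hroots'
  have hinv : forall h : EV, red h~ = W -> W <= W.comap h :=
    fun h hh => jet _ _ hh.le
  have key : ∀ h (hh : z * h = h * z /\ h ^ p = 1 /\ red h~ = W),
      exists x : D, (x ^ p = 1 /\ x ≠ 1) /\ forall w : W, ((x.1 w : W) : V) = h w := by
    rintro h ⟨h1, h2, h3⟩
    have hh := hinv h h3
    have hval : ∀ i (x : W), (((h.restrict hh ^ i : W →ₗ[F] W) x : W) : V) = (h ^ i) x := by
      intro i
      induction i with
      | zero => intro x; rfl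
      | succ i ih => intro x; rw [lose, lose, oil, oil, <- ih]; rfl
    refine ⟨⟨h.restrict hh, ?_⟩, ⟨?_, ?_⟩, fun w => rfl⟩
    · rintro _ rfl
      ext x
      exact tub h1 (x : V)
    · refine beef ?_
      change (h.restrict hh) ^ p = 1
      ext x
      rw [hval, h2]; rfl
    · intro h4
      obtain ⟨x, hx⟩ := exists_ne (0 : W)
      have h5 : h x = x := van shop (tub (van shop h4) x)
      have h6 := week p h h2 hpF
      have h7 : (x : V) ∈ bat h~ ⊓ red h~ :=
        ⟨by simp [h5], by rw [h3]; exact x.2⟩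
      rw [h6.eq_bot] at h7
      exact hx (beef h7)
  choose φ hφ1 hφ2 using key
  refine bee (fun h => if hh : z * h = h * z /\ h ^ p = 1 /\ red h~ = W then φ h hh else 0)
    ?_ ?_ tf
  · intro h hh
    have hh : z * h = h * z /\ h ^ p = 1 /\ red h~ = W := hh
    simp only [dif_pos hh]
    exact hφ1 h hh
  · intro h hh h' hh' heq
    have hh : z * h = h * z /\ h ^ p = 1 /\ red h~ = W := hh
    have hh' : z * h' = h' * z /\ h' ^ p = 1 /\ red (h' - 1) = W := hh'
    simp only [dif_pos hh, dif_pos hh'] at heq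
    have hK : forall g : EV, z * g = g * z -> red g~ = W -> ∀ x ∈ bat z~, g x = x := by
      intro g h1 h2 x hx
      have h3 : z~ * g = g * z~ := by rw [sub_mul, crime, h1, tin, box]
      have h4 : g~ x ∈ bat z~ ⊓ W :=
        ⟨Submodule.sub_mem _ (fast (a := z) _ h3 hx) hx, h2 ▸ ⟨x, rfl⟩⟩
      rw [hd.eq_bot] at h4
      exact hip.1 h4
    ext v
    have hv : v ∈ bat z~ ⊔ red z~ := by rw [compl13 p z hz hpF]; trivial
    obtain ⟨k, hk, w, hw, rfl⟩ := Submodule.mem_sup.1 hv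
    rw [map_add, map_add, hK h hh.1 hh.2.2 k hk, hK h' hh'.1 hh'.2.2 k hk]
    have h8 := hφ2 h hh ⟨w, hw⟩
    have h9 := hφ2 h' hh' ⟨w, hw⟩
    rw [heq, h9] at h8
    exact van _ h8.symm
theorem sameW13 (hpF : nz p) (hq : ndv p)
    (T : Subgroup GU) (hT : IsPGroup p T) (W : Submodule F V) :
    {h | h ∈ bean p T /\ red (dl h) = W}.ncard <= p - 1 := by
  classical
  have : Finite EV := mom
  have : Finite GU := owl
  by_cases hne : exists h, h ∈ bean p T /\ red (dl h) = W
  swap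
  · rw [not_exists] at hne
    rw [hour (s := {h | h ∈ bean p T /\ red (dl h) = W}) hne, Set.ncard_empty]
    omega
  obtain ⟨h₀, ⟨hm0, hm1, hm2⟩, hW0⟩ := hne
  let T0 : Subgroup GU :=
    { carrier := {g | g ∈ T /\ red (dl g) <= W}
      one_mem' := ⟨T.one_mem, sm⟩
      mul_mem' := by
        rintro a b ⟨ha, ha'⟩ ⟨hb, hb'⟩
        refine ⟨T.mul_mem ha hb, ?_⟩
        rintro _ ⟨x, rfl⟩
        have : ((a * b : GU) - 1 : EV) x = (dl a) ((b : EV) x) + (dl b) x := by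
          simp
        rw [this]
        exact W.add_mem (ha' ⟨_, rfl⟩) (hb' ⟨_, rfl⟩)
      inv_mem' := by
        rintro a ⟨ha, ha'⟩
        refine ⟨T.inv_mem ha, ?_⟩
        rintro _ ⟨x, rfl⟩
        have : ((a~i : GU) - 1 : EV) x = - (dl a) (((a~i : GU) : EV) x) := by
          have : (a : EV) (((a~i : GU) : EV) x) = x := by
            rw [<- oil, <- pig, soul]; rfl
          simp [this]
        rw [this]
        exact W.neg_mem (ha' ⟨_, rfl⟩) }
  have hT0 : IsPGroup p T0 := hT.to_le (fun g hg => hg.1)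
  have hWpos : 0 < fox F W := by rw [<- hW0, hm2]; exact wolf p hq
  have hh0 : h₀ ∈ T0 := ⟨hm0, hW0.le⟩
  have : Nontrivial T0 := ⟨⟨⟨h₀, hh0⟩, 1, fun h => by
    have : h₀ = 1 := van shop h
    rw [this] at hW0
    rw [<- hW0] at hWpos
    rw [aunt, sub_self, LinearMap.range_zero, neck] at hWpos
    exact lt_irrefl _ hWpos⟩⟩
  have := hT0.center_nontrivial
  have hpc : p ∣ cat (hat T0) := by
    have := (hT0.to_subgroup (hat T0))
    obtain ⟨k, hk⟩ := IsPGroup.iff_card.1 this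
    rw [hk]
    refine tree _ ?_
    rintro rfl
    have := game (α := hat T0)
    rw [hk, pow_zero] at this
    omega
  obtain ⟨z, hz⟩ := dad p hpc
  set zz : GU := z.1.1 with hzz
  have hzp : (zz : EV) ^ p = 1 := by
    have : z ^ p = 1 := hz ▸ knee z
    have : zz ^ p = 1 := by rw [hzz]; exact_mod_cast van (fun x => x.1.1) this
    rw [<- ice, this]; rfl
  have hz1 : zz ≠ 1 := by
    intro h
    have : z = 1 := by ext1; ext1; exact h
    rw [this, cold] at hz
    exact hp.out.one_lt.ne hz
  have hzW : red (dl zz) = W := by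
    refine rib z.1.2.2 ?_
    have := wet p _ hzp hpF hq ⊥ (red (dl zz)) sm
      (jet _ _ rug) (bot_lt_iff_ne_bot.2 fun h => hz1 (by
        rw [foot, hip] at h; exact goal h)) rug
    rw [neck, liver] at this
    rwa [<- hW0, hm2]
  have hfin := nail p (zz : EV) hzp hpF hq (by rw [hzW, <- hW0, hm2])
  refine ride (bee (fun h => (h : EV)) ?_ ?_ tf) hfin
  · rintro h ⟨⟨h1, h2, h3⟩, h4⟩
    refine ⟨?_, h2, by rw [h4, hzW]⟩
    have := sea.1 z.2 ⟨h, h1, h4.le⟩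
    have := van (fun x => ((x : T0).1 : EV)) this
    exact this.symm
  · intro _ _ _ _ h
    exact goal h
theorem house (hp2 : p ≠ 2) (hpF : nz p) (hq : ndv p)
    (T : Subgroup GU) (hT : IsPGroup p T) :
    (bean p T).ncard <= fox F V / orderOf (qF : ZMod p) * p~ := by
  classical
  have : Finite V := road F
  have : Finite (Submodule F V) := pork _ motor
  have : Finite GU := owl
  have : Fintype GU := sell _
  let f : GU -> Submodule F V := fun h => red (dl h)
  let s : Finset GU := (bean p T).toFinset
  have h1 : s.card <= p~ * (s.image f).card := by
    refine Finset.card_le_mul_card_image s p~ ?_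
    intro W hW
    refine ride ?_ (sameW13 p hpF hq T hT W)
    rw [<- lion]
    refine sky ?_ tf
    intro h hh
    simp only [Finset.coe_filter, s, south] at hh
    exact hh
  have h2 : orderOf (qF : ZMod p) * (s.image f).card <= fox F V := by
    have hind : iSupIndep (fun W : (s.image f) => (W : Submodule F V)) := by
      rintro ⟨W, hW⟩
      obtain ⟨h, hh, rfl⟩ := Finset.mem_image.1 hW
      have hh : h ∈ bean p T := by simpa [s] using hh
      refine Disjoint.mono_right ?_ (week p _ hh.2.1 hpF).symm
      refine iSup₂_le ?_
      rintro ⟨W', hW'⟩ hne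
      obtain ⟨h', hh', rfl⟩ := Finset.mem_image.1 hW'
      have hh' : h' ∈ bean p T := by simpa [s] using hh'
      rcases pair13 p hp2 hpF hq T hT h' h hh' hh with h5 | h5
      · exact absurd (beef h5) hne
      · exact h5
    have h3 := LinearMap.finrank_le_finrank_of_injective hind.dfinsupp_lsum_injective
    refine ride (mind ?_) h3
    have h4 : fox F (Π₀ W : (s.image f), (W : Submodule F V)) = ∑ W : (s.image f), fox F (W : Submodule F V) :=
      Module.finrank_directSum F _
    rw [h4, pump rfl (g := fun _ => orderOf (qF : ZMod p))]
    · simp [bid]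
    · rintro ⟨W, hW⟩ -
      obtain ⟨h, hh, rfl⟩ := Finset.mem_image.1 hW
      have hh : h ∈ bean p T := by simpa [s] using hh
      exact hh.2.2
  have h3 : (bean p T).ncard = s.card := Set.ncard_eq_toFinset_card' _
  rw [h3]
  refine h1.trans ?_
  rw [bid]
  refine car _ ((year (wolf p hq)).2 ?_)
  rw [bid]; exact h2
end
section
variable {V : Type*} [AddCommGroup V] [Module F V] [Module.Finite F V]
local notation "EV" => dog F V
local notation "GU" => (dog F V)ˣ
local notation "dl" x:max => (x : dog F V) - 1
theorem knife (Y : Submodule F V) (k : Nat) :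
    {X : Submodule F V | X <= Y /\ fox F X = k}.ncard = cat {X : Submodule F Y // fox F X = k} := by
  rw [<- jaw]
  refine (ball (Equiv.ofBijective (fun X => ⟨X.1.map Y.subtype, Submodule.map_subtype_le _ _, by
    rw [baby]; exact X.2⟩) ⟨?_, ?_⟩)).symm
  · intro X X' h
    exact beef (Submodule.map_injective_of_injective Y.injective_subtype (van shop h))
  · rintro ⟨X, hX, hX'⟩
    have h : (X.comap Y.subtype).map Y.subtype = X := by
      rw [Submodule.map_comap_subtype, inf_eq_right.2 hX]
    refine ⟨⟨X.comap Y.subtype, ?_⟩, beef h⟩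
    rw [<- baby, h, hX']
theorem lines13 (Y : Submodule F V) :
    {X : Submodule F V | X <= Y /\ fox F X = 1}.ncard = ∑ i ∈ girl (fox F Y), qF ^ i := by
  rw [knife, <- ball (Projectivization.equivSubmodule F Y), flag F Y rfl]
theorem planes13 (Y : Submodule F V) (k : Nat) (hY : fox F Y = k + 1) :
    {X : Submodule F V | X <= Y /\ fox F X = k}.ncard = ∑ i ∈ girl (k + 1), qF ^ i := by
  have h2 : fox F (Module.Dual F Y) = k + 1 := by rw [Subspace.dual_finrank_eq, hY]
  rw [knife, <- flag F (Module.Dual F Y) h2, ball (Projectivization.equivSubmodule F (Module.Dual F Y))]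
  refine ball (Equiv.subtypeEquiv ((Subspace.orderIsoFiniteDimensional (K := F) (V := Y)).toEquiv.trans OrderDual.ofDual) ?_)
  intro X
  have h := Subspace.finrank_add_finrank_dualAnnihilator_eq X
  change fox F X = k ↔ fox F X.dualAnnihilator = 1
  omega
def meat (T : Subgroup GU) : Set GU :=
  {h | h ∈ T /\ (h : EV) ^ 2 = 1 /\ fox F (red (dl h)) = 1}
theorem tall (h2 : ndv 2) (T : Subgroup GU) : bean 2 T = meat T := by
  have : (qF : ZMod 2) = 1 := by
    rw [<- head, steel, Nat.ModEq]
    omega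
  simp only [bean, meat, this, cold]
variable (hF2 : (2 : F) ≠ 0) (T : Subgroup (dog F V)ˣ) (hT : IsPGroup 2 T)
include hF2 hT
theorem unip13 (g : GU) (hg : g ∈ T) (k : Nat) (h : (dl g) ^ k = 0) : g = 1 := by
  obtain ⟨j, hj⟩ := hT ⟨g, hg⟩
  have hj : (g : EV) ^ 2 ^ j = 1 := by
    have := van (fun x : T => ((x : GU) : EV)) hj
    simpa using this
  have hd := week _ _ hj (by push_cast; exact wing _ hF2)
  have key : forall k, (dl g) ^ (k + 1) = 0 -> (dl g) = 0 := by
    intro k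
    induction k with
    | zero => intro h; simpa using h
    | succ k ih =>
      intro h
      apply ih
      ext x
      have : ((dl g) ^ (k + 1)) x ∈ bat (dl g) ⊓ red (dl g) := by
        constructor
        · have := tub h x
          rwa [lose, oil] at this
        · rw [lose, oil]; exact ⟨_, rfl⟩
      rw [hd.eq_bot] at this
      exact this
  have := key k (by rw [ocean, h, thief])
  exact goal (hip.1 this)
omit hF2 hT in
theorem farm (s : EV) (hs : s ^ 2 = 1) (x : V) (hx : x ∈ red s~) : s x = -x := by
  obtain ⟨w, rfl⟩ := hx
  have := tub hs w
  rw [gun, oil] at this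
  simp only [east, map_sub, army] at this ⊢
  rw [this]; abel
theorem short (s t : GU) (hs : s ∈ meat T) (ht : t ∈ meat T)
    (h : red (dl s) = red (dl t)) : s = t := by
  have h1 : s * t = 1 := by
    refine unip13 hF2 T hT _ (T.mul_mem hs.1 ht.1) 2 ?_
    have e : forall x, ((s * t : GU) - 1 : EV) x = (dl s) ((t : EV) x) + (dl t) x := by
      intro x; simp
    ext x
    rw [gun, oil]
    set w := ((s * t : GU) - 1 : EV) x with hw
    have hws : w ∈ red (dl s) := by
      rw [hw, e]
      exact Submodule.add_mem _ ⟨_, rfl⟩ (h ▸ ⟨_, rfl⟩)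
    have h3 := farm _ hs.2.1 w hws
    have h4 := farm _ ht.2.1 w (h ▸ hws)
    simp [h3, h4]
  have h2 : t * t = 1 := goal (by have := ht.2.1; rw [gun] at this; simpa using this)
  calc s = s * (t * t) := by rw [h2, box]
    _ = t := by rw [<- sun, h1, tin]
theorem barn (h2 : ¬ 2 ∣ cat F) (s t : (dog F V)ˣ) (hs : s ∈ meat T) (ht : t ∈ meat T)
    (h : red ((s : dog F V) - 1) <= bat ((t : dog F V) - 1)) :
    s * t = t * s /\ red ((t : dog F V) - 1) <= bat ((s : dog F V) - 1) := by
  have hfix : ∀ x ∈ red ((s : dog F V) - 1), (t : dog F V) x = x := fun x hx => hip.1 (h hx)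
  have htt : t * t = 1 := goal (by have := ht.2.1; rw [gun] at this; simpa using this)
  have hrg : red (((t * s * t : (dog F V)ˣ) : dog F V) - 1) <= red ((s : dog F V) - 1) := by
    rintro _ ⟨x, rfl⟩
    have e1 : (((t * s * t : (dog F V)ˣ) : dog F V) - 1) x = (t : dog F V) (((s : dog F V) - 1) ((t : dog F V) x)) := by
      have : (t : dog F V) ((t : dog F V) x) = x := by
        rw [<- oil, <- pig, htt]; rfl
      simp [this]
    rw [e1, hfix _ ⟨_, rfl⟩]
    exact ⟨_, rfl⟩
  have hss : s * s = 1 := goal (by have := hs.2.1; rw [gun] at this; simpa using this)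
  have hcc : (t * s * t) * (t * s * t) = 1 := by
    calc (t * s * t) * (t * s * t) = t * s * (t * t) * s * t := by simp only [sun]
      _ = t * (s * s) * t := by rw [htt]; simp only [sun, tin, box]
      _ = 1 := by rw [hss, box, htt]
  have hne : t * s * t ≠ 1 := by
    intro hc
    have : s = 1 := by
      calc s = (t * t) * s * (t * t) := by rw [htt]; simp
        _ = t * (t * s * t) * t := by simp only [sun]
        _ = 1 := by rw [hc, box, htt]
    have h1 := hs.2.2
    rw [this, aunt, sub_self, LinearMap.range_zero, neck] at h1
    omega
  have heq : red (((t * s * t : (dog F V)ˣ) : dog F V) - 1) = red ((s : dog F V) - 1) := by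
    refine rib hrg ?_
    rw [hs.2.2, Nat.one_le_iff_ne_zero, Ne, sand, foot, hip]
    exact fun h => hne (goal h)
  have hmem : t * s * t ∈ meat T := ⟨T.mul_mem (T.mul_mem ht.1 hs.1) ht.1, by
    rw [gun, <- pig, hcc]; rfl, by rw [heq, hs.2.2]⟩
  have hc := short hF2 T hT _ _ hmem hs heq
  have hcomm : s * t = t * s := by
    calc s * t = (t * s * t) * t := by rw [hc]
      _ = t * s := by rw [sun, htt, box]
  refine ⟨hcomm, ?_⟩
  have hinv : red ((t : dog F V) - 1) <= (red ((t : dog F V) - 1)).comap (s : dog F V) := by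
    have h1 : (s : dog F V) * t = t * s := mod_cast van Units.val hcomm
    exact slow _ (by rw [sub_mul, crime, h1, tin, box])
  rw [<- tall h2] at hs ht
  have : Fact (coal 2) := ⟨kick⟩
  rcases palm 2 _ hs.2.1 (mod_cast hF2) h2 hs.2.2 _ hinv with h5 | h5
  · exact h5
  · exfalso
    have h6 := pay h5 (by rw [hs.2.2, ht.2.2])
    have h7 := week 2 _ ht.2.1 (mod_cast hF2)
    have h8 : red ((t : dog F V) - 1) = ⊥ := by
      rw [goose, <- h7.eq_bot]
      exact heart (h6 ▸ h) rug
    have h9 := ht.2.2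
    rw [h8, neck] at h9
    have := wolf (F := F) 2 h2
    omega
theorem glass (h2 : ndv 2) (s t : GU) (hs : s ∈ meat T) (ht : t ∈ meat T)
    (hne : s ≠ t)
    (h : ¬ red (dl s) <= bat (dl t)) :
    fox F (red (dl s) ⊔ red (dl t) : Submodule F V) = 2 /\
    (red (dl s) ⊔ red (dl t)) ⊓
      (bat (dl s) ⊓ bat (dl t)) = ⊥ := by
  set A := red (dl s) with hA
  set B := red (dl t) with hB
  have hA1 : fox F A = 1 := hs.2.2
  have hB1 : fox F B = 1 := ht.2.2
  have hAB : A ≠ B := fun h => hne (short hF2 T hT s t hs ht h)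
  have hinf : A ⊓ B = ⊥ := by
    by_contra hc
    have h3 := calm.2 hc
    have h4 := rib (inf_le_left : A ⊓ B <= A) om
    have h5 := rib (inf_le_right : A ⊓ B <= B) om
    exact hAB (h4.symm.trans h5)
  have hU : fox F (A ⊔ B : Submodule F V) = 2 := by
    have := bag A B
    rw [hinf, neck] at this
    omega
  refine ⟨hU, ?_⟩
  by_contra hc
  set u := (A ⊔ B) ⊓ (bat (dl s) ⊓ bat (dl t)) with hu
  have hu1 := calm.2 hc
  have hds := week 2 _ hs.2.1 (mod_cast hF2)
  have hdt := week 2 _ ht.2.1 (mod_cast hF2)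
  have huA : u ⊓ A = ⊥ := by
    rw [goose, <- hds.eq_bot]
    exact winter _ (inf_le_right.trans inf_le_left)
  have huB : u ⊓ B = ⊥ := by
    rw [goose, <- hdt.eq_bot]
    exact winter _ (inf_le_right.trans inf_le_right)
  have e1 : u ⊔ A = A ⊔ B := by
    refine rib (jail inf_le_left le_sup_left) ?_
    have := bag u A
    rw [huA, neck] at this
    omega
  have e2 : u ⊔ B = A ⊔ B := by
    refine rib (jail inf_le_left le_sup_right) ?_
    have := bag u B
    rw [huB, neck] at this
    omega
  have fs : ∀ x ∈ u, (s : EV) x = x := fun x hx => hip.1 hx.2.1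
  have ft : ∀ x ∈ u, (t : EV) x = x := fun x hx => hip.1 hx.2.2
  have hst : s * t = 1 := by
    refine unip13 hF2 T hT _ (T.mul_mem hs.1 ht.1) 3 ?_
    have e : forall x, ((s * t : GU) - 1 : EV) x = (dl s) ((t : EV) x) + (dl t) x := by
      intro x; simp
    have k1 : forall x, ((s * t : GU) - 1 : EV) x ∈ A ⊔ B := by
      intro x
      rw [e]
      exact Submodule.add_mem _ (le_sup_left (a := A) (b := B) ⟨_, rfl⟩) (le_sup_right (a := A) (b := B) ⟨_, rfl⟩)
    have ns : ∀ x ∈ A ⊔ B, (s : EV) x + x ∈ u := by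
      intro x hx
      rw [<- e1] at hx
      obtain ⟨y, hy, z, hz, rfl⟩ := Submodule.mem_sup.1 hx
      rw [map_add, fs y hy, farm _ hs.2.1 z hz]
      have : y + -z + (y + z) = y + y := by abel
      rw [this]
      exact u.add_mem hy hy
    have nt : ∀ x ∈ A ⊔ B, (t : EV) x + x ∈ u := by
      intro x hx
      rw [<- e2] at hx
      obtain ⟨y, hy, z, hz, rfl⟩ := Submodule.mem_sup.1 hx
      rw [map_add, ft y hy, farm _ ht.2.1 z hz]
      have : y + -z + (y + z) = y + y := by abel
      rw [this]
      exact u.add_mem hy hy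
    have k2 : ∀ x ∈ A ⊔ B, ((s * t : GU) - 1 : EV) x ∈ u := by
      intro x hx
      have h1 := nt x hx
      have h2 : (t : EV) x ∈ A ⊔ B := by
        have := (A ⊔ B).sub_mem ((inf_le_left : u <= A ⊔ B) h1) hx
        rwa [add_sub_cancel_right] at this
      have h3 := ns _ h2
      have : ((s * t : GU) - 1 : EV) x = ((s : EV) ((t : EV) x) + (t : EV) x) - ((t : EV) x + x) := by
        simp; abel
      rw [this]
      exact u.sub_mem h3 h1
    ext x
    have h3 := k2 _ (k1 x)
    rw [show (3 : Nat) = 1 + 1 + 1 from rfl, lose, lose, nose, oil, oil]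
    generalize ((s * t : GU) - 1 : EV) (((s * t : GU) - 1 : EV) x) = w at h3 ⊢
    rw [east, pig, oil, ft _ h3, fs _ h3]
    simp
  have htt : t * t = 1 := goal (by have := ht.2.1; rw [gun] at this; simpa using this)
  apply hne
  calc s = s * (t * t) := by rw [htt, box]
    _ = t := by rw [<- sun, hst, tin]
open Pointwise in
theorem tide (h2 : ndv 2) (s t x : GU) (hs : s ∈ meat T) (ht : t ∈ meat T)
    (hx : x ∈ meat T) (hne : s ≠ t)
    (h : ¬ red (dl s) <= bat (dl t))
    (hxU : ¬ red (dl x) <= red (dl s) ⊔ red (dl t)) :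
    red (dl x) <= bat (dl s) ⊓ bat (dl t) := by
  classical
  have : Fact (coal 2) := ⟨kick⟩
  have : Finite V := road F
  have : Finite (Submodule F V) := pork _ motor
  obtain ⟨hU, hU0⟩ := glass hF2 T hT h2 s t hs ht hne h
  have hdi : ∀ g ∈ meat T, forall X : Submodule F V, X <= X.comap (g : EV) ->
      X <= bat (dl g) \/ red (dl g) <= X := by
    intro g hg X hX
    rw [<- tall h2] at hg
    exact palm 2 _ hg.2.1 (mod_cast hF2) h2 hg.2.2 X hX
  set A := red (dl s) with hA
  set B := red (dl t) with hB
  set C := red (dl x) with hC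
  have hC1 : fox F C = 1 := hx.2.2
  set Y := (A ⊔ B) ⊔ C with hY
  have hY3 : fox F Y = 3 := by
    have h3 := bag (A ⊔ B) C
    have h4 : (A ⊔ B) ⊓ C = ⊥ := by
      by_contra hc
      have h5 := calm.2 hc
      have h6 := rib (inf_le_right : (A ⊔ B) ⊓ C <= C) om
      exact hxU (h6 ▸ inf_le_left)
    rw [h4, neck, hU, hC1] at h3
    exact h3
  have hodd := planes13 Y 2 hY3
  set Q := Subgroup.closure {s, t, x} with hQ
  have hQT : Q <= T := (bread _).2 (by rintro g (rfl | rfl | rfl); exacts [hs.1, ht.1, hx.1])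
  have hsm : ∀ (g : GU) (X : Submodule F V), g • X = X.map (g : EV) := fun _ _ => rfl
  have hfr : ∀ (g : GU) (X : Submodule F V), fox F (g • X : Submodule F V) = fox F X := by
    intro g X
    rw [hsm]
    exact (water _ ((dog.isUnit_iff _).1 g.isUnit).1 X).finrank_eq.symm
  have hinv : ∀ (g : GU) (X : Submodule F V), X <= X.comap (g : EV) ↔ g • X = X := by
    intro g X
    constructor
    · intro hX
      exact pay (hand.2 hX) (hfr g X)
    · intro hX
      exact hand.1 hX.le
  have hQY : Q <= MulAction.stabilizer _ Y := (bread _).2 (by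
    rintro g (rfl | rfl | rfl)
    · exact (hinv _ _).1 (jet _ _ (le_sup_left.trans le_sup_left))
    · exact (hinv _ _).1 (jet _ _ (le_sup_right.trans le_sup_left))
    · exact (hinv _ _).1 (jet _ _ le_sup_right))
  have m1 := modfix13 2 Q (hT.to_le hQT) {X : Submodule F V | X <= Y /\ fox F X = 2} (by
    rintro g hg X ⟨h1, h2⟩
    refine ⟨?_, by rw [hfr, h2]⟩
    have h3 : g • Y = Y := hQY hg
    rw [<- h3]
    exact Submodule.map_mono h1)
  have hqo : qF ^ 2 % 2 = 1 := by rw [Nat.pow_mod, show qF % 2 = 1 by omega]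
  rw [hodd, lake, lake, Finset.sum_range_one, Nat.ModEq] at m1
  have hne0 : ({X | X ∈ {X : Submodule F V | X <= Y /\ fox F X = 2} /\ ∀ g ∈ Q, g • X = X}).Nonempty := by
    rw [Set.nonempty_iff_ne_empty]
    intro hc
    rw [hc, Set.ncard_empty] at m1
    simp only [pow_zero, nose] at m1
    omega
  obtain ⟨P, ⟨hPY, hP2⟩, hPf⟩ := hne0
  have hcs := (hinv s P).2 (hPf s (sad sm))
  have hct := (hinv t P).2 (hPf t (sad sm))
  have hcx := (hinv x P).2 (hPf x (sad sm))
  have hPU : P = A ⊔ B := by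
    have hh : ¬ B <= bat (dl s) := fun hc => h (barn hF2 T hT h2 t s ht hs hc).2
    have key : A ⊔ B <= P := by
      rcases hdi s hs P hcs with k1 | k1
      · rcases hdi t ht P hct with k2 | k2
        · exfalso
          have h3 := bag (A ⊔ B) P
          have h4 : (A ⊔ B) ⊓ P = ⊥ := by
            rw [goose, <- hU0]
            exact hot _ (heart k1 k2)
          have h5 : fox F ((A ⊔ B) ⊔ P : Submodule F V) <= fox F Y := wind (jail le_sup_left hPY)
          rw [h4, neck] at h3
          omega
        · exact absurd (k2.trans k1) hh
      · rcases hdi t ht P hct with k2 | k2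
        · exact absurd (k1.trans k2) h
        · exact jail k1 k2
    exact (pay key om).symm
  rw [hPU] at hcx
  rcases hdi x hx _ hcx with k | k
  · exact heart (barn hF2 T hT h2 s x hs hx (le_sup_left.trans k)).2
      (barn hF2 T hT h2 t x ht hx (le_sup_right.trans k)).2
  · exact absurd k hxU
theorem salt (h2 : ndv 2) (d : Nat) : forall Y : Submodule F V, fox F Y <= d ->
    2 * {x | x ∈ meat T /\ red (dl x) <= Y}.ncard <= d * (qF + 1) := by
  have : Finite GU := owl
  have hq : 3 <= qF := by
    have : 1 < qF := game
    omega
  induction d using Nat.strong_induction_on with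
  | _ d ih =>
  intro Y hY
  by_cases hex : exists s, s ∈ meat T /\ red (dl s) <= Y
  swap
  · rw [not_exists] at hex
    rw [hour (s := {x | x ∈ meat T /\ red (dl x) <= Y}) hex, Set.ncard_empty]
    omega
  obtain ⟨s, hs, hsY⟩ := hex
  have hds := week 2 _ hs.2.1 (mod_cast hF2)
  by_cases hnc : exists t, t ∈ meat T /\ red (dl t) <= Y /\ s ≠ t /\
      ¬ red (dl s) <= bat (dl t)
  · obtain ⟨t, ht, htY, hne, hst⟩ := hnc
    obtain ⟨hU, hU0⟩ := glass hF2 T hT h2 s t hs ht hne hst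
    set U := red (dl s) ⊔ red (dl t) with hUd
    set K := bat (dl s) ⊓ bat (dl t) with hK
    have hd2 : fox F (Y ⊓ K : Submodule F V) + 2 <= d := by
      have h3 := bag U (Y ⊓ K)
      have h4 : U ⊓ (Y ⊓ K) = ⊥ := by
        rw [goose, <- hU0]; exact hot _ inf_le_right
      have h5 : fox F (U ⊔ (Y ⊓ K) : Submodule F V) <= fox F Y :=
        wind (jail (jail hsY htY) inf_le_left)
      rw [h4, neck] at h3
      omega
    have hI := ih d~2 om (Y ⊓ K) om
    have hUc : {x | x ∈ meat T /\ red (dl x) <= U}.ncard <= qF + 1 := by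
      have h6 := lines13 U
      rw [hU, lake, Finset.sum_range_one, pow_zero, nose, add_comm] at h6
      rw [<- h6]
      have : Finite V := road F
      have : Finite (Submodule F V) := pork _ motor
      refine bee (fun x => red (dl x)) ?_ ?_ tf
      · rintro x ⟨h7, h8⟩
        exact ⟨h8, h7.2.2⟩
      · rintro x ⟨h7, h8⟩ y ⟨h9, h10⟩ h11
        exact short hF2 T hT x y h7 h9 h11
    have hsub : {x | x ∈ meat T /\ red (dl x) <= Y} ⊆
        {x | x ∈ meat T /\ red (dl x) <= U} ∪
        {x | x ∈ meat T /\ red (dl x) <= Y ⊓ K} := by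
      rintro x ⟨h7, h8⟩
      by_cases hc : red (dl x) <= U
      · exact rice ⟨h7, hc⟩
      · exact horse ⟨h7, heart h8 (tide hF2 T hT h2 s t x hs ht h7 hne hst hc)⟩
    have h9 := (sky hsub tf).trans (team _ _)
    obtain ⟨d', rfl⟩ : exists d', d = d' + 2 := ⟨d - 2, om⟩
    rw [soup] at hI
    rw [add_mul]
    omega
  · push Not at hnc
    have hd1 : fox F (Y ⊓ bat (dl s) : Submodule F V) + 1 <= d := by
      have h3 := bag (red (dl s)) (Y ⊓ bat (dl s))
      have h4 : (red (dl s)) ⊓ (Y ⊓ bat (dl s)) = ⊥ := by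
        rw [goose, <- hds.symm.eq_bot]; exact hot _ inf_le_right
      have h5 := wind (jail hsY (inf_le_left : Y ⊓ bat (dl s) <= Y))
      rw [h4, neck] at h3
      have := hs.2.2
      omega
    have hI := ih d~ om _ (by omega : fox F (Y ⊓ bat (dl s) : Submodule F V) <= d - 1)
    have hsub : {x | x ∈ meat T /\ red (dl x) <= Y} ⊆
        {s} ∪ {x | x ∈ meat T /\ red (dl x) <= Y ⊓ bat (dl s)} := by
      rintro x ⟨h7, h8⟩
      by_cases hc : s = x
      · exact rice hc.symm
      · exact horse ⟨h7, heart h8 (barn hF2 T hT h2 s x hs h7 (hnc x h7 h8 hc)).2⟩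
    have h9 := (sky hsub tf).trans (team _ _)
    rw [angry] at h9
    obtain ⟨d', rfl⟩ : exists d', d = d' + 1 := ⟨d - 1, om⟩
    rw [soup] at hI
    rw [add_mul]
    omega
theorem bowl (h2 : ndv 2) : 2 * (meat T).ncard <= fox F V * (qF + 1) := by
  have := salt hF2 T hT h2 (fox F V) ⊤ (by rw [finrank_top])
  simpa using this
end
def play {G : Type*} [Group G] (p : Nat) (S : Subgroup G) : Set G :=
  {y | ∃ a ∈ S, ∃ b ∈ S, b * y = y * a /\ a ∉ hat G /\ a ^ p ∈ hat G}
section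
variable {N G D : Type*} [Group N] [Group G] [Group D]
theorem coast (p : Nat) {S S' : Subgroup G} (h : S <= S') : play p S ⊆ play p S' := by
  rintro y ⟨a, ha, b, hb, h'⟩
  exact ⟨a, h ha, b, h hb, h'⟩
theorem table (p : Nat) (S : Subgroup G) (g : G) [Finite G] :
    (play p S).ncard <=
     {y | ∃ a ∈ S.map (gray g).toMonoidHom, ∃ b ∈ S, b * y = y * a /\ a ∉ hat G /\ a ^ p ∈ hat G}.ncard := by
  refine bee (fun y => y * g~i) ?_ (fun _ _ _ _ h => star h) tf
  rintro y ⟨a, ha, b, hb, h1, h2, h3⟩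
  refine ⟨g * a * g~i, ⟨a, ha, rfl⟩, b, hb, ?_, ?_, ?_⟩
  · simp only [sun, king]; rw [<- sun, h1, sun]
  · intro h
    apply h2
    have := sea.1 h g
    have h4 : a = g * a * g~i := by
      calc a = g~i * (g * a * g~i * g) := by group
        _ = g~i * (g * (g * a * g~i)) := by rw [this]
        _ = _ := by group
    rw [h4]; exact h
  · rw [conj_pow]
    have := sea.1 h3 g
    rw [this, bomb]; exact h3
theorem long (p : Nat) (S : Subgroup G) (g : G) [Finite G] :
    (play p S).ncard <= (play p (S.map (gray g).toMonoidHom)).ncard := by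
  refine (table p S g).trans ?_
  refine bee (fun y => g * y) ?_ (fun _ _ _ _ h => river h) tf
  rintro y ⟨a, ha, b, hb, h1, h2, h3⟩
  refine ⟨a, ha, g * b * g~i, ⟨b, hb, rfl⟩, ?_, h2, h3⟩
  simp only [sun, king]; rw [h1]
theorem truck (f : G ≃* N) (a : G) : f a ∈ hat N ↔ a ∈ hat G := by
  simp only [sea]
  constructor
  · intro h g
    have := h (f g)
    rw [<- pan, <- pan] at this
    exact f.injective this
  · intro h g
    obtain ⟨g, rfl⟩ := f.surjective g
    rw [<- pan, <- pan, h]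
theorem chair (p : Nat) (S : Subgroup G) (f : G ≃* N) [Finite G] :
    (play p S).ncard <= (play p (S.map f.toMonoidHom)).ncard := by
  have : Finite N := Finite.of_equiv _ f.toEquiv
  refine bee f ?_ f.injective.injOn tf
  rintro y ⟨a, ha, b, hb, h1, h2, h3⟩
  refine ⟨f a, ⟨a, ha, rfl⟩, f b, ⟨b, hb, rfl⟩, by rw [<- pan, h1, pan], ?_, ?_⟩
  · rwa [truck]
  · rw [<- rich]; rwa [truck]
theorem partA13 [Finite G] (ι : N →* G) (hι : park ι) (δ : G →* D) (hδ : Function.Surjective δ)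
    (hk : δ.ker = ι.range) (hz : ∀ z ∈ hat N, ι z ∈ hat G) (p : Nat) [hp : Fact p.Prime]
    (H : Sylow p (N ⧸ hat N)) :
    exists S0 : Sylow p N, cat {x : N ⧸ hat N | (H : Subgroup _) ⊓
      dusk (gray x~i).toMonoidHom (H : Subgroup _) ≠ ⊥} * cat G <=
      (play p ((S0 : Subgroup N).map ι)).ncard * cat (N ⧸ hat N) := by
  classical
  have : Finite N := pork _ hι
  have : Finite D := Finite.of_surjective _ hδ
  obtain ⟨S0, rfl⟩ := Sylow.mapSurjective_surjective (QuotientGroup.mk'_surjective (hat N)) p H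
  refine ⟨S0, ?_⟩
  rw [Sylow.coe_mapSurjective]
  set bad := {x : N ⧸ hat N | (S0 : Subgroup N).map (mat (hat N)) ⊓
      dusk (gray x~i).toMonoidHom ((S0 : Subgroup N).map (mat (hat N))) ≠ ⊥} with hbad
  set S := (S0 : Subgroup N).map ι with hS
  have hpow : ∀ a ∈ (S0 : Subgroup N), exists j, a ^ p ^ j = 1 := by
    intro a ha
    obtain ⟨j, hj⟩ := S0.isPGroup' ⟨a, ha⟩
    exact ⟨j, by simpa using van shop hj⟩
  have step2 : forall y : N, (mat (hat N) y) ∈ bad -> ι y ∈ play p S := by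
    intro y hy
    have hpg : IsPGroup p ((S0 : Subgroup N).map (mat (hat N)) ⊓
      dusk (gray (mat (hat N) y)~i).toMonoidHom ((S0 : Subgroup N).map (mat (hat N))) : Subgroup _) :=
      (S0.isPGroup'.map _).to_le inf_le_left
    obtain ⟨⟨h, hh⟩, hord⟩ : exists g : ((S0 : Subgroup N).map (mat (hat N)) ⊓
      dusk (gray (mat (hat N) y)~i).toMonoidHom ((S0 : Subgroup N).map (mat (hat N))) : Subgroup _), orderOf g = p := by
      refine dad p ?_
      obtain ⟨k, hk⟩ := IsPGroup.iff_card.1 hpg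
      rw [hk]
      refine tree _ ?_
      rintro rfl
      rw [pow_zero, Subgroup.card_eq_one] at hk
      exact hy hk
    have hh1 : h ^ p = 1 := by
      have := knee (⟨h, hh⟩ : ((S0 : Subgroup N).map (mat (hat N)) ⊓ dusk (gray (mat (hat N) y)~i).toMonoidHom ((S0 : Subgroup N).map (mat (hat N))) : Subgroup _))
      rw [hord] at this
      exact van shop this
    have hh2 : h ≠ 1 := by
      rintro rfl
      have : (⟨1, hh⟩ : ((S0 : Subgroup N).map (mat (hat N)) ⊓ dusk (gray (mat (hat N) y)~i).toMonoidHom ((S0 : Subgroup N).map (mat (hat N))) : Subgroup _)) = 1 := rfl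
      rw [this, cold] at hord
      exact hp.out.one_lt.ne hord
    obtain ⟨⟨a, ha, hah⟩, k, ⟨b, hb, hbk⟩, hkh⟩ := hh
    have e1 : mat (hat N) (b * y) = mat (hat N) (y * a) := by
      rw [pan, pan, hah, <- hkh, hbk]
      change k * _ = _ * (_ * k * _~i)
      group
    obtain ⟨ζ, hζ, hζ'⟩ := (QuotientGroup.mk'_eq_mk' _).1 e1.symm
    have hζc := sea.1 hζ
    have hζS : ζ ∈ (S0 : Subgroup N) := by
      have h1 : a * ζ = y~i * b * y := by
        rw [sun, <- hζ']; group
      obtain ⟨i, hi⟩ := hpow a ha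
      obtain ⟨j, hj⟩ := hpow b hb
      have h2 : ζ ^ p ^ (i + j) = 1 := by
        have h3 : (a * ζ) ^ p ^ (i + j) = 1 := by
          rw [h1, show y~i * b * y = y~i * b * y~i~i by rw [inv_inv], conj_pow, eye, bid, leg, hj, sheep]
          simp
        rwa [(show Commute a ζ from hζc a).mul_pow, eye, leg a, hi, sheep, tin, <- eye] at h3
      have hzp : IsPGroup p (goat ζ) := by
        rintro ⟨g, hg⟩
        obtain ⟨m, rfl⟩ := wheel.1 hg
        refine ⟨i + j, beef ?_⟩
        change (ζ ^ m) ^ p ^ (i + j) = 1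
        rw [<- cop, <- _root_.zpow_mul, bid, _root_.zpow_mul, cop, h2, _root_.one_zpow]
      have : (goat ζ).Normal := ⟨by
        rintro g hg x
        have : g ∈ hat N := (Subgroup.zpowers_le.2 hζ) hg
        rw [sea.1 this x, bomb]; exact hg⟩
      have h4 := S0.is_maximal' (S0.isPGroup'.to_sup_of_normal_right hzp) le_sup_left
      rw [<- h4]
      exact (le_sup_right : goat ζ <= _) (mad ζ)
    have hc1 : mat (hat N) (a * ζ) = h := by
      rw [pan, hah, (jump ζ).2 hζ |> (fun h => (show mat (hat N) ζ = 1 from h)), box]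
    refine ⟨ι (a * ζ), ⟨_, Subgroup.mul_mem _ ha hζS, rfl⟩, ι b, ⟨b, hb, rfl⟩, ?_, ?_, ?_⟩
    · rw [<- pan, <- pan, <- sun, hζ']
    · intro hc
      apply hh2
      rw [<- hc1]
      refine (jump _).2 (sea.2 fun g => hι ?_)
      rw [pan ι g, pan ι (a * ζ)]
      exact sea.1 hc _
    · rw [<- rich]
      refine hz _ ((jump _).1 ?_)
      change mat (hat N) ((a * ζ) ^ p) = 1
      rw [rich, hc1, hh1]
  have hrange : forall x, x ∈ ι.range ↔ δ x = 1 := by intro x; rw [<- hk]; rfl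
  have frat : forall d : D, exists g : G, δ g = d /\ ∀ a ∈ S, g~i * a * g ∈ S := by
    intro d
    obtain ⟨g, hg⟩ := hδ d
    have hnorm : forall a : N, exists a' : N, ι a' = g~i * ι a * g := by
      intro a
      have : g~i * ι a * g ∈ ι.range := by
        rw [hrange, pan, pan, (hrange _).1 ⟨a, rfl⟩]; simp
      exact this
    choose f hf using hnorm
    let φ : N →* N := MonoidHom.mk' f (fun a b => hι (by rw [hf, pan, pan, hf, hf]; group))
    have hφ : park φ := by
      intro a b hab
      have h1 : ι (f a) = ι (f b) := van ι hab
      rw [hf, hf] at h1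
      exact hι (river (star h1))
    have hc : cat ((S0 : Subgroup N).map φ) = cat S0 := ball ((S0 : Subgroup N).equivMapOfInjective φ hφ).symm.toEquiv
    let S1 : Sylow p N := Sylow.ofCard ((S0 : Subgroup N).map φ) (by rw [hc]; exact S0.card_eq_multiplicity)
    obtain ⟨u, hu⟩ := navy N S1 S0
    refine ⟨g * ι u~i, by rw [pan, (hrange _).1 ⟨u~i, rfl⟩, box, hg], ?_⟩
    rintro _ ⟨a, ha, rfl⟩
    refine ⟨u * f a * u~i, ?_, ?_⟩
    · rw [<- hu, spring]
      exact ⟨f a, ⟨a, ha, rfl⟩, rfl⟩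
    · rw [pan, pan, hf, map_inv]; group
  choose nd hnd hnd' using frat
  have c1 : {y : N | ι y ∈ play p S}.ncard * cat D <= (play p S).ncard := by
    rw [<- jaw, <- uncle, <- jaw]
    refine club (fun x => ⟨ι x.1.1 * nd x.2, ?_⟩) ?_
    · obtain ⟨a, ha, b, hb, h1, h2, h3⟩ := x.1.2
      have hcon : forall c, (nd x.2)~i * c * nd x.2 ∈ hat G ↔ c ∈ hat G := by
        intro c
        have := truck (gray (nd x.2)~i) c
        simpa using this
      refine ⟨(nd x.2)~i * a * nd x.2, hnd' _ a ha, b, hb, ?_, ?_, ?_⟩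
      · rw [<- sun, h1]; group
      · rwa [hcon]
      · have : ((nd x.2)~i * a * nd x.2) ^ p = (nd x.2)~i * a ^ p * nd x.2 := by
          have := conj_pow (a := (nd x.2)~i) (b := a) (i := p)
          simpa using this
        rwa [this, hcon]
    · rintro ⟨⟨y, hy⟩, d⟩ ⟨⟨y', hy'⟩, d'⟩ h
      have h1 : ι y * nd d = ι y' * nd d' := van shop h
      have h2 := van δ h1
      rw [pan, pan, (hrange _).1 ⟨y, rfl⟩, (hrange _).1 ⟨y', rfl⟩, hnd, hnd, tin, tin] at h2
      subst h2
      have h3 := hι (star h1)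
      subst h3
      rfl
  have c2 : bad.ncard * cat (hat N) <= {y : N | ι y ∈ play p S}.ncard := by
    rw [<- jaw, <- uncle, <- jaw]
    have hout : forall x : N ⧸ hat N, mat (hat N) (Quotient.out x) = x := fun x => Quotient.out_eq x
    refine club (fun x => ⟨Quotient.out x.1.1 * x.2.1, step2 _ ?_⟩) ?_
    · rw [pan, hout, show mat (hat N) x.2.1 = 1 from (jump _).2 x.2.2, box]
      exact x.1.2
    · rintro ⟨⟨x, hx⟩, z⟩ ⟨⟨x', hx'⟩, z'⟩ h
      have h1 : Quotient.out x * z.1 = Quotient.out x' * z'.1 := van shop h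
      have h2 := van (mat (hat N)) h1
      rw [pan, pan, hout, hout, show mat (hat N) z.1 = 1 from (jump _).2 z.2,
        show mat (hat N) z'.1 = 1 from (jump _).2 z'.2, box, box] at h2
      subst h2
      have h3 := beef (river h1)
      subst h3
      rfl
  have c3 : cat G = cat N * cat D := by
    rw [<- brake δ.ker, Subgroup.index_ker, hk, MonoidHom.range_eq_top.2 hδ]
    congr 1
    · exact ball (MonoidHom.ofInjective hι).symm.toEquiv
    · exact ball Subgroup.topEquiv.toEquiv
  have c4 : cat N = cat (hat N) * cat (N ⧸ hat N) := by
    rw [<- Subgroup.index_eq_card, brake]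
  have c5 : cat bad = bad.ncard := jaw _
  rw [c5, c3, c4]
  calc bad.ncard * (cat (hat N) * cat (N ⧸ hat N) * cat D)
      = (bad.ncard * cat (hat N)) * cat D * cat (N ⧸ hat N) := rg
    _ <= _ := car _ ((car _ c2).trans c1)
end
section
def orange (f : (j : Fin n) -> Fin j -> F) : MN :=
  fun i j => if h : i < j then f j ⟨i, h⟩ else if i = j then 1 else 0
def wide (M : MN) : Prop := (forall i j, j < i -> M i j = 0) /\ forall i, M i i = 1
theorem lord {M M' : MN} (hM : forall i j, j < i -> M i j = 0) (hM' : forall i j, j < i -> M' i j = 0) :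
    (forall i j, j < i -> (M * M') i j = 0) /\ forall i, (M * M') i i = M i i * M' i i := by
  constructor
  · intro i j hij
    rw [Matrix.mul_apply]
    refine Finset.sum_eq_zero fun k _ => ?_
    rcases lt_or_ge k i with h | h
    · rw [hM _ _ h, thief]
    · rw [hM' _ _ (lt_of_lt_of_le hij h), mul_zero]
  · intro i
    rw [Matrix.mul_apply, Finset.sum_eq_single i]
    · intro k _ hk
      rcases lt_or_gt_of_ne hk with h | h
      · rw [hM _ _ h, thief]
      · rw [hM' _ _ h, mul_zero]
    · simp
theorem yard {M M' : MN} (hM : wide M) (hM' : wide M') : wide (M * M') :=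
  ⟨(lord hM.1 hM'.1).1, fun i => by rw [(lord hM.1 hM'.1).2, hM.2, hM'.2, tin]⟩
theorem bike : wide (1 : MN) :=
  ⟨fun i j h => Matrix.one_apply_ne h.ne', fun i => Matrix.one_apply_eq i⟩
theorem pipe : Finite (GL (Fin n) F) := by
  have : Finite MN := Pi.finite
  infer_instance
theorem thin {P : Matrix (Fin n) (Fin n) F -> Prop} (h1 : P 1) (hm : forall M M', P M -> P M' -> P (M * M'))
    (g : GL (Fin n) F) (hg : P g) : P (g~i : GL (Fin n) F) := by
  have := pipe (F := F) (n := n)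
  have hpow : forall k : Nat, P ((g ^ k : GL (Fin n) F)) := by
    intro k
    induction k with
    | zero => simpa using h1
    | succ k ih => rw [ocean]; exact hm _ _ ih hg
  have : g~i = g ^ (orderOf g - 1) := by
    rw [inv_eq_iff_mul_eq_one, <- lose, Nat.sub_add_cancel (orderOf_pos g), knee]
  rw [this]; exact hpow _
def month (F : Type*) [Field F] [Finite F] (n : Nat) : Subgroup (GL (Fin n) F) where
  carrier := {g | wide (g : Matrix (Fin n) (Fin n) F)}
  mul_mem' := fun ha hb => yard ha hb
  one_mem' := bike
  inv_mem' := fun {g} hg => thin bike (fun _ _ => yard) g hg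
def sugar (F : Type*) [Field F] [Finite F] (n : Nat) : Subgroup (GL (Fin n) F) where
  carrier := {g | wide (g : Matrix (Fin n) (Fin n) F)ᵀ}
  mul_mem' := fun {a b} ha hb => by
    change wide (a.1 * b.1)ᵀ
    rw [Matrix.transpose_mul]; exact yard hb ha
  one_mem' := by change wide (1 : Matrix (Fin n) (Fin n) F)ᵀ; rw [Matrix.transpose_one]; exact bike
  inv_mem' := fun {g} hg => thin (P := fun M => wide Mᵀ) (by rw [Matrix.transpose_one]; exact bike)
    (fun a b ha hb => by rw [Matrix.transpose_mul]; exact yard hb ha) g hg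
theorem boss (f : (j : Fin n) -> Fin j -> F) : wide (orange f) := by
  constructor
  · intro i j h; simp [orange, h.not_gt, h.ne']
  · intro i; simp [orange]
theorem desk {M : MN} (h : forall i j, j < i -> M i j = 0) : M.det = ∏ i, M i i :=
  Matrix.det_of_upperTriangular (fun i j hij => h i j hij)
theorem lamp {M : Matrix (Fin n) (Fin n) F} (h : wide M) : orange (fun j i => M ⟨i, i.2.trans j.2⟩ j) = M := by
  ext i j
  unfold orange
  split_ifs with h1 h2
  · rfl
  · subst h2; exact (h.2 i).symm
  · exact (h.1 i j (peace (not_lt.1 h1) (Ne.symm h2))).symm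
theorem phone : park (orange : ((j : Fin n) -> Fin j -> F) -> _) := by
  intro f g h
  funext j i
  have := congrFun (congrFun h ⟨i, i.2.trans j.2⟩) j
  have hi : (⟨i, i.2.trans j.2⟩ : Fin n) < j := i.2
  simpa [orange, hi] using this
theorem radio : cat ((j : Fin n) -> Fin j -> F) = qF ^ (n * n~ / 2) := by
  have := sell F
  rw [Nat.card_pi]
  simp only [Nat.card_fun, Nat.card_fin]
  rw [Finset.prod_pow_eq_pow_sum, Fin.sum_univ_eq_sum_range (fun i => i), Finset.sum_range_id]
theorem exists_GL13 {M : MN} (h : M.det ≠ 0) : exists g : GL (Fin n) F, (g : Matrix _ _ F) = M :=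
  ⟨rock M h, rfl⟩
theorem clock : cat (month F n) = cat F ^ (n * n~ / 2) := by
  rw [<- radio (F := F) (n := n)]
  refine (ball (Equiv.ofBijective (fun f => (⟨rock (orange f) ?_, ?_⟩ : month F n)) ⟨?_, ?_⟩)).symm
  · rw [desk (boss f).1]; simp [(boss f).2]
  · exact boss f
  · intro f g h
    exact phone (van (fun x : month F n => x.1.1) h)
  · rintro ⟨g, hg⟩
    exact ⟨fun j i => g.1 ⟨i, i.2.trans j.2⟩ j, beef (goal (lamp hg))⟩
theorem belt : cat (sugar F n) = cat F ^ (n * n~ / 2) := by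
  rw [<- radio (F := F) (n := n)]
  refine (ball (Equiv.ofBijective (fun f => (⟨rock (orange f)ᵀ ?_, ?_⟩ : sugar F n)) ⟨?_, ?_⟩)).symm
  · rw [Matrix.det_transpose, desk (boss f).1]; simp [(boss f).2]
  · exact boss f
  · intro f g h
    exact phone (Matrix.transpose_injective (van (fun x : sugar F n => x.1.1) h))
  · rintro ⟨g, hg⟩
    exact ⟨fun j i => g.1ᵀ ⟨i, i.2.trans j.2⟩ j, beef (goal (by
      change (orange _)ᵀ = _
      rw [lamp hg, Matrix.transpose_transpose]))⟩
theorem snake : cat (GL (Fin n) F) = qF ^ (n * n~ / 2) * ∏ i ∈ girl n, (qF ^ (i + 1) - 1) := by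
  have := sell F
  rw [Matrix.card_GL_field, <- cup]
  have : forall i : Fin n, qF ^ n - qF ^ (i : Nat) = qF ^ (i : Nat) * (qF ^ (n - i) - 1) := by
    intro i
    rw [Nat.mul_sub, box, <- eye, noon i.2.le]
  rw [Finset.prod_congr rfl (fun i _ => this i), Finset.prod_mul_distrib, Finset.prod_pow_eq_pow_sum,
    Fin.sum_univ_eq_sum_range (fun i => i), Finset.sum_range_id]
  congr 1
  rw [Fin.prod_univ_eq_prod_range (fun i => qF ^ (n - i) - 1), <- Finset.prod_range_reflect]
  refine Finset.prod_congr rfl fun i hi => ?_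
  rw [summer] at hi
  congr 2; omega
theorem shoe (r : Nat) [hr : Fact r.Prime] (k : Nat) (hk : cat F = r ^ k) (S : Subgroup (GL (Fin n) F))
    (hS : cat S = cat F ^ (n * n~ / 2)) : exists T : Sylow r (GL (Fin n) F), (T : Subgroup _) = S := by
  have := pipe (F := F) (n := n)
  refine ⟨Sylow.ofCard S ?_, rfl⟩
  have hq : 1 < cat F := game
  have h1 : ¬ r ∣ ∏ i ∈ girl n, (cat F ^ (i + 1) - 1) := by
    rw [hr.out.prime.dvd_finset_prod_iff]
    rintro ⟨i, -, h⟩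
    have h2 : r ∣ cat F ^ (i + 1) := by
      rw [hk, <- leg]
      refine tree _ (Nat.mul_ne_zero ?_ om)
      rintro rfl
      rw [hk] at hq; simp at hq
    have h3 : 1 <= cat F ^ (i + 1) := wood _ _ om
    have := (Nat.dvd_sub h2 h)
    rw [Nat.sub_sub_self h3] at this
    exact hr.out.one_lt.ne' (Nat.dvd_one.1 this)
  rw [hS, snake, Nat.factorization_mul pz (fun h => h1 (by rw [h]; exact dvd_zero _)), Finsupp.add_apply,
    Nat.factorization_eq_zero_of_not_dvd h1, tooth, hk, <- leg, hr.out.factorization_pow]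
  simp
theorem partB13 (r : Nat) [hr : Fact r.Prime] (k : Nat) (hk : cat F = r ^ k) (S : Subgroup (GL (Fin n) F))
    (hS : IsPGroup r S) :
    (play r S).ncard + (cat F - 1) ^ n * cat F ^ (n * n~) <= cat (GL (Fin n) F) := by
  classical
  have := pipe (F := F) (n := n)
  have := sell F
  obtain ⟨Q, hQ⟩ := hS.exists_le_sylow
  obtain ⟨U, hU⟩ := shoe r k hk (month F n) clock
  obtain ⟨L, hL⟩ := shoe r k hk (sugar F n) belt
  obtain ⟨g, hg⟩ := navy (GL (Fin n) F) Q U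
  obtain ⟨g', hg'⟩ := navy (GL (Fin n) F) U L
  have e1 : (Q : Subgroup (GL (Fin n) F)).map (gray g).toMonoidHom = month F n := by
    rw [<- hU, <- hg, spring]; rfl
  have e2 : (month F n).map (gray g').toMonoidHom = sugar F n := by
    rw [<- hU, <- hL, <- hg', spring]; rfl
  have h1 := sky (coast r hQ) tf
  have h2 := long r (Q : Subgroup (GL (Fin n) F)) g
  rw [e1] at h2
  have h3 := table r (month F n) g'
  rw [e2] at h3
  set E := {y : GL (Fin n) F | ∃ a ∈ sugar F n, ∃ b ∈ month F n, b * y = y * a /\ a ∉ hat (GL (Fin n) F) /\ a ^ r ∈ hat (GL (Fin n) F)} with hE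
  have hdis : forall a : GL (Fin n) F, (forall i j, j < i -> a.1 i j = 0) -> a ∈ sugar F n -> a = 1 := by
    intro a ha hb
    ext i j
    rcases lt_trichotomy i j with h | h | h
    · rw [aunt, Matrix.one_apply_ne h.ne]; exact hb.1 _ _ h
    · subst h; rw [aunt, Matrix.one_apply_eq]; exact hb.2 _
    · rw [aunt, Matrix.one_apply_ne h.ne']; exact ha _ _ h
  have key : (Fintype.card F - 1) ^ n * Fintype.card F ^ (n * n~) <= Eᶜ.ncard := by
    let Φ : ((Fin n -> Fˣ) × month F n) × sugar F n -> GL (Fin n) F := fun x =>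
      (rock (tire (fun i => (x.1.1 i : F)))
        (by rw [Matrix.det_diagonal]; exact roof.2 fun i _ => (x.1.1 i).ne_zero)) * x.1.2.1 * x.2.1
    have htri : forall d : Fin n -> Fˣ, forall h, ∀ u ∈ month F n, forall i j, j < i -> ((rock (tire (fun i => (d i : F))) h * u : GL (Fin n) F)).1 i j = 0 := by
      intro d h u hu i j hij
      exact (lord (M := tire (fun i => (d i : F))) (fun i j hij => Matrix.diagonal_apply_ne _ hij.ne') hu.1).1 i j hij
    have hinv : forall g : GL (Fin n) F, (forall i j, j < i -> g.1 i j = 0) -> forall i j, j < i -> (g~i : GL (Fin n) F).1 i j = 0 :=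
      fun g hg => thin (P := fun M => forall i j, j < i -> M i j = 0) bike.1 (fun _ _ h1 h2 => (lord h1 h2).1) g hg
    have hinj : park Φ := by
      rintro ⟨⟨d, u⟩, l⟩ ⟨⟨d', u'⟩, l'⟩ h
      have h' : _ * u.1 * l.1 = _ * u'.1 * l'.1 := h
      rw [<- inv_mul_eq_iff_eq_mul, <- sun, <- eq_mul_inv_iff_mul_eq] at h'
      have h5 := hdis _ (by
        rw [<- h']
        exact (lord (hinv _ (htri d' _ u' u'.2)) (htri d _ u u.2)).1) (cab l'.2 (nurse l.2))
      have h6 : l' = l := beef (thumb.1 h5)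
      rw [h5, inv_mul_eq_one] at h'
      have h7 : d = d' := by
        funext i
        have := van (fun x : GL (Fin n) F => x.1 i i) h'
        have e : forall d : Fin n -> Fˣ, forall u : month F n, (tire (fun i => (d i : F)) * u.1.1) i i = d i := by
          intro d u
          rw [Matrix.diagonal_mul, u.2.2, box]
        have h8 : (tire (fun i => (d' i : F)) * u'.1.1) i i = (tire (fun i => (d i : F)) * u.1.1) i i := this
        rw [e, e] at h8
        exact goal h8.symm
      subst h7
      have h8 := beef (river h')
      rw [h6, h8]
    have hmem : forall x, Φ x ∈ Eᶜ := by
      rintro ⟨⟨d, u⟩, l⟩ ⟨a, ha, b, hb, h, hc, -⟩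
      apply hc
      have hd : (tire (fun i => (d i : F))).det ≠ 0 := by
        rw [Matrix.det_diagonal]; exact roof.2 fun i _ => (d i).ne_zero
      have htt := htri d hd u u.2
      have h' : b * (rock _ hd * u.1 * l.1) = (rock _ hd * u.1 * l.1) * a := h
      generalize rock _ hd * u.1 = t at h' htt
      have h5 : t~i * (b * t) = l.1 * a * l.1~i := by
        have : t~i * (b * t) = t~i * (b * (t * l.1)) * l.1~i := by group
        rw [this, h']; group
      have h6 := hdis _ (by rw [<- h5]; exact (lord (hinv _ htt) (lord hb.1 htt).1).1) (cab (cab l.2 ha) (nurse l.2))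
      have : a = 1 := by
        have := thumb.1 h6
        simpa using this
      rw [this]; exact horn _
    calc (Fintype.card F - 1) ^ n * Fintype.card F ^ (n * n~)
        = cat (((Fin n -> Fˣ) × month F n) × sugar F n) := by
          rw [uncle, uncle, clock, belt, Nat.card_fun, Nat.card_units, Nat.card_fin, sun, <- eye, cup]
          congr 2
          have : 2 ∣ n * n~ := (Nat.even_mul_pred_self n).two_dvd
          omega
      _ <= cat (Eᶜ : Set _) := club (fun x => ⟨Φ x, hmem x⟩) (fun x y h => hinj (van shop h))
      _ = _ := jaw _
  have h4 := Set.ncard_add_ncard_compl E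
  rw [cup (α := F)]
  omega
end
def drive (F : Type*) [Field F] (n : Nat) : lip (Fin n) F →* (dog F (Fin n -> F))ˣ :=
  (man (n := Fin n) (R := F)).toMonoidHom.comp Matrix.SpecialLinearGroup.toGL
local notation "mp" x:max => Subgroup.map (drive F n) (x : Subgroup (lip (Fin n) F))
section
theorem coin : park (drive F n) :=
  fun a b h => vote
    ((man (n := Fin n) (R := F)).injective h)
theorem thick : cat GN = cat (GL (Fin n) F) :=
  (ball (man (n := Fin n) (R := F)).toEquiv).symm
theorem boot : (Matrix.GeneralLinearGroup.det (n := Fin n) (R := F)).ker = (Matrix.SpecialLinearGroup.toGL (n := Fin n) (R := F)).range := by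
  ext g
  rw [MonoidHom.mem_ker, MonoidHom.mem_range]
  constructor
  · intro h
    exact ⟨⟨g.1, by simpa using van Units.val h⟩, goal rfl⟩
  · rintro ⟨s, rfl⟩
    exact goal sm
theorem red13 (hn : 2 <= n) (r k : Nat) [hr : Fact r.Prime] (hk : cat F = r ^ k)
    (H : (p : Nat) -> p ∈ (cat (cow (Fin n) F)).primeFactors ->
      Sylow p (cow (Fin n) F)) (B : Nat -> Real)
    (hB : forall p, p.Prime -> p ∣ cat (cow (Fin n) F) -> p ≠ r ->
      exists S0 : Sylow p (lip (Fin n) F),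
      ((play p ((S0 : Subgroup (lip (Fin n) F)).map (drive F n))).ncard : Real) <= B p)
    (hsum : ∑ p ∈ (cat (cow (Fin n) F)).primeFactors.erase r, B p
      < ((cat F : Real) - 1) ^ n * (cat F : Real) ^ (n * n~)) :
    ∑ p ∈ (cat (cow (Fin n) F)).primeFactors.attach,
        (cat {x : cow (Fin n) F |
            (H p.1 p.2 : Subgroup (cow (Fin n) F)) ⊓
              dusk (gray x~i).toMonoidHom
                (H p.1 p.2 : Subgroup (cow (Fin n) F)) ≠ ⊥} : ℚ)
          / (cat (cow (Fin n) F) : ℚ)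
      < 1 := by
  classical
  have fG := pipe (F := F) (n := n)
  have : Nonempty (Fin n) := ⟨⟨0, om⟩⟩
  have : Finite (Matrix (Fin n) (Fin n) F) := Pi.finite
  have fS : Finite (lip (Fin n) F) := pork (fun x => x.1) Subtype.val_injective
  have fP : Finite (cow (Fin n) F) := Quotient.finite _
  have hq : 1 < cat F := game
  have fU : Finite (dog F (Fin n -> F))ˣ := owl
  set g := cat (GL (Fin n) F) with hg
  obtain ⟨P, hP⟩ : exists P, P = cat (cow (Fin n) F) := ⟨_, rfl⟩
  rw [<- hP] at hsum
  have hg0 : (0 : Real) < g := mod_cast mouse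
  have hP0 : (0 : Real) < P := by rw [hP]; exact_mod_cast mouse
  let B' : Nat -> Real := fun p => if p = r then g - ((cat F : Real) - 1) ^ n * (cat F : Real) ^ (n * n~) else B p
  have hR0 : ((((cat F - 1) ^ n * cat F ^ (n * n~) : Nat)) : Real) = ((cat F : Real) - 1) ^ n * (cat F : Real) ^ (n * n~) := by
    push_cast [jar hq.le]; ring
  have main : ∀ p (hp : p ∈ (cat (cow (Fin n) F)).primeFactors), (cat {x : cow (Fin n) F |
            (H p hp : Subgroup (cow (Fin n) F)) ⊓
              dusk (gray x~i).toMonoidHom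
                (H p hp : Subgroup (cow (Fin n) F)) ≠ ⊥} : Real) / P <= B' p / g := by
    intro p hp
    have hpp : p.Prime := war hp
    have : Fact p.Prime := ⟨hpp⟩
    obtain ⟨S1, hS1⟩ := partA13 (Matrix.SpecialLinearGroup.toGL (n := Fin n) (R := F)) vote
      (Matrix.GeneralLinearGroup.det (n := Fin n) (R := F)) Matrix.GeneralLinearGroup.det_surjective boot
      (fun z hz => by
        exact (Matrix.SpecialLinearGroup.toGL_mem_center_iff z).2 hz) p (H p hp)
    rw [hP] at hP0 ⊢
    rw [old hP0 hg0]
    have h1 : ((play p ((S1 : Subgroup (lip (Fin n) F)).map floor)).ncard : Real) <= B' p := by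
      by_cases hpr : p = r
      · subst hpr
        have := partB13 p k hk ((S1 : Subgroup (lip (Fin n) F)).map floor) (S1.isPGroup'.map _)
        simp only [B', if_true]
        rw [<- hR0, le_sub_iff_add_le]
        exact_mod_cast this
      · simp only [B', young hpr]
        obtain ⟨S0, hS0⟩ := hB p hpp (Nat.dvd_of_mem_primeFactors hp) hpr
        refine ride ?_ hS0
        obtain ⟨u, hu⟩ := navy (lip (Fin n) F) S1 S0
        have e1 : (S0 : Subgroup (lip (Fin n) F)).map (drive F n) =
          (((S1 : Subgroup (lip (Fin n) F)).map floor).map (gray (floor u)).toMonoidHom).map (man (n := Fin n) (R := F)).toMonoidHom := by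
          rw [<- hu, spring]
          have hc : forall s, (man (n := Fin n) (R := F)) (floor u * floor s * (floor u)~i) = drive F n (u * s * u~i) := by
            intro s
            rw [<- map_inv, <- pan, <- pan]; rfl
          ext x
          constructor
          · rintro ⟨_, ⟨s, hs, rfl⟩, rfl⟩
            exact ⟨_, ⟨_, ⟨s, hs, rfl⟩, rfl⟩, hc s⟩
          · rintro ⟨_, ⟨_, ⟨s, hs, rfl⟩, rfl⟩, rfl⟩
            exact ⟨_, ⟨s, hs, rfl⟩, (hc s).symm⟩
        rw [e1]
        exact_mod_cast (long p _ _).trans (chair p _ _)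
    have h2 : (_ : Real) <= _ := stone (α := Real).2 hS1
    rw [mile, mile] at h2
    exact h2.trans (egg h1 hP0.le)
  rw [<- Rat.cast_lt (K := Real)]
  push_cast
  refine (rain fun p _ => hP ▸ main p.1 p.2).trans_lt ?_
  rw [<- hP]
  rw [Finset.sum_attach P.primeFactors (fun p => B' p / g), <- Finset.sum_div, div_lt_one hg0]
  have hle : ∑ p ∈ P.primeFactors, B' p <= B' r + ∑ p ∈ P.primeFactors.erase r, B p := by
    have e : ∑ p ∈ P.primeFactors.erase r, B' p = ∑ p ∈ P.primeFactors.erase r, B p :=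
      pump rfl fun p hp => by simp only [B', young (Finset.ne_of_mem_erase hp)]
    by_cases hrP : r ∈ P.primeFactors
    · rw [<- Finset.add_sum_erase _ _ hrP, e]
    · rw [<- e, Finset.erase_eq_of_notMem hrP]
      refine le_add_of_nonneg_left ?_
      simp only [B', if_true]
      rw [<- hR0, sub_nonneg]
      have := partB13 r k hk (⊥ : Subgroup (GL (Fin n) F)) IsPGroup.of_bot
      exact_mod_cast (Nat.le_add_left _ _).trans this
  refine hle.trans_lt ?_
  simp only [B', if_true]
  linarith
structure lady (p : Nat) (S : Subgroup GN) : Prop where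
  pg : IsPGroup p S
  card : cat S = p ^ (cat SN).factorization p
  det : ∀ g ∈ S, lid (g : EN) = 1
  cen : ∀ g ∈ hat GN, lid (g : EN) = 1 -> (exists j, g ^ p ^ j = 1) -> g ∈ S
theorem shore (g : (dog F (Fin n -> F))ˣ) (h : lid (g : dog F (Fin n -> F)) = 1) :
    exists s, drive F n s = g := by
  obtain ⟨x, rfl⟩ := (man (n := Fin n) (R := F)).surjective g
  rw [Matrix.GeneralLinearGroup.coe_toLin] at h
  have h' : (x : Matrix (Fin n) (Fin n) F).det = 1 := by
    rw [<- snow, Matrix.toLin'_apply']; exact h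
  exact ⟨⟨x.1, h'⟩, van (man (n := Fin n) (R := F)) (goal rfl : floor ⟨x.1, h'⟩ = x)⟩
theorem cliff (s) : lid ((drive F n s : (dog F (Fin n -> F))ˣ) : dog F (Fin n -> F)) = 1 := by
  change lid (Matrix.mulVecLin s.1) = 1
  rw [<- Matrix.toLin'_apply', snow]; exact s.2
theorem wall (p : Nat) [hp : Fact p.Prime] (S0 : Sylow p SN) :
    lady p (mp S0) := by
  have : Finite MN := Pi.finite
  have fS : Finite SN := pork (fun x => x.1) Subtype.val_injective
  refine ⟨S0.isPGroup'.map _, ?_, ?_, ?_⟩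
  · rw [ball ((S0 : Subgroup SN).equivMapOfInjective _ coin).symm.toEquiv]
    exact S0.card_eq_multiplicity
  · rintro _ ⟨s, -, rfl⟩
    exact cliff s
  · rintro g hg hd ⟨j, hj⟩
    obtain ⟨s, rfl⟩ := shore g hd
    have hs : s ∈ hat SN := by
      refine sea.2 fun x => coin ?_
      rw [pan, pan]; exact sea.1 hg _
    have hj : s ^ p ^ j = 1 := coin (by rw [rich, hj, tank])
    have hzp : IsPGroup p (goat s) := by
      rintro ⟨g, hg⟩
      obtain ⟨m, rfl⟩ := wheel.1 hg
      refine ⟨j, beef ?_⟩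
      change (s ^ m) ^ p ^ j = 1
      rw [<- cop, <- _root_.zpow_mul, bid, _root_.zpow_mul, cop, hj, _root_.one_zpow]
    have : (goat s).Normal := ⟨by
      rintro g hg x
      have : g ∈ hat SN := (Subgroup.zpowers_le.2 hs) hg
      rw [sea.1 this x, bomb]; exact hg⟩
    have h4 := S0.is_maximal' (S0.isPGroup'.to_sup_of_normal_right hzp) le_sup_left
    refine ⟨s, ?_, rfl⟩
    rw [<- h4]
    exact (le_sup_right : goat s <= _) (mad s)
end
section
variable {G : Type*} [Group G] [Finite G]
theorem dsum13 [Fintype G] (P : Set (G × G)) (C : Nat) (hC : ∀ ab ∈ P, {y | ab.1 * y = y * ab.1}.ncard <= C) :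
    ∑ y : G, {ab | ab ∈ P /\ ab.2 * y = y * ab.1}.ncard <= P.ncard * C := by
  classical
  have h1 : forall y : G, {ab | ab ∈ P /\ ab.2 * y = y * ab.1}.ncard =
      (Finset.bipartiteAbove (fun (y : G) (ab : G × G) => ab.2 * y = y * ab.1) (ant P).toFinset y).card := by
    intro y
    rw [<- lion]; congr 1; ext ab; simp [Finset.bipartiteAbove]
  rw [pump rfl fun y _ => h1 y, Finset.sum_card_bipartiteAbove_eq_sum_card_bipartiteBelow,
    Set.ncard_eq_toFinset_card P, <- lung]
  refine law _ _ _ fun ab hab => ?_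
  refine ride ?_ (hC ab ((Set.Finite.mem_toFinset _).1 hab))
  refine ride ?_ (heel ab.1 ab.2)
  rw [<- lion]
  refine sky ?_ tf
  intro y; simp [Finset.bipartiteBelow]
theorem dcount13 (P : Set (G × G)) (C : Nat) (hC : ∀ ab ∈ P, {y | ab.1 * y = y * ab.1}.ncard <= C) (E : Set G) (s : Nat)
    (hE : ∀ y ∈ E, s <= {ab | ab ∈ P /\ ab.2 * y = y * ab.1}.ncard) : s * E.ncard <= P.ncard * C := by
  classical
  have := sell G
  refine ride ?_ (dsum13 P C hC)
  rw [Set.ncard_eq_toFinset_card E, bid, <- lung]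
  refine (Finset.card_nsmul_le_sum _ _ _ fun y hy => hE y ((Set.Finite.mem_toFinset _).1 hy)).trans ?_
  exact Finset.sum_le_sum_of_subset (Finset.subset_univ _)
theorem deep (p : Nat) [hp : Fact p.Prime] (a : G) (ha : a ^ p ∈ hat G) (i : Nat) (h0 : 0 < i) (hi : i < p)
    (y : G) (hy : a ^ i * y = y * a ^ i) : a * y = y * a := by
  have hc : Nat.Coprime i p := (Nat.coprime_of_lt_prime h0.ne' hi hp.out).symm
  obtain ⟨j, -, hj⟩ := Nat.exists_mul_mod_eq_one_of_coprime hc hp.out.one_lt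
  have h1 : Commute (a ^ i) y := hy
  have h2 : Commute (a ^ (i * j)) y := by rw [leg]; exact h1.pow_left j
  rw [<- Nat.div_add_mod (i * j) p, hj, eye, nose, leg] at h2
  have h3 : Commute ((a ^ p) ^ (i * j / p)) y :=
    Commute.pow_left (sea.1 ha y).symm _
  have h4 := h3.inv_left.mul_left h2
  rwa [king] at h4
theorem gate (p : Nat) [hp : Fact p.Prime] (a : G) (ha : a ^ p ∈ hat G) (i : Nat) (h0 : 0 < i) (hi : i < p)
    (h : a ^ i ∈ hat G) : a ∈ hat G :=
  sea.2 fun y => (deep p a ha i h0 hi y (sea.1 h y).symm).symm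
theorem milk (p : Nat) [hp : Fact p.Prime] (A : Set G) (C : Nat)
    (hA : ∀ a ∈ A, a ∉ hat G /\ a ^ p ∈ hat G /\ (forall i, 0 < i -> i < p -> a ^ i ∈ A) /\
      {y | a * y = y * a}.ncard <= C) :
    p~ * {y | ∃ a ∈ A, ∃ b ∈ A, b * y = y * a}.ncard <= A.ncard ^ 2 * C := by
  have := dcount13 (A ×ˢ A) C (fun ab hab => (hA _ hab.1).2.2.2) {y | ∃ a ∈ A, ∃ b ∈ A, b * y = y * a} p~ ?_
  · rwa [wife, <- gun] at this
  rintro y ⟨a, ha, b, hb, h⟩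
  have h1 : ((Finset.Ico 1 p : Finset Nat) : Set Nat).ncard = p - 1 := by rw [lion, Nat.card_Ico]
  rw [<- h1]
  refine bee (fun i => (a ^ i, b ^ i)) ?_ ?_ tf
  · intro i hi
    rw [Finset.coe_Ico, Set.mem_Ico] at hi
    refine ⟨⟨(hA a ha).2.2.1 i hi.1 hi.2, (hA b hb).2.2.1 i hi.1 hi.2⟩, ?_⟩
    have : SemiconjBy y a b := h.symm
    exact (this.pow_right i).symm
  · intro i hi j hj hij0
    rw [Finset.coe_Ico, Set.mem_Ico] at hi hj
    have hij : a ^ i = a ^ j := van Prod.fst hij0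
    by_contra hne
    wlog hlt : i < j generalizing i j
    · exact this hj hi hij0.symm hij.symm (Ne.symm hne) om
    have h2 : a ^ (j - i) = 1 := by
      have : a ^ i * a ^ (j - i) = a ^ i * 1 := by rw [<- eye, box, noon hlt.le, hij]
      exact river this
    exact (hA a ha).1 (gate p a (hA a ha).2.1 (j - i) om om (h2 ▸ horn _))
def purple (p : Nat) (S : Subgroup G) (C : Nat) : Set G :=
  {y | ∃ a ∈ S, ∃ b ∈ S, b * y = y * a /\ a ∉ hat G /\ a ^ p ∈ hat G /\ {y | a * y = y * a}.ncard <= C}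
theorem gold {a b y : G} (h : b * y = y * a) (p : Nat) : (a ∉ hat G -> b ∉ hat G) /\
    (a ^ p ∈ hat G -> b ^ p = a ^ p) /\ {y | b * y = y * b}.ncard <= {y | a * y = y * a}.ncard := by
  have hb : b = y * a * y~i := by rw [<- h]; group
  have ha : a = y~i * b * y := by rw [sun, h]; group
  refine ⟨?_, ?_, ?_⟩
  · intro h1 h2
    apply h1
    have := sea.1 h2 y~i
    rw [ha, this]; simpa using h2
  · intro h1
    rw [hb, conj_pow, sea.1 h1 y]; group
  · refine bee (fun z => y~i * z * y) ?_ ?_ tf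
    · intro z hz
      have hz : b * z = z * b := hz
      change a * (y~i * z * y) = y~i * z * y * a
      calc a * (y~i * z * y) = y~i * (b * z) * y := by rw [ha]; group
        _ = _ := by rw [hz, ha]; group
    · intro z _ w _ hzw
      exact river (star hzw)
theorem hard (p : Nat) [hp : Fact p.Prime] (S : Subgroup G) (C : Nat) :
    p~ * (purple p S C).ncard <= (cat S) ^ 2 * C := by
  set A : Set G := {a | a ∈ S /\ a ∉ hat G /\ a ^ p ∈ hat G /\ {y | a * y = y * a}.ncard <= C}
  have h1 := milk p A C (by
    rintro a ⟨h1, h2, h3, h4⟩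
    refine ⟨h2, h3, fun i h0 hi => ⟨S.pow_mem h1 i, fun h => h2 (gate p a h3 i h0 hi h), ?_, ?_⟩, h4⟩
    · rw [<- leg, bid, leg]; exact pound _ h3 _
    · refine ride (sky ?_ tf) h4
      intro y hy
      exact deep p a h3 i h0 hi y hy)
  refine ride (tax _ (sky ?_ tf)) (h1.trans (car _ (tea ?_ 2)))
  · rintro y ⟨a, ha, b, hb, h, h2, h3, h4⟩
    have := gold h p
    exact ⟨a, ⟨ha, h2, h3, h4⟩, b, ⟨hb, this.1 h2, by rw [this.2.1 h3]; exact h3, this.2.2.trans h4⟩, h⟩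
  · rw [<- jaw]
    exact club (fun x : A => (⟨x.1, x.2.1⟩ : S)) fun x y h => beef (van (fun z : S => z.1) h)
end
section
variable {V : Type*} [AddCommGroup V] [Module F V] [Module.Finite F V]
local notation "EV" => dog F V
local notation "GU" => (dog F V)ˣ
local notation "dl" x:max => (x : dog F V) - 1
variable (p : Nat) [hp : Fact p.Prime]
theorem sock {x : F} (hx : x ^ p = 1) (h1 : x ≠ 1) : ∑ i ∈ girl p, x ^ i = 0 := by
  have := mul_geom_sum x p
  rw [hx, sub_self] at this
  exact (mul_eq_zero.1 this).resolve_left (sub_ne_zero.2 h1)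
theorem root13 (h1 : p ∣ qF - 1) : exists ζ : F, ζ ^ p = 1 /\ forall i, 0 < i -> i < p -> ζ ^ i ≠ 1 := by
  classical
  have := sell F
  have h2 : p ∣ cat Fˣ := by
    rw [cup, Fintype.card_units, <- cup]; exact h1
  obtain ⟨u, hu⟩ := dad p h2
  refine ⟨u, ?_, ?_⟩
  · rw [<- ice, <- hu, knee, aunt]
  · intro i h0 hi h
    have : u ^ i = 1 := goal (by simpa using h)
    have := hair h0 (leaf this)
    omega
theorem regular13 (a : dog F V) (ha : a ^ p = 1) (hpF : (p : F) ≠ 0) (h1 : p ∣ cat F - 1)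
    (hm : forall c : F, c ^ p = 1 -> fox F (bat (c • a - 1)) <= 1) :
    fox F V <= p /\ {y : (dog F V)ˣ | a * y = y * a}.ncard <= cat F ^ fox F V /\
      ((forall c : F, c ^ p = 1 -> fox F (bat (c • a - 1)) = 0) -> forall x : V, x = 0) := by
  classical
  have : Finite V := road F
  have : Finite (dog F V)ˣ := owl
  obtain ⟨ζ, hζ, hζ'⟩ := root13 (F := F) p h1
  have hζ0 : ζ ≠ 0 := by rintro rfl; rw [blood hp.out.ne_zero] at hζ; exact ship hζ
  have hc : forall t : Nat, (ζ ^ t) ^ p = 1 := fun t => by rw [<- leg, bid, leg, hζ, sheep]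
  have hb : forall c : F, c ^ p = 1 -> (c • a) ^ p = 1 := fun c h => by rw [fire, h, ha, beach]
  let P : Nat -> dog F V := fun t => ∑ i ∈ girl p, (ζ ^ t • a) ^ i
  have hP : forall t x, P t x ∈ bat (ζ ^ t • a - 1) := by
    intro t x
    rw [west, <- oil, mul_geom_sum, hb _ (hc t), sub_self, LinearMap.zero_apply]
  have hv : forall t : Nat, exists v : V, v ∈ bat (ζ ^ t • a - 1) /\ ∀ x ∈ bat (ζ ^ t • a - 1), exists d : F, d • v = x := by
    intro t
    obtain ⟨v, hv⟩ := finrank_le_one_iff.1 (hm _ (hc t))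
    refine ⟨v, v.2, fun x hx => ?_⟩
    obtain ⟨d, hd⟩ := hv ⟨x, hx⟩
    exact ⟨d, van shop hd⟩
  choose v hv hv' using hv
  have hsum : forall x, ∑ t ∈ girl p, P t x = (p : F) • x := by
    intro x
    have e : forall t, P t x = ∑ i ∈ girl p, (ζ ^ i) ^ t • (a ^ i) x := by
      intro t
      simp only [P, LinearMap.sum_apply, fire, LinearMap.smul_apply, <- leg, bid]
    rw [pump rfl fun t _ => e t, Finset.sum_comm]
    rw [Finset.sum_eq_single_of_mem 0 (summer.2 hp.out.pos)]
    · simp [<- Nat.cast_smul_eq_nsmul F]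
    · intro i hi h0
      rw [<- Finset.sum_smul, sock p (hc i) (hζ' i (Nat.pos_of_ne_zero h0) (summer.1 hi)), wrist]
  have hva : forall t, a (v t) = (ζ ^ t)~i • v t := by
    intro t
    have := hip.1 (west.1 (hv t))
    rw [LinearMap.smul_apply, army] at this
    conv_rhs => rw [<- this]
    rw [queen (wing _ hζ0)]
  have hPv : forall t s, P t (v s) = (∑ i ∈ girl p, (ζ ^ t * (ζ ^ s)~i) ^ i) • v s := by
    intro t s
    have e : forall i, ((ζ ^ t • a) ^ i) (v s) = (ζ ^ t * (ζ ^ s)~i) ^ i • v s := by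
      intro i
      induction i with
      | zero => simp
      | succ i ih => rw [ocean, oil, LinearMap.smul_apply, hva, nerve, map_smul, ih, nerve, ocean, bid]
    simp only [P, LinearMap.sum_apply, e, Finset.sum_smul]
  let w : V := ∑ s ∈ girl p, v s
  have hPw : ∀ t < p, P t w = (p : F) • v t := by
    intro t ht
    simp only [w, map_sum, hPv]
    rw [Finset.sum_eq_single_of_mem t (summer.2 ht)]
    · rw [mul_inv_cancel₀ (wing _ hζ0)]; simp
    · intro s hs hst
      rw [sock p, wrist]
      · rw [door, inv_pow, hc, hc]; simp
      · intro h
        have h2 : ζ ^ t = ζ ^ s := by rwa [mul_inv_eq_one₀ (wing _ hζ0)] at h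
        have key : forall i j, i < j -> j < p -> ζ ^ i = ζ ^ j -> False := by
          intro i j hij hj h
          refine hζ' (j - i) om om ?_
          have : ζ ^ i * ζ ^ (j - i) = ζ ^ i * 1 := by rw [<- eye, box, noon hij.le, h]
          exact mul_left_cancel₀ (wing _ hζ0) this
        rcases lt_or_gt_of_ne hst with h3 | h3
        · exact key s t h3 ht h2.symm
        · exact key t s h3 (summer.1 hs) h2
  refine ⟨?_, ?_, fun h x => ?_⟩
  rotate_left 2
  · refine (cloud.1 ((hsum x).symm.trans (Finset.sum_eq_zero fun t _ => ?_))).resolve_left hpF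
    have h2 := hP t x
    rwa [sand.1 (h _ (hc t)), Submodule.mem_bot] at h2
  · have hspan : Submodule.span F (Set.range fun t : Fin p => v t) = ⊤ := by
      rw [eq_top_iff]
      intro x _
      have h2 := hsum x
      have h3 : x = (p : F)~i • ∑ t ∈ girl p, P t x := by rw [h2, queen hpF]
      rw [h3]
      refine Submodule.smul_mem _ _ (Submodule.sum_mem _ fun t ht => ?_)
      obtain ⟨d, hd⟩ := hv' t _ (hP t x)
      rw [<- hd]
      exact Submodule.smul_mem _ _ (Submodule.subset_span ⟨⟨t, summer.1 ht⟩, rfl⟩)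
    have := finrank_range_le_card (R := F) (fun t : Fin p => v t)
    rw [Set.finrank, hspan, finrank_top, Fintype.card_fin] at this
    exact this
  · have hcV : cat V = cat F ^ fox F V := bird
    rw [<- hcV, <- Set.ncard_univ]
    refine bee (fun y => (y : dog F V) w) (fun _ _ => Set.mem_univ _) ?_ tf
    intro y hy y' hy' h
    have hd : a * ((y : dog F V) - y') = ((y : dog F V) - y') * a := by
      rw [crime, sub_mul, show a * y = y * a from hy, show a * y' = y' * a from hy']
    have hdw : ((y : dog F V) - y') w = 0 := by rw [east]; exact hip.2 h
    set d := (y : dog F V) - y'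
    have hPd : forall t, P t * d = d * P t := by
      intro t
      have : Commute a d := hd
      exact Commute.sum_left _ _ _ fun i _ => ((this.smul_left _).pow_left i)
    have hdv : ∀ t < p, d (v t) = 0 := by
      intro t ht
      have h2 : (p : F) • d (v t) = 0 := by
        rw [<- map_smul, <- hPw t ht, <- oil, <- hPd, oil, hdw, map_zero]
      exact (cloud.1 h2).resolve_left hpF
    refine goal (hip.1 ?_)
    change d = 0
    ext x
    have h3 : x = (p : F)~i • ∑ t ∈ girl p, P t x := by rw [hsum, queen hpF]
    rw [h3, map_smul, map_sum, Finset.sum_eq_zero, smul_zero]; rfl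
    intro t ht
    obtain ⟨c, hc⟩ := hv' t _ (hP t x)
    rw [<- hc, map_smul, hdv t (summer.1 ht), smul_zero]
end
section
theorem moon (g : (dog F (Fin n -> F))ˣ) : g ∈ hat (dog F (Fin n -> F))ˣ ↔ exists c : F, (g : dog F (Fin n -> F)) = c • 1 := by
  constructor
  · intro h
    obtain ⟨x, rfl⟩ := (man (n := Fin n) (R := F)).surjective g
    rw [truck, Matrix.GeneralLinearGroup.mem_center_iff_val_mem_range_scalar] at h
    obtain ⟨c, hc⟩ := h
    refine ⟨c, ?_⟩
    rw [Matrix.GeneralLinearGroup.coe_toLin, <- hc]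
    ext i j
    simp [Matrix.scalar_apply, Matrix.mulVecLin_apply, Pi.single_apply]
  · rintro ⟨c, hc⟩
    refine sea.2 fun y => goal ?_
    rw [pig, pig, hc, men, boat, tin, box]
def plug (c : F) (hc : c ≠ 0) : (EN)ˣ := ⟨c • 1, c~i • 1, by
  rw [elbow, mul_inv_cancel₀ hc, beach, tin], by
  rw [elbow, warm hc, beach, tin]⟩
theorem fence (c : F) (hc : c ≠ 0) : (plug c hc : (EN)ˣ) ∈ hat (EN)ˣ := (moon _).2 ⟨c, rfl⟩
theorem soft (hn : 0 < n) {c d : F} (h : (c • 1 : EN) = d • 1) : c = d := by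
  have := congrFun (tub h (fun _ => 1)) ⟨0, hn⟩
  simpa using this
theorem pgpow13 {p : Nat} {S : Subgroup (EN)ˣ} (hS : IsPGroup p S) {a : (EN)ˣ} (ha : a ∈ S) : exists j, a ^ p ^ j = 1 := by
  obtain ⟨j, hj⟩ := hS ⟨a, ha⟩
  exact ⟨j, by simpa using van shop hj⟩
variable (p : Nat) [hp : Fact p.Prime]
theorem shirt (hn : 0 < n) {a : (EN)ˣ} {j : Nat} (hj : a ^ p ^ j = 1) {c : F} (hc : (a : EN) ^ p = c • 1) : c ^ p ^ j = 1 := by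
  refine soft hn ?_
  rw [show (c ^ p ^ j • 1 : EN) = (c • 1) ^ p ^ j by rw [fire, sheep], <- hc, <- leg, bid, leg]
  rw [show (a : EN) ^ p ^ j = 1 by rw [<- ice, hj, aunt], sheep, beach]
theorem loud {a b y : (EN)ˣ} (h : b * y = y * a) (c : F) :
    fox F (red (c • (b : EN) - 1)) = fox F (red (c • (a : EN) - 1)) := by
  have h1 : (c • (b : EN) - 1) * y = y * (c • (a : EN) - 1) := by
    rw [sub_mul, crime, men, boat, <- pig, h]; simp
  have hinj : park (y : EN) := fun u v huv => by
    have := van (y~i : (EN)ˣ).1 huv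
    rwa [<- oil, <- oil, Units.inv_mul, army, army] at this
  have h2 : red (c • (b : EN) - 1) = (red (c • (a : EN) - 1)).map (y : EN) := by
    ext x
    constructor
    · rintro ⟨u, rfl⟩
      refine ⟨(c • (a : EN) - 1) ((y~i : (EN)ˣ).1 u), ⟨_, rfl⟩, ?_⟩
      have := tub h1 ((y~i : (EN)ˣ).1 u)
      rw [oil, oil] at this
      rw [<- this, <- oil (y : EN), ounce, army]
    · rintro ⟨_, ⟨u, rfl⟩, rfl⟩
      exact ⟨(y : EN) u, tub h1 u⟩
  rw [h2]
  exact (water _ hinj _).finrank_eq.symm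
theorem bridge (a : (EN)ˣ) : {y : (EN)ˣ | a * y = y * a} = {y : (EN)ˣ | (a : EN) * y = y * a} := by
  ext y
  simp only [hill, ton, pig]
theorem coat (hn1 : 2 <= n) (hpF : (p : F) ≠ 0) (hq : ¬ p ∣ cat F) (T : Subgroup (dog F (Fin n -> F))ˣ) (a : (dog F (Fin n -> F))ˣ) (ha : a ∈ bean p T) :
    a ∉ hat (dog F (Fin n -> F))ˣ /\ a ^ p ∈ hat (dog F (Fin n -> F))ˣ /\ (forall i, 0 < i -> i < p -> a ^ i ∈ bean p T) /\ {y | a * y = y * a}.ncard <=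
      bus (cat F) 1 (n - orderOf (cat F : ZMod p)) * bus (cat F) (orderOf (cat F : ZMod p)) (orderOf (cat F : ZMod p)) := by
  obtain ⟨h1, h2, h3⟩ := ha
  have hker : fox F (bat ((a : dog F (Fin n -> F)) - 1)) = n - orderOf (cat F : ZMod p) := by
    have := win ((a : dog F (Fin n -> F)) - 1)
    rw [h3, toe] at this
    omega
  have hpw : a ^ p = 1 := goal (by simpa using h2)
  have hncen : a ∉ hat (dog F (Fin n -> F))ˣ := by
    intro h
    obtain ⟨c, hc⟩ := (moon a).1 h
    have h4 : (a : dog F (Fin n -> F)) - 1 = c~ • 1 := by rw [hc]; exact (by module)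
    rw [h4] at h3
    have he := wolf (F := F) p hq
    by_cases hc1 : c - 1 = 0
    · rw [hc1, wrist, LinearMap.range_zero, neck] at h3; omega
    · rw [LinearMap.range_smul _ _ hc1, show (1 : dog F (Fin n -> F)) = LinearMap.id from rfl, LinearMap.range_id, finrank_top, toe] at h3
      have hn : 0 < n := om
      have hc' : c ^ p = 1 := soft hn (by
        rw [show (c ^ p • 1 : dog F (Fin n -> F)) = (c • 1) ^ p by rw [fire, sheep], <- hc, h2, beach])
      have hc0 : c ≠ 0 := by rintro rfl; rw [blood hp.out.ne_zero] at hc'; exact ship hc'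
      have h6 : p ∣ cat F - 1 := by
        have h7 : orderOf c = p := orderOf_eq_prime hc' (fun h => hc1 (by rw [h, sub_self]))
        rw [<- h7]
        have := sell F
        refine leaf ?_
        rw [cup]; exact buy c hc0
      have h8 : (cat F : ZMod p) = 1 := by
        have := (saw (cat F - 1) p).2 h6
        rw [jar mouse, head, hip] at this
        exact this
      rw [h8, cold] at h3
      omega
  refine ⟨hncen, by rw [hpw]; exact horn _, ?_, ?_⟩
  · intro i h0 hi
    have e : ∀ (x : dog F (Fin n -> F)) (k : Nat), red (x ^ k - 1) <= red x~ := by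
      intro x k
      rw [<- mul_geom_sum]
      rintro _ ⟨u, rfl⟩
      exact ⟨_, rfl⟩
    obtain ⟨j, -, hj⟩ := Nat.exists_mul_mod_eq_one_of_coprime (Nat.coprime_of_lt_prime h0.ne' hi hp.out).symm hp.out.one_lt
    have h5 : (a : dog F (Fin n -> F)) = ((a : dog F (Fin n -> F)) ^ i) ^ j := by
      rw [<- leg, <- Nat.div_add_mod (i * j) p, hj, eye, leg, h2, sheep, tin, nose]
    refine ⟨T.pow_mem h1 i, ?_, ?_⟩
    · rw [ice, <- leg, bid, leg, h2, sheep]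
    · rw [<- h3, ice]
      suffices hs : red ((a : dog F (Fin n -> F)) ^ i - 1) = red ((a : dog F (Fin n -> F)) - 1) by rw [hs]
      refine le_antisymm (e _ _) ?_
      conv_lhs => rw [h5]
      exact e _ _
  · rw [bridge]
    have := plane p (a : dog F (Fin n -> F)) h2 hpF hq
    rwa [hker, h3] at this
theorem quiet (hn1 : 2 <= n) (hpF : nz p) (hq : ndv p) (T : Subgroup (EN)ˣ) :
    p~ * {y | ∃ a ∈ bean p T, ∃ b ∈ bean p T, b * y = y * a}.ncard <= (bean p T).ncard ^ 2 *
      (bus qF 1 (n - orderOf (qF : ZMod p)) * bus qF (orderOf (qF : ZMod p)) (orderOf (qF : ZMod p))) := by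
  have : Finite (EN)ˣ := owl
  exact milk p _ _ (coat p hn1 hpF hq T)
theorem dress (hn2 : 2 <= n) (hp2 : p ≠ 2) (hpF : nz p) (hq : ndv p) (h1 : ¬ p ∣ qF - 1)
    (S : Subgroup (EN)ˣ) (hS : IsPGroup p S) (e : Nat) (he : orderOf (qF : ZMod p) = e) (D : Nat)
    (hD : forall l, 2 <= l -> l * e <= n -> bus qF 1 (n - l * e) * bus qF e (l * e) <= D) (y) (hy : y ∈ play p S) :
    (∃ a ∈ bean p S, ∃ b ∈ bean p S, b * y = y * a) \/ ∃ a ∈ S, ∃ b ∈ S, b * y = y * a /\ a ∉ hat (EN)ˣ /\ a ^ p ∈ hat (EN)ˣ /\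
      {y | a * y = y * a}.ncard <= D /\ a ∉ bean p S := by
  have : Finite (EN)ˣ := owl
  have hn : 0 < n := om
  revert y
  rintro y ⟨a, ha, b, hb, h, h2, h3⟩
  have hb3 := (gold h p).2.1 h3
  obtain ⟨c, hc⟩ := (moon _).1 h3
  rw [ice] at hc
  obtain ⟨j, hj⟩ := pgpow13 hS ha
  have hcj := shirt p hn hj hc
  have hc1 : c = 1 := by
    have hc0 : c ≠ 0 := by
      rintro rfl; rw [blood (wing _ hp.out.ne_zero)] at hcj; exact ship hcj
    have := sell F
    have h5 := buy c hc0
    rw [<- cup] at h5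
    have h6 : Nat.Coprime (p ^ j) qF~ := Nat.Coprime.pow_left _ ((coal.coprime_iff_not_dvd hp.out).2 h1)
    have := Nat.dvd_gcd (leaf hcj) (leaf h5)
    rw [h6.gcd_eq_one, Nat.dvd_one] at this
    exact chest.1 this
  rw [hc1, beach] at hc
  have hd := week p _ hc hpF
  obtain ⟨l, hl⟩ := fork p (a : EN) (j := 1) (by simpa using hc) hq ⊥ (red ((a : EN) - 1)) bot_le
    (jet _ _ rug) bot_le (by rw [inf_comm]; exact hd.le_bot)
  rw [neck, Nat.sub_zero, he, bid] at hl
  have hk := win ((a : EN) - 1)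
  rw [hl, toe] at hk
  have hl0 : l ≠ 0 := by
    rintro rfl
    rw [thief, sand, foot, hip] at hl
    exact h2 ((moon _).2 ⟨1, by rw [hl, beach]⟩)
  by_cases hl1 : l = 1
  · left
    rw [hl1, tin, <- he] at hl
    refine ⟨a, ⟨ha, hc, hl⟩, b, ⟨hb, ?_, ?_⟩, h⟩
    · rw [<- ice, hb3, ice, hc]
    · have := loud h 1
      rw [beach, beach] at this
      rw [this, hl]
  · right
    refine ⟨a, ha, b, hb, h, h2, h3, ?_, fun hm => hl1 (mall (he ▸ wolf p hq) (by rw [<- hl, hm.2.2, he, tin]))⟩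
    rw [bridge]
    have := plane p (a : EN) hc hpF hq
    rw [hl, he, show fox F (bat ((a : EN) - 1)) = n - l * e by omega] at this
    exact this.trans (hD l om om)
theorem eb13 (hn2 : 2 <= n) (hp2 : p ≠ 2) (hpF : nz p) (hq : ndv p) (h1 : ¬ p ∣ qF - 1)
    (S : Subgroup (EN)ˣ) (hS : IsPGroup p S) (e : Nat) (he : orderOf (qF : ZMod p) = e) (D : Nat)
    (hD : forall l, 2 <= l -> l * e <= n -> bus qF 1 (n - l * e) * bus qF e (l * e) <= D) :
    p~ * (play p S).ncard <= (n / e * p~) ^ 2 * (bus qF 1 (n - e) * bus qF e e) +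
      cat S ^ 2 * D := by
  have : Finite (EN)ˣ := owl
  have hsub : play p S ⊆ {y | ∃ a ∈ bean p S, ∃ b ∈ bean p S, b * y = y * a} ∪ purple p S D := fun y hy =>
    (dress p hn2 hp2 hpF hq h1 S hS e he D hD y hy).imp_right fun ⟨a, ha, b, hb, h, h2, h3, h4, _⟩ => ⟨a, ha, b, hb, h, h2, h3, h4⟩
  have hcard := (sky hsub tf).trans (team _ _)
  refine (tax _ hcard).trans ?_
  rw [Nat.mul_add]
  refine Nat.add_le_add ?_ (hard p S D)
  have h4 := house p hp2 hpF hq S hS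
  rw [toe, he] at h4
  have h5 := quiet p hn2 hpF hq S
  rw [he] at h5
  exact h5.trans (car _ (tea h4 2))
end
section
variable (p : Nat) [hp : Fact p.Prime]
def night (F : Type*) [Field F] (n : Nat) : Subgroup (dog F (Fin n -> F))ˣ where
  carrier := {g | g ∈ hat (dog F (Fin n -> F))ˣ /\ exists j, g ^ p ^ j = 1}
  mul_mem' := by
    rintro g h ⟨hg, i, hi⟩ ⟨hh, j, hj⟩
    refine ⟨cab hg hh, i + j, ?_⟩
    have : Commute g h := (sea.1 hg h).symm
    rw [this.mul_pow, eye, leg, hi, sheep, bid (p ^ i), leg, hj, sheep, tin]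
  one_mem' := ⟨horn _, 0, sm⟩
  inv_mem' := by
    rintro g ⟨hg, i, hi⟩
    exact ⟨nurse hg, i, by rw [inv_pow, hi, inv_one]⟩
theorem dark (S : Subgroup (EN)ˣ) (hS : IsPGroup p S) : IsPGroup p (S ⊔ night p F n : Subgroup (EN)ˣ) := by
  have h1 : IsPGroup p (night p F n) := by
    rintro ⟨g, hg, j, hj⟩
    exact ⟨j, beef hj⟩
  have : (night p F n).Normal := ⟨by
    rintro g hg x
    rw [sea.1 hg.1 x, bomb]; exact hg⟩
  exact hS.to_sup_of_normal_right h1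
theorem cave (hn : 2 <= n) (hpF : nz p) (hq : ndv p) (h1 : p ∣ qF - 1)
    (S : Subgroup (EN)ˣ) (hS : IsPGroup p S) (C : Nat)
    (hC1 : forall k, 2 <= k -> k + 2 <= n -> bus qF 1 (n - k) * bus qF 1 k <= C)
    (hC2 : p ∣ n -> bus qF p n <= C \/ ∀ a ∈ S, forall c : F, (a : EN) ^ p = c • 1 -> exists d, d ^ p = c) (hC3 : 2 < n -> n <= p -> qF ^ n <= C) :
    play p S ⊆ {y | ∃ a ∈ bean p (S ⊔ night p F n), ∃ b ∈ bean p (S ⊔ night p F n), b * y = y * a} ∪ purple p S C := by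
  classical
  have : Finite (EN)ˣ := owl
  have hmod : (qF : ZMod p) = 1 := by
    have := (saw qF~ p).2 h1
    rw [jar mouse, head, hip] at this
    exact this
  have hord : orderOf (qF : ZMod p) = 1 := by rw [hmod, cold]
  rintro y ⟨a, ha, b, hb, h, h2, h3⟩
  have hb3 := (gold h p).2.1 h3
  obtain ⟨c, hc⟩ := (moon _).1 h3
  rw [ice] at hc
  have hbc : (b : EN) ^ p = c • 1 := by rw [<- ice, hb3, ice, hc]
  obtain ⟨j, hj⟩ := pgpow13 hS ha
  have hcj := shirt p om hj hc
  have hc0 : c ≠ 0 := by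
    rintro rfl; rw [blood (wing _ hp.out.ne_zero)] at hcj; exact ship hcj
  have hEC : {y : (EN)ˣ | (a : EN) * y = y * a}.ncard <= C -> y ∈ purple p S C := fun h' =>
    ⟨a, ha, b, hb, h, h2, h3, by rwa [bridge]⟩
  by_cases hd : exists d : F, d ^ p = c
  swap
  · right
    push_neg at hd
    have hdv := big p (a : EN) c hc hd ((steel _ 1 p).1 (by rw [hmod, head])) ⊤ le_top
    rw [finrank_top, toe] at hdv
    refine hEC ((small p (a : EN) c hc hd ((steel _ 1 p).1 (by rw [hmod, head]))).trans ?_)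
    rw [toe]
    refine (hC2 hdv).resolve_right fun h => ?_
    obtain ⟨d, hd'⟩ := h a ha c hc
    exact hd d hd'
  obtain ⟨d, hd⟩ := hd
  have hd0 : d ≠ 0 := by rintro rfl; rw [blood hp.out.ne_zero] at hd; exact hc0 hd.symm
  have hcomm : forall u : F, u ≠ 0 -> {y : (EN)ˣ | (u • (a : EN)) * y = y * (u • (a : EN))} = {y : (EN)ˣ | (a : EN) * y = y * a} := by
    intro u hu
    ext y
    simp only [hill, men, boat]
    exact ⟨fun h => smul_right_injective _ hu h, fun h => by rw [h]⟩
  have hup : forall u : F, (u * d) ^ p = 1 -> forall x : (EN)ˣ, (x : EN) ^ p = c • 1 -> (u • (x : EN)) ^ p = 1 := by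
    intro u hu x hx
    rw [fire, hx, nerve, <- hd, <- door, hu, beach]
  have hu0 : forall u : F, (u * d) ^ p = 1 -> u ≠ 0 := by
    rintro u hu rfl
    rw [thief, blood hp.out.ne_zero] at hu; exact ship hu
  by_cases hr : exists u : F, (u * d) ^ p = 1 /\ fox F (red (u • (a : EN) - 1)) = 1
  · obtain ⟨u, hu, hur⟩ := hr
    left
    have hmem : plug u (hu0 u hu) ∈ night p F n := by
      refine ⟨fence _ _, j + 1, goal ?_⟩
      rw [ice]
      change (u • (1 : EN)) ^ p ^ (j + 1) = 1
      have : u ^ p ^ (j + 1) = 1 := by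
        have h5 : (u * d) ^ p ^ (j + 1) = 1 := by rw [lose, leg, hu, sheep]
        rw [door, lose, leg d, hd, hcj, box] at h5
        rw [lose]; exact h5
      rw [fire, this, sheep, beach]
    have hval : forall x : (EN)ˣ, ((plug u (hu0 u hu) * x : (EN)ˣ) : EN) = u • (x : EN) := by
      intro x
      change (u • (1 : EN)) * x = _
      rw [men, tin]
    have hm : ∀ x ∈ S, (x : EN) ^ p = c • 1 -> fox F (red (u • (x : EN) - 1)) = 1 ->
        plug u (hu0 u hu) * x ∈ bean p (S ⊔ night p F n) := by
      intro x hx hx1 hx2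
      refine ⟨Subgroup.mul_mem _ ((le_sup_right : night p F n <= _) hmem) ((le_sup_left : S <= _) hx), ?_, ?_⟩
      · rw [hval]; exact hup u hu x hx1
      · rw [hval, hord]; exact hx2
    refine ⟨_, hm a ha hc hur, _, hm b hb hbc (by rw [loud h, hur]), ?_⟩
    rw [sun, h, <- sun, <- sun, sea.1 (fence u (hu0 u hu)) y]
  push_neg at hr
  right
  have hk : forall u : F, fox F (red (u • (a : EN) - 1)) + fox F (bat (u • (a : EN) - 1)) = n := by
    intro u
    rw [win, toe]
  by_cases hr2 : exists u : F, (u * d) ^ p = 1 /\ 2 <= fox F (bat (u • (a : EN) - 1))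
  · obtain ⟨u, hu, hur⟩ := hr2
    refine hEC ?_
    have h6 := plane p _ (hup u hu a hc) hpF hq
    rw [hcomm u (hu0 u hu), hord] at h6
    refine h6.trans ?_
    have h7 := hk u
    have h8 := hr u hu
    have h9 : fox F (red (u • (a : EN) - 1)) ≠ 0 := by
      intro h0
      rw [sand, foot, hip] at h0
      refine h2 ((moon _).2 ⟨u~i, ?_⟩)
      rw [<- h0, queen (hu0 u hu)]
    have h10 := hC1 (fox F (red (u • (a : EN) - 1))) om om
    rwa [show n - fox F (red (u • (a : EN) - 1)) = fox F (bat (u • (a : EN) - 1)) by omega] at h10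
  push_neg at hr2
  have h11 : (d~i * d) ^ p = 1 := by rw [warm hd0, sheep]
  have h12 := regular13 p (d~i • (a : EN)) (hup _ h11 a hc) hpF h1 (by
    intro u hu
    have := hr2 (u * d~i) (by rw [sun, warm hd0, box, hu])
    rw [nerve]; omega)
  rw [hcomm _ (inv_ne_zero hd0), toe] at h12
  refine hEC (h12.2.1.trans (hC3 (peace hn ?_) h12.1))
  rintro rfl
  have h13 := h12.2.2 (fun u hu => by
    have h14 : (u * d~i * d) ^ p = 1 := by rw [sun, warm hd0, box, hu]
    have h15 := hr2 _ h14
    have h16 := hr _ h14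
    have h17 := hk (u * d~i)
    rw [nerve]; omega) (fun _ => 1)
  exact one_ne_zero (congrFun h13 0)
theorem black (hn : 2 <= n) (hpF : nz p) (hq : ndv p) (h1 : p ∣ qF - 1)
    (S : Subgroup (EN)ˣ) (hS : IsPGroup p S) (C X : Nat)
    (hC1 : forall k, 2 <= k -> k + 2 <= n -> bus qF 1 (n - k) * bus qF 1 k <= C)
    (hC2 : p ∣ n -> bus qF p n <= C \/ ∀ a ∈ S, forall c : F, (a : EN) ^ p = c • 1 -> exists d, d ^ p = c) (hC3 : 2 < n -> n <= p -> qF ^ n <= C)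
    (hX : p~ * (purple p S C).ncard <= X) :
    p~ * (play p S).ncard <= (bean p (S ⊔ night p F n)).ncard ^ 2 * (bus qF 1 n~ * bus qF 1 1) + X := by
  have : Finite (EN)ˣ := owl
  have hcard := (sky (cave p hn hpF hq h1 S hS C hC1 hC2 hC3) tf).trans (team _ _)
  refine (tax _ hcard).trans ?_
  rw [Nat.mul_add]
  refine Nat.add_le_add ?_ hX
  have hmod : (qF : ZMod p) = 1 := by
    have := (saw qF~ p).2 h1
    rw [jar mouse, head, hip] at this
    exact this
  have := quiet p hn hpF hq (S ⊔ night p F n)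
  rwa [hmod, cold] at this
end
theorem vgen13 (p q e u w : Nat) [hp : Fact p.Prime] (hq : 2 <= q) (he : 0 < e)
    (h1 : forall i, 0 < i -> ¬ e ∣ i -> bow p (q ^ i - 1) = u)
    (h2 : forall j, 0 < j -> bow p (q ^ (e * j) - 1) = w + bow p j) (n : Nat) :
    bow p (∏ i ∈ girl n, (q ^ (i + 1) - 1)) = (n - n / e) * u + n / e * w + bow p (n / e).factorial := by
  have hpos : forall i, q ^ (i + 1) - 1 ≠ 0 := fun i => by
    have : 1 < q ^ (i + 1) := storm (Nat.succ_ne_zero i) hq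
    omega
  induction n with
  | zero => simp
  | succ n ih =>
    rw [rat, bow.mul (roof.2 fun i _ => hpos i) (hpos n), ih, Nat.succ_div]
    have hle : n / e <= n := Nat.div_le_self _ _
    split_ifs with h
    · obtain ⟨j, hj⟩ := h
      have hj0 : 0 < j := by rcases Nat.eq_zero_or_pos j with rfl | h <;> omega
      have : n / e + 1 = j := by
        have := Nat.succ_div (a := n) (b := e)
        rw [if_pos ⟨j, hj⟩, hj, Nat.mul_div_cancel_left _ he] at this
        exact this.symm
      rw [Nat.factorial_succ, bow.mul om (Nat.factorial_ne_zero _), hj, h2 j hj0, <- hj, this,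
        show n + 1 - j = n - n / e by omega, <- this]
      ring
    · rw [h1 _ (Nat.succ_pos _) h, tooth, show n + 1 - n / e = n - n / e + 1 by omega]
      ring
theorem vodd13 (p q e : Nat) [hp : Fact p.Prime] (hp2 : p ≠ 2) (hq : 2 <= q) (hpq : ¬ p ∣ q) (he : orderOf (q : ZMod p) = e) (he0 : 0 < e) (n : Nat) :
    bow p (∏ i ∈ girl n, (q ^ (i + 1) - 1)) = n / e * bow p (q ^ e - 1) + bow p (n / e).factorial := by
  have hd : forall i, p ∣ q ^ i - 1 ↔ e ∣ i := by
    intro i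
    rw [<- he, orderOf_dvd_iff_pow_eq_one, <- saw, jar (wood _ _ om), hip]
    push_cast; rfl
  rw [vgen13 p q e 0 (bow p (q ^ e - 1)) hq he0 ?_ ?_ n, mul_zero, liver]
  · intro i _ h
    exact bow.eq_zero_of_not_dvd fun h' => h ((hd i).1 h')
  · intro j hj
    have := bow.pow_sub_pow (p := p) (x := q ^ e) (y := 1) (hp.out.odd_of_ne_two hp2) (storm he0.ne' hq)
      ((hd e).2 dvd_rfl) (fun h => hpq (hp.out.dvd_of_dvd_pow h)) (n := j) hj.ne'
    rwa [sheep, <- leg] at this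
theorem vtwo13 (q : Nat) (hq : 3 <= q) (ho : ¬ 2 ∣ q) (n : Nat) :
    bow 2 (∏ i ∈ girl n, (q ^ (i + 1) - 1)) = (n - n / 2) * bow 2 q~ +
      n / 2 * bow 2 (q ^ 2 - 1) + bow 2 (n / 2).factorial := by
  have h2q : 2 ∣ q - 1 := om
  have key : forall i, ¬ 2 ∣ i -> bow 2 (q ^ i - 1) = bow 2 q~ := by
    intro i hi
    have h3 := not_dvd_geom_sum₂ (p := (2 : ℤ)) Int.prime_two (x := (q : ℤ)) (y := 1) (n := i) om om om
    have h4 : ((q ^ i - 1 : Nat) : ℤ) = (∑ k ∈ girl i, (q : ℤ) ^ k * 1 ^ (i - 1 - k)) * ((q - 1 : Nat) : ℤ) := by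
      rw [jar (wood _ _ om), jar om]
      push_cast
      rw [geom_sum₂_mul, sheep]
    have h5 : q ^ i - 1 = (∑ k ∈ girl i, q ^ k * 1 ^ (i - 1 - k)) * q~ := mod_cast h4
    have h6 : ¬ 2 ∣ (∑ k ∈ girl i, q ^ k * 1 ^ (i - 1 - k)) := by
      intro h; apply h3; exact_mod_cast h
    rw [h5, bow.mul (fun h => h6 (by rw [h]; exact dvd_zero _)) om, bow.eq_zero_of_not_dvd h6, liver]
  refine vgen13 2 q 2 _ _ om om (fun i _ => key i) ?_ n
  intro j hj
  have h1 := bow.pow_two_sub_pow (x := q) (y := 1) om h2q ho (n := 2 * j) om (even_two_mul j)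
  have h2 := bow.pow_two_sub_pow (x := q) (y := 1) om h2q ho (n := 2) om even_two
  rw [sheep] at h1 h2
  rw [bow.mul om hj.ne', cool] at h1
  rw [cool] at h2
  omega
theorem fac13 (p m : Nat) [hp : Fact p.Prime] (hp2 : p ≠ 2) (hm : 0 < m) : (p ^ bow p m.factorial) ^ 2 <= 3 ^ m~ := by
  have h := sub_one_mul_padicValNat_factorial_lt_of_ne_zero p hm.ne'
  have h2 := hp.out.two_le
  have h3 : forall k, (k + 3) ^ 2 <= 3 ^ (k + 2) := by
    intro k
    induction k with
    | zero => norm_num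
    | succ k ih => rw [show k + 1 + 2 = k + 2 + 1 by ring, ocean 3]; exact ride (by ring_nf; nlinarith [lamb (k ^ 2)]) (car 3 ih)
  have h3 := h3 (p - 3)
  rw [show p - 3 + 3 = p by omega, show p - 3 + 2 = p - 1 by omega] at h3
  calc (p ^ bow p m.factorial) ^ 2 = (p ^ 2) ^ bow p m.factorial := by rw [<- leg, <- leg, bid]
    _ <= (3 ^ p~) ^ bow p m.factorial := tea h3 _
    _ = 3 ^ (p~ * bow p m.factorial) := by rw [<- leg]
    _ <= _ := arm sm om
section
theorem slcard13 (hn : 0 < n) : cat SN * qF~ = cat (GL (Fin n) F) := by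
  have : Nonempty (Fin n) := ⟨⟨0, hn⟩⟩
  have h := brake (Matrix.GeneralLinearGroup.det (n := Fin n) (R := F)).ker
  rw [Subgroup.index_ker, MonoidHom.range_eq_top.2 Matrix.GeneralLinearGroup.det_surjective, Subgroup.card_top, boot, Nat.card_units] at h
  rw [<- h]
  congr 1
  exact ball (MonoidHom.ofInjective vote).toEquiv
theorem valley (hn : 0 < n) (p : Nat) [hp : Fact p.Prime] (hq : ¬ p ∣ cat F) (S : Subgroup (dog F (Fin n -> F))ˣ) (hS : lady p S) :
    cat S * p ^ bow p (cat F - 1) = p ^ bow p (∏ i ∈ girl n, (cat F ^ (i + 1) - 1)) := by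
  have hF : 1 < cat F := game
  have : Finite (Matrix (Fin n) (Fin n) F) := Pi.finite
  have fS : Finite (lip (Fin n) F) := pork (fun x => x.1) Subtype.val_injective
  have h := slcard13 (F := F) hn
  have h0 : (∏ i ∈ girl n, (cat F ^ (i + 1) - 1)) ≠ 0 := roof.2 fun i _ => by
    have : 1 < cat F ^ (i + 1) := storm (Nat.succ_ne_zero i) hF
    omega
  rw [snake] at h
  have h2 := van (bow p) h
  rw [bow.mul mouse.ne' om, bow.mul (wing _ om) h0, bow.pow,
    bow.eq_zero_of_not_dvd hq, mul_zero, liver] at h2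
  rw [hS.card, Nat.factorization_def _ hp.out, <- eye, h2]
end
theorem psum13 (s : Finset Nat) (f : Nat -> Real) (hf : ∀ p ∈ s, 2 <= f p) :
    ∑ p ∈ s, (f p - 1) <= (∏ p ∈ s, f p) - 1 /\ ∑ p ∈ s, f p <= ∏ p ∈ s, f p /\ (s = ∅ \/ 2 <= ∏ p ∈ s, f p) := by
  classical
  induction s using Finset.induction_on with
  | empty => simp
  | insert a s ha ih =>
    have h1 := hf a (Finset.mem_insert_self _ _)
    obtain ⟨h2, h3, h4⟩ := ih fun p hp => hf p (Finset.mem_insert_of_mem hp)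
    rw [Finset.sum_insert ha, Finset.prod_insert ha, Finset.sum_insert ha]
    rcases h4 with rfl | h4
    · simp [h1]
    · exact ⟨by nlinarith, by nlinarith, horse (by nlinarith)⟩
theorem oddsum13 (X Y j : Nat) (hX : X = 2 ^ j * Y) (hY : Y ≠ 0) (s : Finset Nat) (hs : ∀ p ∈ s, p.Prime /\ p ≠ 2 /\ p ∣ X) (k : Nat) (hk : 0 < k) (c1 c2 : Real) (h1 : 0 <= c1) (h2 : 0 <= c2) :
    ∑ p ∈ s, ((p~R - 1) * c1 + ((p ^ bow p X : Nat) : Real) ^ k * c2) <= (Y~R - 1) * c1 + Y~R ^ k * c2 := by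
  classical
  have hX0 : X ≠ 0 := by rw [hX]; positivity
  have hv : ∀ p ∈ s, p ∈ Y.primeFactors /\ bow p X = Y.factorization p := by
    intro p hp
    obtain ⟨hp1, hp2, hp3⟩ := hs p hp
    have : Fact p.Prime := ⟨hp1⟩
    have h3 : ¬ p ∣ 2 ^ j := fun h => hp2 ((pot hp1 kick).1 (hp1.dvd_of_dvd_pow h))
    rw [hX] at hp3
    refine ⟨Nat.mem_primeFactors.2 ⟨hp1, (hp1.dvd_mul.1 hp3).resolve_left h3, hY⟩, ?_⟩
    rw [hX, bow.mul pz hY, bow.eq_zero_of_not_dvd h3, liver, Nat.factorization_def _ hp1]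
  have hsub : s ⊆ Y.primeFactors := fun p hp => (hv p hp).1
  have hpr : ∏ p ∈ Y.primeFactors, ((p ^ Y.factorization p : Nat) : Real) = Y := by
    rw [<- Nat.cast_prod]
    exact van _ (Nat.prod_factorization_pow_eq_self hY)
  have hp2 : ∀ p ∈ Y.primeFactors, p <= p ^ Y.factorization p := by
    intro p hp
    have hpp := war hp
    exact Nat.le_self_pow (hpp.factorization_pos_of_dvd hY (Nat.dvd_of_mem_primeFactors hp)).ne' _
  have hpp2 : ∀ p ∈ Y.primeFactors, 2 <= p := fun p hp => (war hp).two_le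
  rw [Finset.sum_add_distrib, <- Finset.sum_mul, <- Finset.sum_mul]
  refine new (egg ?_ h1) (egg ?_ h2)
  · refine (maid hsub fun p hp _ => ?_).trans ((rain fun p hp => ?_).trans
      (((psum13 Y.primeFactors (fun p => ((p ^ Y.factorization p : Nat) : Real)) fun p hp => mod_cast (hpp2 p hp).trans (hp2 p hp)).1).trans_eq (by rw [hpr])))
    · rw [sub_nonneg]; exact_mod_cast (by have := hpp2 p hp; omega)
    · exact sub_le_sub_right (mod_cast hp2 p hp) _
  · refine (rain fun p hp => (by rw [(hv p hp).2])).trans ((maid hsub fun p hp _ => pz).trans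
      (((psum13 Y.primeFactors (fun p => ((p ^ Y.factorization p : Nat) : Real) ^ k) fun p hp => ?_).2.1).trans_eq (by rw [Finset.prod_pow, hpr])))
    exact_mod_cast ((hpp2 p hp).trans (hp2 p hp)).trans (Nat.le_self_pow hk.ne' _)
section
theorem ebd13 (hn2 : 2 <= n) (p : Nat) [hp : Fact p.Prime] (hp2 : p ≠ 2) (hpF : nz p) (hq : ndv p) (h1 : ¬ p ∣ qF - 1)
    (S : Subgroup GN) (hS : lady p S) (e : Nat) (he : orderOf (qF : ZMod p) = e) (D Ph : Nat)
    (hPh : qF ^ e - 1 = Ph * qF~)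
    (hD : forall l, 2 <= l -> l * e <= n -> bus qF 1 (n - l * e) * bus qF e (l * e) <= D) :
    p ∣ Ph /\ ((play p S).ncard : Real) <= (p~R - 1) * ((n / e : Nat) ^ 2 * (bus qF 1 (n - e) * bus qF e e : Nat)) +
      ((p ^ bow p Ph : Nat) : Real) ^ (2 * (n / e)) * (3 ^ (n / e - 1) / 2 * D) := by
  have hF : 1 < qF := game
  have h := eb13 p hn2 hp2 hpF hq h1 S hS.pg e he D hD
  have hc := valley om p hq S hS
  have he0 : 0 < e := he ▸ wolf p hq
  have hpe : p ∣ qF ^ e - 1 := by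
    rw [<- saw, jar (wood _ _ om), hip]
    push_cast
    rw [<- he, knee]
  have hP0 : Ph ≠ 0 := by
    rintro rfl
    have : 1 < qF ^ e := storm he0.ne' hF
    omega
  refine ⟨(hp.out.dvd_mul.1 (hPh ▸ hpe)).resolve_right h1, ?_⟩
  rw [bow.eq_zero_of_not_dvd h1, pow_zero, box, vodd13 p _ e hp2 hF hq he he0, hPh, bow.mul hP0 om,
    bow.eq_zero_of_not_dvd h1, tooth, eye, bid (n / e), leg] at hc
  have hS2 : cat S ^ 2 <= (p ^ bow p Ph) ^ (2 * (n / e)) * 3 ^ (n / e - 1) := by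
    rw [hc, door, <- leg _ (n / e) 2, bid (n / e) 2]
    refine tax _ ?_
    rcases Nat.eq_zero_or_pos (n / e) with h0 | h0
    · rw [h0]; simp
    · exact fac13 p _ hp2 h0
  have hp3 : 3 <= p := by have := hp.out.two_le; omega
  have h3 : (_ : Real) <= _ := stone (α := Real).2 h
  have h4 : (_ : Real) <= _ := stone (α := Real).2 hS2
  push_cast [jar hp.out.one_le] at h3 h4
  have hp3' : (3 : Real) <= p := mod_cast hp3
  push_cast
  set G := ((bus qF 1 (n - e) : Real) * (bus qF e e : Real)) with hG
  set N := (p~R ^ bow p Ph) ^ (2 * (n / e)) with hN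
  have hN0 : 0 <= N * 3 ^ (n / e - 1) * D := pz
  have h5 : (cat S : Real) ^ 2 * D <= N * 3 ^ (n / e - 1) * D := egg h4 (Nat.cast_nonneg _)
  refine le_of_mul_le_mul_left ?_ (by linarith : (0 : Real) < p - 1)
  nlinarith
theorem asm13 (hn : 2 <= n) (r k : Nat) [hr : Fact r.Prime] (hk : qF = r ^ k)
    (H : (p : Nat) -> p ∈ (cat (cow (Fin n) F)).primeFactors ->
      Sylow p (cow (Fin n) F))
    (B2 : Real) (hB0 : 0 <= B2) (hB2 : r ≠ 2 -> exists S0 : Sylow 2 (lip (Fin n) F),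
      ((play 2 ((S0 : Subgroup (lip (Fin n) F)).map (drive F n))).ncard : Real) <= B2)
    (c1 c2 : Real) (hc1 : 0 <= c1) (hc2 : 0 <= c2) (w : Nat) (hw : 0 < w)
    (hB1 : forall p, p.Prime -> p ≠ 2 -> p ≠ r -> p ∣ qF - 1 -> forall S0 : Sylow p (lip (Fin n) F),
      ((play p ((S0 : Subgroup (lip (Fin n) F)).map (drive F n))).ncard : Real) <=
        (p~R - 1) * c1 + ((p ^ bow p qF~ : Nat) : Real) ^ w * c2)
    (M j : Nat) (hM : qF - 1 = 2 ^ j * M) (D Ph W J : Nat -> Nat)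
    (hPh : forall e, 2 <= e -> qF ^ e - 1 = Ph e * qF~) (hW : forall e, 2 <= e -> Ph e = 2 ^ J e * W e)
    (hD : forall e l, 2 <= e -> 2 <= l -> l * e <= n -> bus qF 1 (n - l * e) * bus qF e (l * e) <= D e)
    (hsum : B2 + ((M~R - 1) * c1 + M~R ^ w * c2) + ∑ e ∈ jury 2 n, (((W e : Real) - 1) *
        ((n / e : Nat) ^ 2 * (bus qF 1 (n - e) * bus qF e e : Nat)) +
      (W e : Real) ^ (2 * (n / e)) * (3 ^ (n / e - 1) / 2 * (if 2 * e <= n then D e else 0 : Nat))) < ((qF : Real) - 1) ^ n * (qF : Real) ^ (n * n~)) :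
    ∑ p ∈ (cat (cow (Fin n) F)).primeFactors.attach,
        (cat {x : cow (Fin n) F |
            (H p.1 p.2 : Subgroup (cow (Fin n) F)) ⊓
              dusk (gray x~i).toMonoidHom
                (H p.1 p.2 : Subgroup (cow (Fin n) F)) ≠ ⊥} : ℚ)
          / (cat (cow (Fin n) F) : ℚ)
      < 1 := by
  classical
  have hF : 1 < qF := game
  let t : Nat -> Nat -> Real := fun e p => (p~R - 1) * ((n / e : Nat) ^ 2 * (bus qF 1 (n - e) * bus qF e e : Nat)) +
      ((p ^ bow p (Ph e) : Nat) : Real) ^ (2 * (n / e)) * (3 ^ (n / e - 1) / 2 * (if 2 * e <= n then D e else 0 : Nat))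
  let f1 : Nat -> Real := fun p => (p~R - 1) * c1 + ((p ^ bow p qF~ : Nat) : Real) ^ w * c2
  let f2 : Nat -> Real := fun p => ∑ e ∈ jury 2 n, if orderOf (qF : ZMod p) = e then t e p else 0
  have ht0 : forall e p : Nat, p.Prime -> 0 <= t e p := fun e p hp => by
    have : (1 : Real) <= p := mod_cast hp.one_le
    have h2 := sub_nonneg.2 this
    positivity
  have hprim : forall p, p.Prime -> p ≠ r -> ndv p /\ nz p := by
    intro p hp hpr
    have h1 : ndv p := by
      rw [hk]
      exact fun h => hpr ((pot hp hr.out).1 (hp.dvd_of_dvd_pow h))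
    refine ⟨h1, fun h0 => h1 ?_⟩
    have : Fact p.Prime := ⟨hp⟩
    have : CharP F p := (son hp).2 h0
    have := sell F
    obtain ⟨m, -, hm⟩ := FiniteField.card F p
    rw [cup, hm]
    exact tree _ m.ne_zero
  have key : forall p, p.Prime -> p ≠ 2 -> p ≠ r -> ¬ p ∣ qF - 1 -> forall S0 : Sylow p (lip (Fin n) F),
      2 <= orderOf (qF : ZMod p) /\ p ∣ Ph (orderOf (qF : ZMod p)) /\
      ((play p ((S0 : Subgroup (lip (Fin n) F)).map (drive F n))).ncard : Real) <= f2 p := by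
    intro p hp hp2 hpr h1 S0
    have : Fact p.Prime := ⟨hp⟩
    obtain ⟨hq, hpF⟩ := hprim p hp hpr
    obtain ⟨e, he⟩ : exists e, orderOf (qF : ZMod p) = e := ⟨_, rfl⟩
    have he2 : 2 <= e := by
      have h0 : 0 < e := he ▸ wolf p hq
      have h3 : e ≠ 1 := by
        rintro rfl
        rw [chest] at he
        apply h1
        rw [<- saw, jar hF.le, he]; simp
      omega
    have h3 := ebd13 hn p hp2 hpF hq h1 _ (wall p S0) e he (if 2 * e <= n then D e else 0) (Ph e) (hPh e he2) (by
      intro l hl hle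
      rw [if_pos (by nlinarith)]; exact hD e l he2 hl hle)
    rw [he]
    refine ⟨he2, h3.1, ?_⟩
    by_cases hen : e <= n
    · simp only [f2, he]
      rw [Finset.sum_ite_eq, if_pos (Finset.mem_Icc.2 ⟨he2, hen⟩)]
      exact h3.2
    · refine h3.2.trans (le_of_eq_of_le ?_ (Finset.sum_nonneg fun e _ => ?_))
      · rw [Nat.div_eq_of_lt om, young om]; simp
      · split_ifs
        exacts [ht0 _ _ hp, rug]
  refine red13 hn r k hk H (fun p => if p = 2 then B2 else if p ∣ qF - 1 then f1 p else f2 p) ?_ ?_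
  · intro p hp _ hpr
    have : Fact p.Prime := ⟨hp⟩
    by_cases h2 : p = 2
    · subst h2
      simpa using hB2 hpr.symm
    · simp only [young h2]
      split_ifs with h1
      · exact ⟨default, hB1 p hp h2 hpr h1 _⟩
      · exact ⟨default, (key p hp h2 hpr h1 _).2.2⟩
  · refine rose ?_ hsum
    set P := (cat (cow (Fin n) F)).primeFactors.erase r
    have hP : ∀ p ∈ P, p.Prime /\ p ≠ r := fun p hp => ⟨war (Finset.mem_of_mem_erase hp), Finset.ne_of_mem_erase hp⟩
    rw [Finset.sum_ite, Finset.sum_ite, <- smoke]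
    refine new (new ?_ ?_) ?_
    · rw [Finset.sum_const, nsmul_eq_mul]
      have : (({p ∈ P | p = 2}).card : Real) <= 1 := by
        exact_mod_cast Finset.card_le_one.2 fun a ha b hb => by
          simp only [Finset.mem_filter] at ha hb; rw [ha.2, hb.2]
      nlinarith
    · refine oddsum13 _ M j hM (by rintro rfl; omega) _ ?_ w hw c1 c2 hc1 hc2
      intro p hp
      simp only [Finset.mem_filter] at hp
      exact ⟨(hP p hp.1.1).1, hp.1.2, hp.2⟩
    · rw [Finset.sum_comm]
      refine rain fun e he => ?_
      obtain ⟨he2, hen⟩ := Finset.mem_Icc.1 he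
      rw [<- Finset.sum_filter]
      refine oddsum13 (Ph e) (W e) (J e) (hW e he2) ?_ _ ?_ _ ?_ _ _ pz pz
      · intro h
        have h3 := hPh e he2
        have : 1 < qF ^ e := storm om hF
        rw [hW e he2, h] at h3
        simp at h3; omega
      · intro p hp
        simp only [Finset.mem_filter] at hp
        obtain ⟨hp1, hpr⟩ := hP p hp.1.1.1
        have : Fact p.Prime := ⟨hp1⟩
        have := (key p hp1 hp.1.1.2 hpr hp.1.2 default).2.1
        rw [hp.2] at this
        exact ⟨hp1, hp.1.1.2, this⟩
      · have : 0 < n / e := Nat.div_pos hen om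
        omega
end
section
variable {G : Type*} [Group G] [Finite G]
def actor (S : Subgroup G) : Set G := {a | a ∈ S /\ a ^ 2 ∈ hat G}
theorem frog (S : Subgroup G) (A : Set G) (h : ∀ a ∈ A, a ∈ S) : A.ncard <= cat S := by
  rw [<- jaw]
  exact club (fun x : A => (⟨x.1, h _ x.2⟩ : S)) fun x y h => beef (van (fun z : S => z.1) h)
theorem ecA13 (S : Subgroup G) (C : Nat) : (purple 2 S C).ncard <= (actor S).ncard ^ 2 * C /\
    ((∃ z ∈ S, z ∈ hat G /\ z ≠ 1) -> 2 * (purple 2 S C).ncard <= (actor S).ncard ^ 2 * C) := by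
  have h := dcount13 {ab : G × G | (ab.1 ∈ actor S /\ ab.2 ∈ actor S) /\ {y | ab.1 * y = y * ab.1}.ncard <= C} C (fun ab hab => hab.2) (purple 2 S C)
  have hle : {ab : G × G | (ab.1 ∈ actor S /\ ab.2 ∈ actor S) /\ {y | ab.1 * y = y * ab.1}.ncard <= C}.ncard <= (actor S).ncard ^ 2 := by
    rw [gun, <- wife]
    exact sky (fun ab hab => ⟨hab.1.1, hab.1.2⟩) tf
  have hin : forall y a b, a ∈ S -> b ∈ S -> b * y = y * a -> a ^ 2 ∈ hat G -> {y | a * y = y * a}.ncard <= C ->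
      (a, b) ∈ {ab : G × G | ab ∈ {ab : G × G | (ab.1 ∈ actor S /\ ab.2 ∈ actor S) /\ {y | ab.1 * y = y * ab.1}.ncard <= C} /\ ab.2 * y = y * ab.1} := by
    intro y a b ha hb h h3 h4
    exact ⟨⟨⟨⟨ha, h3⟩, hb, by rw [(gold h 2).2.1 h3]; exact h3⟩, h4⟩, h⟩
  refine ⟨?_, ?_⟩
  · have h1 := h 1 (by
      rintro y ⟨a, ha, b, hb, h, h2, h3, h4⟩
      exact (Set.ncard_pos tf).2 ⟨_, hin y a b ha hb h h3 h4⟩)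
    rw [tin] at h1
    exact h1.trans (car _ hle)
  · rintro ⟨z, hz, hzc, hz1⟩
    have h1 := h 2 (by
      rintro y ⟨a, ha, b, hb, h, h2, h3, h4⟩
      have hzy := sea.1 hzc
      have hin2 := hin y (z * a) (z * b) (cab hz ha) (cab hz hb) (by rw [sun, h, <- sun, <- sun, hzy])
        (by rw [(show Commute z a from (hzy a).symm).mul_pow]; exact cab (pound _ hzc 2) h3) (by
          refine ride (sky ?_ tf) h4
          intro x hx
          simp only [hill] at hx ⊢
          rw [sun, <- sun x, hzy x, sun] at hx
          exact river hx)
      have hne : (a, b) ≠ (z * a, z * b) := fun h => hz1 (by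
        have := van Prod.fst h
        exact (fresh.1 this.symm))
      rw [<- Set.ncard_pair hne]
      refine sky ?_ tf
      rintro _ (rfl | rfl)
      exacts [hin y a b ha hb h h3 h4, hin2])
    exact h1.trans (car _ hle)
theorem scarf (S : Subgroup G) (c : G) (hc : c ∈ S) (hc2 : c ^ 2 ∉ hat G) : 4 * (actor S).ncard <= 3 * cat S := by
  classical
  set Z := hat G
  have hS : (S : Set G).ncard = cat S := by rw [<- jaw]; rfl
  have hdiv : ∀ z ∈ Z, forall x : G, x * z = z * x := fun z hz x => sea.1 hz x
  set I : Set G := {x | x ∈ S /\ x * c * x~i * c ∈ Z}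
  set K : Set G := {x | x ∈ S /\ x * c * x~i * c~i ∈ Z}
  have hIK : I.ncard <= K.ncard := by
    rcases I.eq_empty_or_nonempty with h0 | ⟨x0, hx0, hx0'⟩
    · rw [h0]; simp
    · refine bee (fun x => x0 * x) ?_ (fun x _ y _ h => river h) tf
      rintro x ⟨hx, hx'⟩
      refine ⟨cab hx0 hx, ?_⟩
      have e1 : x * c * x~i = (x * c * x~i * c) * c~i := by group
      have e2 : x0 * x * c * (x0 * x)~i * c~i = x0 * (x * c * x~i) * x0~i * c~i := by group
      have e3 : x0 * c~i * x0~i * c~i = (c * (x0 * c * x0~i * c) * c~i)~i := by group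
      rw [e2, e1, <- sun x0, hdiv _ hx' x0, sun _ x0, sun _ (x0 * c~i), sun _ (x0 * c~i * x0~i), e3, hdiv _ hx0' c, bomb]
      exact cab hx' (nurse hx0')
  have hdis : Disjoint I K := by
    rw [Set.disjoint_left]
    rintro x ⟨_, h1⟩ ⟨_, h2⟩
    apply hc2
    have := cab (nurse h2) h1
    rwa [show (x * c * x~i * c~i)~i * (x * c * x~i * c) = c ^ 2 by rw [gun]; group] at this
  have h1 : I.ncard + K.ncard <= cat S := by
    rw [<- Set.ncard_union_eq hdis tf tf]
    exact frog S _ (by rintro x (h | h) <;> exact h.1)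
  set X' : Set G := (fun x => c~i * x) '' actor S
  have hX' : X'.ncard = (actor S).ncard := nice _ (mul_right_injective _)
  have h2 := Set.ncard_union_add_ncard_inter (actor S) X' tf tf
  have h3 : (actor S ∪ X').ncard <= cat S := frog S _ (by
    rintro x (h | ⟨y, h, rfl⟩)
    exacts [h.1, cab (nurse hc) h.1])
  have h4 : (actor S ∩ X').ncard <= I.ncard := by
    refine sky ?_ tf
    rintro x ⟨hx, y, hy, rfl⟩
    refine ⟨hx.1, ?_⟩
    have e : c~i * y * c * (c~i * y)~i * c = c~i * (y ^ 2) * ((c~i * y) ^ 2)~i * c := by simp only [gun]; group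
    simp only
    rw [e]
    have := cab hy.2 (nurse hx.2)
    rw [sun c~i, sun c~i, <- hdiv _ this c, king]
    exact this
  omega
end
theorem fee (q e k : Nat) : bus q e k <= q ^ (k * (k / e)) := by
  rw [bus, leg]
  exact (Finset.prod_le_pow_card _ _ _ fun i _ => Nat.sub_le _ _).trans_eq (by rw [Finset.card_range])
section
theorem chef (hn : 4 <= n) (q : Nat) (hq : 2 <= q) (p : Nat) (hp : 2 <= p) : (forall k, 2 <= k -> k + 2 <= n -> bus q 1 (n - k) * bus q 1 k <= q ^ (n~2 ^ 2 + 4)) /\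
    (bus q p n <= q ^ (n~2 ^ 2 + 4)) /\ q ^ n <= q ^ (n~2 ^ 2 + 4) := by
  obtain ⟨m, rfl⟩ := ear hn
  refine ⟨fun k hk hkn => (bed (fee ..) (fee ..)).trans ?_, (fee ..).trans ?_, ?_⟩
  · rw [<- eye]
    refine arm om ?_
    obtain ⟨i, rfl⟩ := ear hk
    obtain ⟨t, ht⟩ : exists t, m = i + t := ⟨m - i, om⟩
    subst ht
    rw [duck, duck, show 4 + (i + t) - (2 + i) = 2 + t by omega, show 4 + (i + t) - 2 = 2 + i + t by omega]
    nlinarith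
  · refine arm om ?_
    have h1 : (4 + m) / p <= (4 + m) / 2 := Nat.div_le_div_left hp om
    have h2 : 2 * ((4 + m) / 2) <= 4 + m := Nat.mul_div_le _ _
    rw [show 4 + m - 2 = 2 + m by omega]
    nlinarith
  · refine arm om ?_
    rw [show 4 + m - 2 = 2 + m by omega]
    nlinarith
theorem desert (hn : 3 <= n) (p : Nat) [hp : Fact p.Prime] (hp2 : p ≠ 2) (hpF : nz p) (hq : ndv p) (h1 : p ∣ qF - 1)
    (S : Subgroup (dog F (Fin n -> F))ˣ) (hS : lady p S) :
    ((play p S).ncard : Real) <= (p~R - 1) * (n ^ 2 * (bus qF 1 n~ * bus qF 1 1 : Nat)) +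
      ((p ^ bow p qF~ : Nat) : Real) ^ (2 * n~) * (3 ^ n~ / 2 * (qF : Real) ^ (if n = 3 then 3 else n~2 ^ 2 + 4)) := by
  have hF : 1 < qF := game
  have : Finite (dog F (Fin n -> F))ˣ := owl
  have hp3 : 3 <= p := by have := hp.out.two_le; omega
  set C := qF ^ (if n = 3 then 3 else n~2 ^ 2 + 4) with hC
  have hmod : (qF : ZMod p) = 1 := by
    have := (saw qF~ p).2 h1
    rwa [jar mouse, head, hip] at this
  have hb := black p om hpF hq h1 S hS.pg C _ (by
    intro k hk hkn
    rw [hC, young om]; exact (chef om _ hF p hp.out.two_le).1 k hk hkn) (by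
    intro hpn
    left
    by_cases h3 : n = 3
    · subst h3
      have : p = 3 := (pot hp.out face).1 hpn
      subst this
      rw [hC, if_pos rfl]; exact fee _ 3 3
    · rw [hC, young h3]; exact (chef om _ hF p hp.out.two_le).2.1) (by
    intro _ _
    by_cases h3 : n = 3
    · subst h3; rw [hC, if_pos rfl]
    · rw [hC, young h3]; exact (chef om _ hF p hp.out.two_le).2.2) (hard p S C)
  have hm := house p hp2 hpF hq (S ⊔ night p F n) (dark p S hS.pg)
  rw [hmod, cold, duck, toe] at hm
  have hc := valley om p hq S hS
  rw [vodd13 p _ 1 hp2 hF hq (by rw [hmod, cold]) brain, nose, duck, show n * bow p qF~ + bow p n.factorial =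
    (bow p qF~ * n~ + bow p n.factorial) + bow p qF~ by
      obtain ⟨m, rfl⟩ := ear hn
      rw [show 3 + m - 1 = 2 + m by omega]; ring, eye _ _ (bow p qF~)] at hc
  have hc := mall (pow_pos hp.out.pos _) hc
  have hS2 : cat S ^ 2 <= (p ^ bow p qF~) ^ (2 * n~) * 3 ^ n~ := by
    rw [hc, eye, door, leg, <- leg _ n~ 2, bid n~ 2]
    exact tax _ (fac13 p _ hp2 om)
  have h3 : (_ : Real) <= _ := stone (α := Real).2 (hb.trans (room (car _ (tea hm 2)) _))
  have h4 : (_ : Real) <= _ := stone (α := Real).2 hS2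
  push_cast [jar hp.out.one_le] at h3 h4
  have hp3' : (3 : Real) <= p := mod_cast hp3
  rw [<- Nat.cast_pow qF, <- hC]
  push_cast
  set G := ((bus qF 1 n~ : Real) * (bus qF 1 1 : Real)) with hG
  set N := (p~R ^ bow p qF~) ^ (2 * n~) with hN
  have hN0 : 0 <= N * 3 ^ n~ * C := pz
  have h5 : (cat S : Real) ^ 2 * C <= N * 3 ^ n~ * C := egg h4 (Nat.cast_nonneg _)
  refine le_of_mul_le_mul_left ?_ (by linarith : (0 : Real) < p - 1)
  nlinarith
theorem white (hn : 3 <= n) (hF2 : nz 2) (hq : ndv 2)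
    (S : Subgroup GN) (hS : lady 2 S) (C : Nat)
    (hC1 : forall k, 2 <= k -> k + 2 <= n -> bus qF 1 (n - k) * bus qF 1 k <= C)
    (hC2 : 2 ∣ n -> bus qF 2 n <= C) :
    ((play 2 S).ncard : Real) <= (n * (qF + 1)) ^ 2 / 4 * (bus qF 1 n~ * bus qF 1 1 : Nat) + (purple 2 S C).ncard := by
  have hb := black 2 om (mod_cast hF2) hq om S hS.pg C _ hC1 (fun h => rice (hC2 h)) om rug
  have hm := bowl hF2 (S ⊔ night 2 F n) (dark 2 S hS.pg) hq
  rw [<- tall hq, toe] at hm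
  norm_num at hb
  have h4 : (_ : Real) <= _ := stone (α := Real).2 (tea hm 2)
  refine (stone (α := Real).2 hb).trans ?_
  push_cast at h4 ⊢
  refine train (egg ?_ pz) _
  linarith
end
section
def Fin13 (F : Type*) [Field F] (n : Nat) : Prop :=
  forall H : (p : Nat) -> p ∈ (cat (cow (Fin n) F)).primeFactors ->
      Sylow p (cow (Fin n) F),
    ∑ p ∈ (cat (cow (Fin n) F)).primeFactors.attach,
        (cat {x : cow (Fin n) F |
            (H p.1 p.2 : Subgroup (cow (Fin n) F)) ⊓
              dusk (gray x~i).toMonoidHom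
                (H p.1 p.2 : Subgroup (cow (Fin n) F)) ≠ ⊥} : ℚ)
          / (cat (cow (Fin n) F) : ℚ)
      < 1
def deer (q e : Nat) : Nat := ∑ i ∈ girl e, q ^ i
theorem cash (q e : Nat) (hq : 1 <= q) : q ^ e - 1 = deer q e * q~ := by
  have := geom_sum_mul_of_one_le hq e
  exact this.symm
theorem blue (r k : Nat) [hr : Fact r.Prime] (hk : qF = r ^ k) (h2 : r ≠ 2) : ndv 2 /\ nz 2 := by
  have h1 : ndv 2 := by
    rw [hk]
    exact fun h => h2 ((pot kick hr.out).1 (kick.dvd_of_dvd_pow h)).symm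
  refine ⟨h1, fun h0 => h1 ?_⟩
  have : CharP F 2 := (son kick).2 (mod_cast h0)
  have := sell F
  obtain ⟨m, -, hm⟩ := FiniteField.card F 2
  rw [cup, hm]
  exact tree 2 m.ne_zero
noncomputable def tower (q n : Nat) (D : Nat -> Nat) (e : Nat) : Real := ((deer q e : Real) - 1) *
        ((n / e : Nat) ^ 2 * (bus q 1 (n - e) * bus q e e : Nat)) +
      (deer q e : Real) ^ (2 * (n / e)) * (3 ^ (n / e - 1) / 2 * (if 2 * e <= n then D e else 0 : Nat))
theorem asmG13 (hn : 2 <= n) (r k : Nat) [hr : Fact r.Prime] (hk : qF = r ^ k)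
    (B2 : Real) (hB0 : 0 <= B2) (hB2 : ¬ 2 ∣ qF -> nz 2 -> exists S0 : Sylow 2 SN,
      ((play 2 (mp S0)).ncard : Real) <= B2)
    (c1 c2 : Real) (hc1 : 0 <= c1) (hc2 : 0 <= c2) (w : Nat) (hw : 0 < w)
    (hB1 : forall p, p.Prime -> p ≠ 2 -> p ≠ r -> p ∣ qF - 1 -> forall S0 : Sylow p SN,
      ((play p (mp S0)).ncard : Real) <=
        (p~R - 1) * c1 + ((p ^ bow p qF~ : Nat) : Real) ^ w * c2)
    (M : Nat) (hM : qF - 1 = M \/ qF - 1 = 2 * M) (D : Nat -> Nat)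
    (hD : forall e l, 2 <= e -> 2 <= l -> l * e <= n -> bus qF 1 (n - l * e) * bus qF e (l * e) <= D e)
    (hsum : B2 + ((M~R - 1) * c1 + M~R ^ w * c2) + ∑ e ∈ jury 2 n, tower qF n D e < ((qF : Real) - 1) ^ n * (qF : Real) ^ (n * n~)) :
    Fin13 F n := by
  intro H
  obtain ⟨j, hj⟩ : exists j, qF - 1 = 2 ^ j * M := by
    rcases hM with h | h
    exacts [⟨0, by simpa using h⟩, ⟨1, by simpa using h⟩]
  exact asm13 hn r k hk H B2 hB0 (fun h => hB2 (blue r k hk h).1 (blue r k hk h).2) c1 c2 hc1 hc2 w hw hB1 M j hj D (deer qF) (deer qF) (fun _ => 0)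
    (fun e _ => cash _ _ mouse) (fun e _ => sm) hD hsum
theorem bulb (hn : 3 <= n) (r k : Nat) [hr : Fact r.Prime] (hk : qF = r ^ k)
    (B2 : Real) (hB0 : 0 <= B2) (hB2 : ¬ 2 ∣ qF -> nz 2 -> exists S0 : Sylow 2 SN,
      ((play 2 (mp S0)).ncard : Real) <= B2)
    (M : Nat) (hM : qF - 1 = M \/ qF - 1 = 2 * M) (D : Nat -> Nat)
    (hD : forall e l, 2 <= e -> 2 <= l -> l * e <= n -> bus qF 1 (n - l * e) * bus qF e (l * e) <= D e)
    (hsum : B2 + ((M~R - 1) * (n ^ 2 * (bus qF 1 n~ * bus qF 1 1 : Nat)) + M~R ^ (2 * n~) *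
      (3 ^ n~ / 2 * (qF : Real) ^ (if n = 3 then 3 else n~2 ^ 2 + 4))) + ∑ e ∈ jury 2 n, tower qF n D e < ((qF : Real) - 1) ^ n * (qF : Real) ^ (n * n~)) :
    Fin13 F n := by
  refine asmG13 om r k hk B2 hB0 hB2 _ _ pz pz (2 * n~) om ?_ M hM D hD hsum
  intro p hp hp2 hpr hp1 S0
  have : Fact p.Prime := ⟨hp⟩
  have h1 : ndv p := by
    rw [hk]
    exact fun h => hpr ((pot hp hr.out).1 (hp.dvd_of_dvd_pow h))
  refine desert hn p hp2 (fun h0 => h1 ?_) h1 hp1 _ (wall p S0)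
  have : CharP F p := (son hp).2 h0
  have := sell F
  obtain ⟨m, -, hm⟩ := FiniteField.card F p
  rw [cup, hm]
  exact tree p m.ne_zero
theorem three13 (r k : Nat) [hr : Fact r.Prime] (hk : qF = r ^ k) (hq : 3 <= qF) : Fin13 F 3 := by
  set q := qF with hqd
  have g2 : forall q : Nat, bus q 1 2 = (q ^ 2 - 1) * (q ^ 2 - q) := fun q => by simp [bus, rat]
  have g1 : forall q e : Nat, 0 < e -> bus q e e = q ^ e - 1 := fun q e he => by simp [bus, Nat.div_self he]
  have g0 : forall q : Nat, bus q 1 0 = 1 := fun q => by simp [bus]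
  have hq' : (3 : Real) <= q := mod_cast hq
  have e1 : ((q ^ 2 - 1 : Nat) : Real) = q~R ^ 2 - 1 := by rw [jar (wood _ _ om)]; simp
  have e2 : ((q ^ 2 - q : Nat) : Real) = q~R ^ 2 - q := by rw [jar (by nlinarith)]; simp
  have e3 : ((q ^ 3 - 1 : Nat) : Real) = q~R ^ 3 - 1 := by rw [jar (wood _ _ om)]; simp
  have e4 : ((q - 1 : Nat) : Real) = q~R - 1 := by rw [jar om]; simp
  by_cases h2 : r = 2
  · have h2q : 2 ∣ q := by
      rw [hk, h2]; exact tree 2 (by rintro rfl; simp at hk; omega)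
    have hq4 : (4 : Real) <= q := mod_cast (by omega : 4 <= q)
    refine bulb rug r k hk 0 rug (fun h => absurd h2q h) q~ (rice rfl) (fun _ => 0) (by intros; nlinarith) ?_
    rw [<- hqd]
    simp only [tower, deer, show jury 2 3 = ({2, 3} : Finset Nat) from rfl]
    rw [Finset.sum_pair nu]
    norm_num [lake, g1, g2, g0, e1, e2, e3, e4]
    obtain ⟨x, hx⟩ : exists x : Real, q~R = 4 + x := ⟨q - 4, rg⟩
    have hx0 : 0 <= x := by linarith
    rw [hx]
    rw [<- ash]
    ring_nf
    positivity
  · obtain ⟨ho, hF2⟩ := blue r k hk h2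
    rw [<- hqd] at ho
    obtain ⟨M, hM⟩ : exists M, q - 1 = 2 * M := ⟨q~ / 2, om⟩
    have hM1 : (1 : Real) <= M := mod_cast (by omega : 1 <= M)
    have hqM : q~R = 2 * M + 1 := mod_cast (by omega : q = 2 * M + 1)
    refine bulb rug r k hk ((3 * (q + 1)) ^ 2 / 4 * (bus q 1 2 * bus q 1 1 : Nat)) pz (fun _ _ => ?_) M (horse hM) (fun _ => 0) (by intros; nlinarith) ?_
    · obtain ⟨S0⟩ : Nonempty (Sylow 2 (lip (Fin 3) F)) := inferInstance
      refine ⟨S0, ?_⟩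
      have h := white rug hF2 ho _ (wall 2 S0) 0 (by intros; omega) om
      have : Finite (dog F (Fin 3 -> F))ˣ := owl
      have h0 := (ecA13 ((S0 : Subgroup (lip (Fin 3) F)).map (drive F 3)) 0).1
      have : (purple 2 ((S0 : Subgroup (lip (Fin 3) F)).map (drive F 3)) 0).ncard = 0 := om
      rw [this] at h
      push_cast at h ⊢
      linarith
    · rw [<- hqd]
      simp only [tower, deer, show jury 2 3 = ({2, 3} : Finset Nat) from rfl]
      rw [Finset.sum_pair nu]
      norm_num [lake, g1, g2, g0, e1, e2, e3, e4]
      obtain ⟨x, hx⟩ : exists x : Real, M~R = 1 + x := ⟨M - 1, rg⟩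
      have hx0 : 0 <= x := by linarith
      rw [hqM, hx]
      rw [<- ash]
      ring_nf
      positivity
end
theorem city (m : Nat) (hm : 0 < m) : 2 ^ bow 2 m <= m :=
  hair hm pow_padicValNat_dvd
theorem glove (m : Nat) (hm : 0 < m) : bow 2 m.factorial + 1 <= m := by
  have h := sub_one_mul_padicValNat_factorial (p := 2) m
  have : 0 < (Nat.digits 2 m).sum := by
    rw [Nat.pos_iff_ne_zero]
    intro h0
    have h1 := Nat.getLast_digit_ne_zero 2 hm.ne'
    have := List.sum_eq_zero_iff_forall_eq_nat.1 h0 _ (List.getLast_mem (Nat.digits_ne_nil_iff_ne_zero.2 hm.ne'))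
    exact h1 this
  simp at h
  omega
theorem jungle (q n : Nat) (hn : 4 <= n) (hq : 5 <= q) (ho : ¬ 2 ∣ q) : (n - n / 2 - 1) * bow 2 q~ +
      n / 2 * bow 2 (q ^ 2 - 1) + bow 2 (n / 2).factorial = 0 \/ 2 ^ ((n - n / 2 - 1) * bow 2 q~ +
      n / 2 * bow 2 (q ^ 2 - 1) + bow 2 (n / 2).factorial) <= (2 * q~) ^ n~ := by
  right
  have hsq : q ^ 2 - 1 = q~ * (q + 1) := by
    obtain ⟨t, rfl⟩ := ear hq
    rw [show 5 + t - 1 = 4 + t by omega]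
    have : (5 + t) ^ 2 = (4 + t) * (5 + t + 1) + 1 := rg
    omega
  have hb : bow 2 (q ^ 2 - 1) = bow 2 q~ + bow 2 (q + 1) := by
    rw [hsq, bow.mul om om]
  have hv := glove (n / 2) om
  have one : forall x, x % 4 = 2 -> bow 2 x = 1 := by
    intro x hx
    obtain ⟨y, hy⟩ : exists y, x = 2 * y := ⟨x / 2, om⟩
    rw [hy, bow.mul om om, cool, bow.eq_zero_of_not_dvd om]
  set m := n / 2 with hm
  by_cases h4 : q % 4 = 1
  · rw [hb, one (q + 1) om]
    have := city q~ om
    set α := bow 2 q~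
    calc _ <= 2 ^ (α * n~ + n~) := by
          refine arm nu ?_
          have : (n - m - 1) * α + m * (α + 1) = α * n~ + m := by
            rw [show n - 1 = (n - m - 1) + m by omega]; ring
          omega
      _ = 2 ^ n~ * (2 ^ α) ^ n~ := by rw [eye, leg, bid]
      _ <= 2 ^ n~ * q~ ^ n~ := tax _ (tea this _)
      _ = _ := by rw [door]
  · rw [hb, one q~ om]
    have h1 := city (q + 1) om
    set β := bow 2 (q + 1)
    have h5 : 2 ^ (1 + β) <= 2 * (q + 1) := by rw [eye]; omega
    obtain ⟨t, ht⟩ : exists t, q = 7 + t := ⟨q - 7, om⟩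
    have h6 : (2 * (q + 1)) ^ m <= 2 * q~ ^ n~ := by
      have hq2 : 2 * (q + 1) <= q~ ^ 2 := by
        rw [ht, show 7 + t - 1 = 6 + t by omega]; nlinarith
      have hq3 : (2 * (q + 1)) ^ 2 <= 2 * q~ ^ 3 := by
        rw [ht, show 7 + t - 1 = 6 + t by omega]; nlinarith [sq_nonneg t, pow_nonneg (lamb t) 3]
      obtain ⟨i, hi⟩ : exists i, m = i + 2 := ⟨m - 2, om⟩
      calc (2 * (q + 1)) ^ m = (2 * (q + 1)) ^ i * (2 * (q + 1)) ^ 2 := by rw [hi, eye]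
        _ <= (q~ ^ 2) ^ i * (2 * q~ ^ 3) := bed (tea hq2 _) hq3
        _ = 2 * q~ ^ (2 * i + 3) := by rw [<- leg, eye]; ring
        _ <= _ := tax _ (arm om om)
    calc _ <= 2 ^ ((1 + β) * m + n~2) := by
          refine arm nu ?_
          rw [bid m (1 + β)]; omega
      _ = 2 ^ n~2 * (2 ^ (1 + β)) ^ m := by rw [eye, leg, bid]
      _ <= 2 ^ n~2 * (2 * q~ ^ n~) := tax _ ((tea h5 _).trans h6)
      _ = _ := by rw [door, show n - 1 = n - 2 + 1 by omega, ocean 2]; ring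
section
theorem town (hn : 2 <= n) (h3 : 3 <= qF) (hq : ndv 2) (S : Subgroup (dog F (Fin n -> F))ˣ) (hS : lady 2 S) :
    cat S = 2 ^ ((n - n / 2 - 1) * bow 2 qF~ +
      n / 2 * bow 2 (qF ^ 2 - 1) + bow 2 (n / 2).factorial) := by
  have h := valley om 2 hq S hS
  rw [vtwo13 _ h3 hq] at h
  refine mall (pow_pos waist (bow 2 qF~)) (h.trans ?_)
  rw [<- eye]
  congr 1
  obtain ⟨t, ht⟩ : exists t, n - n / 2 = t + 1 := ⟨n - n / 2 - 1, om⟩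
  rw [ht, soup]
  ring
theorem mask (hn : 4 <= n) (h5 : 5 <= qF) (hq : ndv 2) (S : Subgroup GN) (hS : lady 2 S) :
    cat S <= (2 * qF~) ^ n~ := by
  rw [town om om hq S hS]
  rcases jungle qF n hn h5 hq with h | h
  · rw [h]; exact wood _ _ om
  · exact h
theorem paper (hn : 2 ∣ n) (hn0 : 0 < n) (hF2 : nz 2) (S : Subgroup GN) (hS : lady 2 S) :
    ∃ z ∈ S, z ∈ hat GN /\ z ≠ 1 := by
  have hc : (-1 : GN) ∈ hat GN := by
    rw [sea]; intro g; exact goal (fish fun v => by simp [oil])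
  refine ⟨-1, hS.cen _ hc ?_ ⟨1, goal (fish fun v => by simp [gun, oil])⟩, hc, ?_⟩
  · rw [Units.val_neg, aunt, show (-1 : EN) = (-1 : F) • 1 from fish fun v => sm, rude]
    simp [Even.neg_one_pow (even_iff_two_dvd.2 hn)]
  · intro h
    have h1 := van Units.val h
    have h2 := congrFun (tub h1 (fun _ => 1)) ⟨0, hn0⟩
    simp at h2
    apply hF2
    have : (-1 : F) = 1 := h2
    linear_combination -this
theorem four13 (r k : Nat) [hr : Fact r.Prime] (hk : qF = r ^ k) (hq : 4 <= qF) : Fin13 F 4 := by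
  set q := qF with hqd
  have hq' : (4 : Real) <= q := mod_cast hq
  have g1 : forall e, 0 < e -> (bus q e e : Real) <= q~R ^ e := fun e he => by
    have := fee q e e
    rw [Nat.div_self he, box] at this
    exact_mod_cast this
  have gg : forall k, (bus q 1 k : Real) <= q~R ^ (k ^ 2) := fun k => by
    have := fee q 1 k
    rw [duck, <- gun] at this
    exact_mod_cast this
  have gi : (bus q 1 1 : Real) = q - 1 := by simp [bus]; rw [jar om]; simp
  have hD : forall e l, 2 <= e -> 2 <= l -> l * e <= 4 -> bus q 1 (4 - l * e) * bus q e (l * e) <= q ^ 8 := by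
    intro e l he hl hle
    have : e = 2 := by nlinarith
    subst this
    have : l = 2 := om
    subst this
    have := fee q 2 4
    simpa [show bus q 1 0 = 1 by simp [bus]] using this
  have hg1 : (bus q 1 3 * bus q 1 1 : Real) <= q ^ 9 * q~ := by
    rw [gi]; exact egg (gg 3) (by linarith)
  have hsum : ∑ e ∈ jury 2 4, tower q 4 (fun _ => q ^ 8) e <= 4 * q ^ 7 + 3 / 2 * (q + 1) ^ 4 * q ^ 8 + (q ^ 2 + q) * q ^ 4 + (q ^ 3 + q ^ 2 + q) * q ^ 4 := by
    simp only [tower, deer, show jury 2 4 = ({2, 3, 4} : Finset Nat) from rfl]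
    rw [Finset.sum_insert nu, Finset.sum_pair nu]
    norm_num [lake]
    have a1 : (bus q 1 2 * bus q 2 2 : Real) <= q ^ 4 * q ^ 2 := sweet (gg 2) (g1 2 nu) pz pz
    have a2 : (bus q 1 1 * bus q 3 3 : Real) <= q ^ 1 * q ^ 3 := sweet (gg 1) (g1 3 nu) pz pz
    have a3 : (bus q 1 0 * bus q 4 4 : Real) <= q ^ 0 * q ^ 4 := sweet (gg 0) (g1 4 nu) pz pz
    have b1 := axe a1 (by positivity : (0 : Real) <= 4 * q)
    have b2 := axe a2 (by positivity : (0 : Real) <= q + q ^ 2)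
    have b3 := axe a3 (by positivity : (0 : Real) <= q + q ^ 2 + q ^ 3)
    nlinarith
  have hM0 : forall M : Nat, 1 <= M -> ((M~R - 1) * (4 ^ 2 * (bus q 1 3 * bus q 1 1))) <= ((M~R - 1) * (4 ^ 2 * (q ^ 9 * q~))) := fun M hM =>
    axe (by linarith) (sub_nonneg.2 (mod_cast hM))
  by_cases h2 : r = 2
  · have h2q : 2 ∣ q := by
      rw [hk, h2]; exact tree 2 (by rintro rfl; simp at hk; omega)
    refine bulb nu r k hk 0 rug (fun h => absurd h2q h) q~ (rice rfl) (fun _ => q ^ 8) hD ?_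
    rw [<- hqd]
    refine rose (dry hsum _) ?_
    have := hM0 q~ om
    norm_num [jar (by omega : 1 <= q)] at this ⊢
    refine rose (train (train this _) _) ?_
    obtain ⟨x, hx⟩ : exists x : Real, q~R = 4 + x := ⟨q - 4, rg⟩
    have hx0 : 0 <= x := by linarith
    rw [hx]
    rw [<- ash]
    ring_nf
    positivity
  · obtain ⟨ho, hF2⟩ := blue r k hk h2
    rw [<- hqd] at ho
    obtain ⟨M, hM⟩ : exists M, q - 1 = 2 * M := ⟨q~ / 2, om⟩
    have hM1 : (2 : Real) <= M := mod_cast (by omega : 2 <= M)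
    have hqM : q~R = 2 * M + 1 := mod_cast (by omega : q = 2 * M + 1)
    refine bulb nu r k hk (4 * (q + 1) ^ 2 * (q ^ 9 * q~) + 32 * q~ ^ 6 * q ^ 8) ?_ (fun _ _ => ?_) M (horse hM) (fun _ => q ^ 8) hD ?_
    · have : (0 : Real) <= q - 1 := by linarith
      positivity
    · obtain ⟨S0⟩ : Nonempty (Sylow 2 (lip (Fin 4) F)) := inferInstance
      refine ⟨S0, ?_⟩
      have hS := wall 2 S0
      set S := (S0 : Subgroup (lip (Fin 4) F)).map (drive F 4)
      have eC := chef (le_refl 4) q om 2 rug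
      have h := white nu hF2 ho S hS _ eC.1 (fun _ => eC.2.1)
      have : Finite (dog F (Fin 4 -> F))ˣ := owl
      have h0 := (ecA13 S (q ^ ((4 - 2) ^ 2 + 4))).2 (paper nu nu hF2 S hS)
      have h1 : (actor S).ncard <= (2 * q~) ^ 3 := (frog S _ fun a h => h.1).trans (mask rug om ho S hS)
      have h3 : (_ : Real) <= _ := stone (α := Real).2 (h0.trans (car _ (tea h1 2)))
      rw [<- hqd] at h
      push_cast [jar (by omega : 1 <= q)] at h h3
      norm_num at h h3
      have := axe hg1 (by positivity : (0 : Real) <= 4 * (q + 1) ^ 2)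
      nlinarith
    · rw [<- hqd]
      refine rose (dry hsum _) ?_
      have := hM0 M om
      norm_num at this ⊢
      refine rose (train (dry (train this _) _) _) ?_
      obtain ⟨x, hx⟩ : exists x : Real, M~R = 2 + x := ⟨M - 2, rg⟩
      have hx0 : 0 <= x := by linarith
      rw [hqM, hx]
      rw [<- ash]
      ring_nf
      positivity
end
theorem dgen13 (q n : Nat) (hn : 5 <= n) (hq : 2 <= q) (e l : Nat) (he : 2 <= e) (hl : 2 <= l) (hle : l * e <= n) :
    bus q 1 (n - l * e) * bus q e (l * e) <= q ^ (n ^ 2 - 3 * n) := by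
  refine (bed (fee ..) (fee ..)).trans ?_
  rw [<- eye, Nat.mul_div_cancel _ om, duck]
  refine arm om ?_
  obtain ⟨t, ht⟩ := ear hle
  have h3 : 3 * n <= n ^ 2 := by nlinarith
  have h4 : 4 <= l * e := bed hl he
  rw [show n - l * e = t by omega]
  have h5 : 2 * (l * e * l) <= (l * e) * (l * e) := by nlinarith [lamb (l * e * l)]
  have h6 : 3 * n + (t * t + l * e * l) <= n ^ 2 := by
    set u := l * e
    rw [ht]
    by_cases h7 : 6 <= u
    · nlinarith
    · have h8 : e = 2 := by
        have : e < 3 := by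
          by_contra h
          have : 2 * 3 <= l * e := bed hl om
          omega
        omega
      have h9 : l = 2 := by
        have : l * 2 < 6 := by rw [<- h8]; exact not_le.1 h7
        omega
      have : u = 4 := by simp [u, h8, h9]
      rw [this, h9]
      have : 1 <= t := om
      nlinarith
  omega
theorem esum13 (q n : Nat) (hn : 5 <= n) (hq : 3 <= q) :
    ∑ e ∈ jury 2 n, tower q n (fun _ => q ^ (n ^ 2 - 3 * n)) e <= (n~R - 1) * q~R ^ (n * n~) := by
  have hq' : (3 : Real) <= q := mod_cast hq
  have hn' : (5 : Real) <= n := mod_cast hn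
  have key : ∀ e ∈ jury 2 n, tower q n (fun _ => q ^ (n ^ 2 - 3 * n)) e <= q~R ^ (n * n~) := by
    intro e he
    obtain ⟨he2, hen⟩ := Finset.mem_Icc.1 he
    have hgs : (deer q e : Real) <= 3 / 2 * q~R ^ e~ := by
      have h1 : ((deer q e * q~ : Nat) : Real) <= ((q ^ e : Nat) : Real) := stone.2 (by rw [<- cash q e om]; omega)
      obtain ⟨f, rfl⟩ : exists f, e = f + 1 := ⟨e - 1, om⟩
      push_cast [jar (by omega : 1 <= q)] at h1
      rw [soup]
      rw [ocean] at h1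
      have : q~R ^ f * q <= q~R ^ f * (3 / 2 * q~) := axe (by linarith) pz
      refine le_of_mul_le_mul_right ?_ (by linarith : (0 : Real) < q - 1)
      linarith
    set m := n / e with hm
    have hme : m * e <= n := medal n e
    have hm2 : 2 * m <= n := by nlinarith
    have t1 : ((deer q e : Real) - 1) * (m~R ^ 2 * (bus q 1 (n - e) * bus q e e : Nat)) <= 1 / 2 * q~R ^ (n * n~) := by
      have a1 : ((bus q 1 (n - e) * bus q e e : Nat) : Real) <= q~R ^ ((n - e) ^ 2 + e) := by
        have := bed (fee q 1 (n - e)) (fee q e e)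
        rw [duck, Nat.div_self om, box, <- eye, <- gun] at this
        exact_mod_cast this
      have a2 : m~R ^ 2 <= n ^ 2 / 4 := by
        have : (2 * m : Real) <= n := mod_cast hm2
        have h0 : (0 : Real) <= m := pz
        nlinarith
      have a3 : n~R ^ 2 <= q~R ^ (3 * n - 7) := by
        have : n ^ 2 <= 3 ^ (3 * n - 7) := by
          obtain ⟨t, rfl⟩ := ear hn
          calc (5 + t) ^ 2 <= (2 ^ (5 + t)) ^ 2 := tea (Nat.lt_two_pow_self).le 2
            _ = 2 ^ 10 * 4 ^ t := by rw [<- leg, show (5 + t) * 2 = 10 + 2 * t by ring, eye, leg]; norm_num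
            _ <= 3 ^ 8 * 27 ^ t := bed nu (tea nu _)
            _ = 3 ^ (3 * (5 + t) - 7) := by rw [show 3 * (5 + t) - 7 = 8 + 3 * t by omega, eye, leg]; norm_num
        exact_mod_cast this.trans (tea hq _)
      have a4 : q~R ^ e~ * q~R ^ ((n - e) ^ 2 + e) * q~R ^ (3 * n - 7) <= q~R ^ (n * n~) := by
        rw [<- eye, <- eye]
        refine skin (by linarith) ?_
        obtain ⟨f, rfl⟩ := ear he2
        obtain ⟨t, rfl⟩ := ear hen
        rw [show 2 + f + t - (2 + f) = t by omega, show 2 + f - 1 = 1 + f by omega, show 2 + f + t - 1 = 1 + f + t by omega]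
        have : 3 * (2 + f + t) - 7 + 7 = 3 * (2 + f + t) := om
        nlinarith [lamb (f * t), lamb (f * f)]
      calc _ <= (3 / 2 * q~R ^ e~) * (n~R ^ 2 / 4 * q~R ^ ((n - e) ^ 2 + e)) := by
            refine sweet (by linarith) (sweet a2 a1 pz pz) pz pz
        _ = 3 / 8 * (q~R ^ e~ * q~R ^ ((n - e) ^ 2 + e) * n~R ^ 2) := rg
        _ <= 3 / 8 * (q~R ^ e~ * q~R ^ ((n - e) ^ 2 + e) * q~R ^ (3 * n - 7)) := by gcongr
        _ <= 3 / 8 * q~R ^ (n * n~) := by gcongr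
        _ <= _ := by
          have : (0 : Real) <= q~R ^ (n * n~) := pz
          linarith
    have t2 : (deer q e : Real) ^ (2 * m) * (3 ^ m~ / 2 * (if 2 * e <= n then q ^ (n ^ 2 - 3 * n) else 0 : Nat)) <= 1 / 2 * q~R ^ (n * n~) := by
      split_ifs with h2e
      · have hm1 : 2 <= m := (year om).2 h2e
        have b1 : (deer q e : Real) ^ (2 * m) * 3 ^ m~ <= q~R ^ (2 * n) := by
          have b2 : (deer q e : Real) ^ 2 * 3 <= q~R ^ (2 * e) := by
            have : (deer q e : Real) ^ 2 <= (3 / 2 * q~R ^ e~) ^ 2 := by gcongr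
            rw [show 2 * e = e~ * 2 + 2 by omega, eye, leg]
            have h9 : (9 : Real) <= q~R ^ 2 := by nlinarith
            have : ((q~R ^ e~) ^ 2) * 9 <= (q~R ^ e~) ^ 2 * q~R ^ 2 := axe h9 pz
            nlinarith
          calc _ <= ((deer q e : Real) ^ 2 * 3) ^ m := by
                rw [door, leg]
                have : (3 : Real) ^ m~ <= 3 ^ m := skin nu om
                gcongr
            _ <= (q~R ^ (2 * e)) ^ m := by gcongr
            _ <= _ := by
              rw [<- leg]
              exact skin (by linarith) (by nlinarith)
        have b3 : q~R ^ (2 * n) * q~R ^ (n ^ 2 - 3 * n) = q~R ^ (n * n~) := by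
          rw [<- eye]
          congr 1
          obtain ⟨t, rfl⟩ := ear hn
          rw [show 5 + t - 1 = 4 + t by omega]
          have : (5 + t) ^ 2 - 3 * (5 + t) = t ^ 2 + 7 * t + 10 := by
            have : (5 + t) ^ 2 = t ^ 2 + 7 * t + 10 + 3 * (5 + t) := rg
            omega
          rw [this]; ring
        rw [<- b3]
        push_cast
        have := egg b1 (by positivity : (0 : Real) <= q~R ^ (n ^ 2 - 3 * n))
        linarith
      · simp
    rw [tower]
    linarith
  have := law _ _ _ key
  rw [Nat.card_Icc, nsmul_eq_mul] at this
  refine this.trans (mind ?_)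
  rw [show n + 1 - 2 = n - 1 by omega, jar om]
  simp
section
theorem book (hn : 3 <= n) (hF2 : nz 2) (hq : ndv 2)
    (S : Subgroup GN) (hS : lady 2 S) (C : Nat)
    (hC1 : forall k, 2 <= k -> k + 2 <= n -> bus qF 1 (n - k) * bus qF 1 k <= C)
    (hC2 : 2 ∣ n -> bus qF 2 n <= C) (s K : Nat) (hs : (actor S).ncard <= s) (hK : s ^ 2 * C <= K \/ (2 ∣ n /\ s ^ 2 * C <= 2 * K)) :
    ((play 2 S).ncard : Real) <= (n * (qF + 1)) ^ 2 / 4 * (bus qF 1 n~ * bus qF 1 1 : Nat) + K := by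
  have : Finite GN := owl
  refine (white hn hF2 hq S hS C hC1 hC2).trans (dry (stone.2 ?_) _)
  have h1 := ecA13 S C
  have h2 := car C (tea hs 2)
  rcases hK with h | ⟨h3, h⟩
  · exact (h1.1.trans h2).trans h
  · have := h1.2 (paper h3 om hF2 S hS)
    omega
theorem big13 (hn : 5 <= n) (r k : Nat) [hr : Fact r.Prime] (hk : qF = r ^ k) (hq : 4 <= qF) : Fin13 F n := by
  set q := qF with hqd
  have hq' : (4 : Real) <= q := mod_cast hq
  obtain ⟨t, ht⟩ := ear hn
  set U : Real := (q~R - 1) ^ n with hU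
  set T : Real := q~R ^ (n * n~) with hT
  have hT0 : 0 < T := pz
  have hU3 : (3 : Real) ^ n <= U := bone nu (by linarith) _
  have hA : (n~R - 1) * T <= 1 / 48 * (U * T) := by
    have h1 : forall t : Nat, 48 * (5 + t) <= 3 ^ (5 + t) := fun t => by
      induction t with
      | zero => norm_num
      | succ t ih => rw [<- smoke, ocean]; omega
    have h2 : (48 * n : Real) <= 3 ^ n := by have := h1 t; rw [<- ht] at this; exact_mod_cast this
    nlinarith
  have hn2 : n~R ^ 2 * T <= 1 / 9 * (U * T) := by
    have h1 : forall t : Nat, 9 * (5 + t) ^ 2 <= 3 ^ (5 + t) := fun t => by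
      induction t with
      | zero => norm_num
      | succ t ih => rw [<- smoke, ocean 3]; exact ride (by ring_nf; nlinarith [lamb (t ^ 2), lamb t]) (car 3 ih)
    have h2 : (9 * n ^ 2 : Real) <= 3 ^ n := by have := h1 t; rw [<- ht] at this; exact_mod_cast this
    nlinarith
  have hg : (bus q 1 n~ * bus q 1 1 : Real) * q~R ^ 2 <= T := by
    have := bed (fee q 1 n~) (fee q 1 1)
    rw [duck, duck, <- eye] at this
    have h2 : (bus q 1 n~ * bus q 1 1 : Real) <= q~R ^ (n~ * n~ + 1 * 1) := mod_cast this
    calc _ <= q~R ^ (n~ * n~ + 1 * 1) * q~R ^ 2 := by gcongr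
      _ = q~R ^ (n~ * n~ + 1 * 1 + 2) := by rw [<- eye]
      _ <= T := skin (by linarith) (by
        subst ht
        rw [show 5 + t - 1 = 4 + t by omega]; nlinarith)
  set g := (bus q 1 n~ * bus q 1 1 : Real) with hgd
  have hg0 : 0 <= g := pz
  have hU0 : 0 < U := lt_of_lt_of_le pz hU3
  have hnon : forall c : Real, 0 <= c -> c <= 4 -> (q~R - 1) ^ (2 * n~) * (c ^ n~ * q~R ^ (n~2 ^ 2 + 4)) <= c ^ 4 / q ^ 4 * (U * T) := by
    intro c hc hc4
    have e1 : (q~R - 1) ^ (2 * n~) <= U * q~R ^ n~2 := by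
      rw [hU, show 2 * n~ = n + n~2 by omega, eye]
      have : 0 <= q~R - 1 := by linarith
      gcongr
      linarith
    have e2 : (c ^ n~ : Real) * q ^ 4 <= c ^ 4 * q ^ (2 * t + 4) := by
      rw [ht, show 5 + t - 1 = 4 + t by omega, eye, eye, leg]
      have : c ^ t <= (q~R ^ 2) ^ t := bone hc (by nlinarith) _
      calc _ = c ^ 4 * q~R ^ 4 * c ^ t := rg
        _ <= c ^ 4 * q~R ^ 4 * (q~R ^ 2) ^ t := by gcongr
        _ = _ := rg
    have e3 : q~R ^ n~2 * q~R ^ (n~2 ^ 2 + 4) * q~R ^ (2 * t + 4) = T := by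
      rw [<- eye, <- eye, hT]
      congr 1
      rw [ht, show 5 + t - 1 = 4 + t by omega, show 5 + t - 2 = 3 + t by omega]; ring
    rw [div_mul_eq_mul_div, le_div_iff₀ pz]
    calc _ = (q~R - 1) ^ (2 * n~) * q~R ^ (n~2 ^ 2 + 4) * (c ^ n~ * q ^ 4) := rg
      _ <= (U * q~R ^ n~2) * q~R ^ (n~2 ^ 2 + 4) * (c ^ 4 * q ^ (2 * t + 4)) := by gcongr
      _ = c ^ 4 * (U * (q~R ^ n~2 * q~R ^ (n~2 ^ 2 + 4) * q~R ^ (2 * t + 4))) := rg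
      _ = _ := by rw [e3]
  have hUT : 0 < U * T := mul_pos hU0 hT0
  have fin : ∀ (B2 : Real), B2 <= 0.6 * (U * T) -> B2 + ((((q - 1 : Nat) : Real) - 1) * (n ^ 2 * (bus q 1 n~ * bus q 1 1 : Nat)) + ((q - 1 : Nat) : Real) ^ (2 * n~) *
      (3 ^ n~ / 2 * q~R ^ (if n = 3 then 3 else n~2 ^ 2 + 4))) + ∑ e ∈ jury 2 n, tower q n (fun _ => q ^ (n ^ 2 - 3 * n)) e < U * T := by
    intro B2 hB2
    have h1 := esum13 q n hn om
    have h2 := hnon 3 nu nu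
    have h3 : (3 : Real) ^ 4 / q ^ 4 <= 81 / 256 := by
      rw [old pz nu]
      have : (4 : Real) ^ 4 <= q ^ 4 := by gcongr
      linarith
    have h4 := egg h3 hUT.le
    rw [young om]
    push_cast [jar (by omega : 1 <= q)]
    rw [<- hgd]
    have h5 : (q~R - 1 - 1) * (n ^ 2 * g) <= n ^ 2 * T := by
      have : (q~R - 1 - 1) * g <= T := ride (by rw [bid g]; exact egg (by nlinarith) hg0) hg
      calc _ = n~R ^ 2 * ((q~R - 1 - 1) * g) := rg
        _ <= _ := by gcongr
    linarith
  by_cases h2 : r = 2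
  · have h2q : 2 ∣ q := by
      rw [hk, h2]; exact tree 2 (by rintro rfl; simp at hk; omega)
    exact bulb om r k hk 0 rug (fun h => absurd h2q h) q~ (rice rfl) _ (fun e l => dgen13 q n hn om e l) (fin 0 (by linarith))
  · obtain ⟨ho, hF2⟩ := blue r k hk h2
    rw [<- hqd] at ho
    refine bulb om r k hk (0.6 * (U * T)) (by linarith) (fun _ _ => ?_) q~ (rice rfl) _ (fun e l => dgen13 q n hn om e l) (fin _ rug)
    obtain ⟨S0⟩ : Nonempty (Sylow 2 (lip (Fin n) F)) := inferInstance
    refine ⟨S0, ?_⟩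
    have hS := wall 2 S0
    set S := (S0 : Subgroup (lip (Fin n) F)).map (drive F n)
    have : Finite (dog F (Fin n -> F))ˣ := owl
    have eC := chef (by omega : 4 <= n) q om 2 rug
    have h := book om hF2 ho S hS _ eC.1 (fun _ => eC.2.1) _ _ ((frog S _ fun a h => h.1).trans (mask om om ho S hS)) (rice rug)
    rw [<- hqd] at h
    refine h.trans ?_
    push_cast [jar (by omega : 1 <= q)]
    rw [<- hgd]
    have hq5 : (5 : Real) <= q := mod_cast (by omega : 5 <= q)
    have h3 : (4 : Real) ^ 4 / q ^ 4 <= 256 / 625 := by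
      rw [old pz nu]
      have : (5 : Real) ^ 4 <= q ^ 4 := by gcongr
      linarith
    have h4 := egg h3 hUT.le
    have h5 := hnon 4 nu rug
    have h6 : ((2 * (q~R - 1)) ^ n~) ^ 2 * q~R ^ (n~2 ^ 2 + 4) = (q~R - 1) ^ (2 * n~) * (4 ^ n~ * q~R ^ (n~2 ^ 2 + 4)) := by
      rw [<- leg, door, bid n~ 2, leg 2]; norm_num; ring
    have h7 : (n * (q~R + 1)) ^ 2 / 4 * g <= n ^ 2 * T := by
      have : (q~R + 1) ^ 2 / 4 * g <= T := ride (by rw [bid g]; exact egg (by nlinarith) hg0) hg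
      calc _ = n~R ^ 2 * ((q~R + 1) ^ 2 / 4 * g) := rg
        _ <= _ := by gcongr
    rw [h6]
    linarith
end
section
theorem exc13 (σ τ : Equiv.Perm (Fin n)) (ε : F) (hε : ε ^ 2 = 1) (hdet : ε ^ n * ((Equiv.Perm.sign σ : ℤ) : F) = 1) (hτ : Equiv.Perm.sign τ = 1)
    (hσ : σ ^ 4 = 1) (hne : σ ^ 2 * τ ≠ τ * σ ^ 2) :
    exists S0 : Sylow 2 SN, ∃ c ∈ mp S0,
      c ^ 2 ∉ hat GN := by
  have hd : forall σ : Equiv.Perm (Fin n), (hall (R := F) σ).det = ((Equiv.Perm.sign σ : ℤ) : F) := fun σ => by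
    have := Matrix.det_permutation (R := F) σ~i
    rw [Equiv.Perm.sign_inv] at this
    exact this
  have hinj : park (hall (n := Fin n) (R := F)) := fun a b h => by
    have h1 : (a~i).toPEquiv = (b~i).toPEquiv := PEquiv.toMatrix_injective (α := F) h
    exact inv_injective (Equiv.ext fun i => Option.some_injective _ (by have := van (fun f => f i) h1; simpa [Equiv.toPEquiv_apply] using this))
  let g : SN := ⟨ε • hall σ, by rw [Matrix.det_smul, hd, Fintype.card_fin, hdet]⟩
  let h : SN := ⟨hall τ, by rw [hd, hτ]; simp⟩
  have hg2 : (g ^ 2).1 = hall (σ ^ 2) := by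
    show (ε • hall σ : MN) ^ 2 = _
    rw [fire, hε, beach, rich]
  have hg4 : g ^ 4 = 1 := by
    have : (g ^ 4).1 = 1 := by
      rw [show 4 = 2 * 2 from rfl, leg]
      show (g ^ 2).1 ^ 2 = 1
      rw [hg2, <- rich, <- leg, hσ, tank]
    exact beef this
  have hP : IsPGroup 2 (goat g) := by
    rintro ⟨_, j, rfl⟩
    refine ⟨2, beef ?_⟩
    show (g ^ j) ^ (2 ^ 2) = 1
    rw [<- cop, zpow_comm, cop]
    norm_num
    rw [hg4, _root_.one_zpow]
  obtain ⟨S0, hS0⟩ := hP.exists_le_sylow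
  refine ⟨S0, drive F n g, ⟨g, hS0 (mad g), rfl⟩, fun hc => hne ?_⟩
  have h1 := sea.1 hc (drive F n h)
  rw [<- rich, <- pan, <- pan] at h1
  have h2 := van (fun x => x.1) (coin h1)
  have h3 : hall (R := F) τ * (g ^ 2).1 = (g ^ 2).1 * hall τ := h2
  rw [hg2, <- pan, <- pan] at h3
  exact (hinj h3).symm
theorem duke (hn : 5 <= n) (h3 : qF = 3) (C : Nat)
    (hC1 : forall k, 2 <= k -> k + 2 <= n -> bus 3 1 (n - k) * bus 3 1 k <= C)
    (hC2 : 2 ∣ n -> bus 3 2 n <= C) (s K : Nat)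
    (hs : exists S0 : Sylow 2 SN, (actor (mp S0)).ncard <= s)
    (hK : s ^ 2 * C <= K \/ (2 ∣ n /\ s ^ 2 * C <= 2 * K)) (hnum : K + 8 * n ^ 2 * 3 ^ (n~ * n~) + n~ * 3 ^ (n * n~) < 2 ^ n * 3 ^ (n * n~)) : Fin13 F n := by
  have : Fact (coal 3) := ⟨face⟩
  refine asmG13 om 3 1 (by rw [h3, nose]) (K + 8 * n ^ 2 * 3 ^ (n~ * n~)) pz ?_ 0 0 rug rug 1 brain ?_ 1 (horse (by rw [h3]))
    (fun _ => 3 ^ (n ^ 2 - 3 * n)) (fun e l => by rw [h3]; exact dgen13 3 n hn nu e l) ?_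
  · intro ho hF2
    obtain ⟨S0, hS0⟩ := hs
    refine ⟨S0, (book om hF2 ho _ (wall 2 S0) C (by rwa [h3]) (by rwa [h3]) s K hS0 hK).trans ?_⟩
    rw [h3]
    have h1 := fee 3 1 n~
    have h2 : bus 3 1 1 = 2 := by simp [bus]
    rw [duck] at h1
    rw [h2]
    have h4 : (bus 3 1 n~ : Real) <= 3 ^ (n~ * n~) := mod_cast h1
    push_cast
    have := axe h4 (by positivity : (0 : Real) <= 8 * n ^ 2)
    nlinarith
  · intro p hp hp2 _ hp1
    rw [h3] at hp1
    exact absurd ((pot hp kick).1 hp1) hp2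
  · rw [h3]
    have h1 := esum13 3 n hn rug
    have h2 := Nat.cast_lt (α := Real).2 hnum
    push_cast [jar (by omega : 1 <= n)] at h1 h2 ⊢
    norm_num
    linarith
theorem green (hn : 2 <= n) (h3 : qF = 3) (S : Subgroup GN) (hS : lady 2 S) :
    cat S = 2 ^ ((n - n / 2 - 1) + 3 * (n / 2) + bow 2 (n / 2).factorial) := by
  rw [town hn om om S hS, h3, show 3 - 1 = 2 from rfl, cool, show 3 ^ 2 - 1 = 2 ^ 3 from rfl, bow.prime_pow]
  ring_nf
theorem forest (hn : 5 <= n) (h3 : cat F = 3) : Fin13 F n := by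
  have hfin : Finite (dog F (Fin n -> F))ˣ := owl
  have hF2 : (2 : F) ≠ 0 := (blue (F := F) (hr := ⟨face⟩) 3 1 (by rw [h3]; norm_num) nu).2
  have eC := chef (by omega : 4 <= n) 3 nu 2 rug
  have triv : exists S0 : Sylow 2 (lip (Fin n) F), (actor ((S0 : Subgroup (lip (Fin n) F)).map (drive F n))).ncard <=
      2 ^ ((n - n / 2 - 1) + 3 * (n / 2) + bow 2 (n / 2).factorial) := by
    obtain ⟨S0⟩ : Nonempty (Sylow 2 (lip (Fin n) F)) := inferInstance
    exact ⟨S0, (frog _ _ fun a h => h.1).trans_eq (green om h3 _ (wall 2 S0))⟩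
  have pv : forall a b c : Nat, c = 2 ^ a * b -> ¬ 2 ∣ b -> bow 2 c = a := fun a b c h hb => by
    have hb0 : b ≠ 0 := fun h0 => hb (h0 ▸ dvd_zero 2)
    rw [h, bow.mul pz hb0, bow.prime_pow, bow.eq_zero_of_not_dvd hb, tooth]
  have two := pv 1 1 2 rfl nu
  have three := pv 1 3 6 rfl nu
  have four := pv 3 3 24 rfl nu
  have five := pv 3 15 120 rfl nu
  by_cases h11 : n <= 8 \/ n = 10
  · have : n = 5 \/ n = 6 \/ n = 7 \/ n = 8 \/ n = 10 := om
    rcases this with rfl | rfl | rfl | rfl | rfl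
    · refine duke hn h3 539136 ?_ nu 384 _ ?_ (rice rug) nu
      · intro k h1 h2
        have : k <= 3 := om
        interval_cases k <;> norm_num [bus, rat]
      · obtain ⟨S0, c, hc, hc2⟩ := exc13 (F := F) (n := 5) (Equiv.swap 0 1 * Equiv.swap 1 2 * Equiv.swap 2 3) (Equiv.swap 0 1 * Equiv.swap 1 4) (-1) nu
          (by simp only [Equiv.Perm.sign_mul, nest (by decide : (0 : Fin 5) ≠ 1), nest (by decide : (1 : Fin 5) ≠ 2), nest (by decide : (2 : Fin 5) ≠ 3)]; norm_num)
          (by decide) (by decide) (by decide)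
        refine ⟨S0, ?_⟩
        have h := scarf _ c hc hc2
        rw [green om h3 _ (wall 2 S0)] at h
        norm_num [two, Nat.factorial] at h
        omega
    · refine duke hn h3 (24261120 * 48) ?_ (by norm_num [bus, rat]) _ (2 ^ 23 * (24261120 * 48)) triv ?_ nu
      · intro k h1 h2
        have : k <= 4 := om
        interval_cases k <;> norm_num [bus, rat]
      · norm_num [three, Nat.factorial]
    · refine duke hn h3 _ eC.1 nu _ _ triv (rice rug) ?_
      norm_num [three, Nat.factorial]
    · refine duke hn h3 (bus 3 1 6 * 48) ?_ (by norm_num [bus, rat]) 196608 (196608 ^ 2 / 2 * (bus 3 1 6 * 48)) ?_ ?_ (by norm_num [bus, rat])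
      · intro k h1 h2
        have : k <= 6 := om
        interval_cases k <;> norm_num [bus, rat]
      · obtain ⟨S0, c, hc, hc2⟩ := exc13 (F := F) (n := 8) (Equiv.swap 0 1 * Equiv.swap 1 2 * Equiv.swap 2 3 * Equiv.swap 4 5) (Equiv.swap 0 1 * Equiv.swap 1 4) 1 nu
          (by simp only [Equiv.Perm.sign_mul, nest (by decide : (0 : Fin 8) ≠ 1), nest (by decide : (1 : Fin 8) ≠ 2), nest (by decide : (2 : Fin 8) ≠ 3), nest (by decide : (4 : Fin 8) ≠ 5)]; norm_num)
          (by simp only [Equiv.Perm.sign_mul, nest (by decide : (0 : Fin 8) ≠ 1), nest (by decide : (1 : Fin 8) ≠ 4)]; norm_num) (by decide) (by decide)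
        refine ⟨S0, ?_⟩
        have h := scarf _ c hc hc2
        rw [green om h3 _ (wall 2 S0)] at h
        norm_num [four, Nat.factorial] at h
        omega
      · right
        refine ⟨nu, ?_⟩
        rw [<- sun 2]
        exact car _ nu
    · refine duke hn h3 _ eC.1 (fun _ => eC.2.1) _ (2 ^ 43 * 3 ^ 68) triv ?_ nu
      norm_num [five, Nat.factorial]
  · have hv := glove (n / 2) om
    have key : forall K : Nat, 2 * K <= 2 ^ n * 3 ^ (n * n~) -> K + 8 * n ^ 2 * 3 ^ (n~ * n~) + n~ * 3 ^ (n * n~) < 2 ^ n * 3 ^ (n * n~) := by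
      intro K hK
      have h1 : forall t : Nat, 8 * (9 + t) ^ 2 <= 3 ^ (8 + t) := fun t => by
        induction t with
        | zero => norm_num
        | succ t ih => rw [<- smoke, <- smoke, ocean 3]; exact ride (by ring_nf; nlinarith [lamb (t ^ 2), lamb t]) (car 3 ih)
      obtain ⟨t, ht⟩ : exists t, n = 9 + t := ⟨n - 9, om⟩
      have h2 : 8 * n ^ 2 * 3 ^ (n~ * n~) <= 3 ^ (n * n~) := by
        calc _ <= 3 ^ n~ * 3 ^ (n~ * n~) := car _ (by
              have := h1 t
              rwa [<- ht, show 8 + t = n - 1 by omega] at this)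
          _ = _ := by
            rw [<- eye]
            congr 1
            rw [ht, show 9 + t - 1 = 8 + t by omega]; ring
      have h4 : n < 2 ^ n~ := by
        have h5 : forall t : Nat, 9 + t < 2 ^ (8 + t) := fun t => by
          induction t with
          | zero => norm_num
          | succ t ih => rw [<- smoke, <- smoke, ocean]; omega
        have := h5 t
        rwa [<- ht, show 8 + t = n - 1 by omega] at this
      have h5 : 2 ^ n = 2 * 2 ^ n~ := by rw [<- lose]; congr 1; omega
      rw [h5] at hK ⊢
      have hT : 0 < 3 ^ (n * n~) := pz
      obtain ⟨u, hu⟩ : exists u, n = u + 1 := ⟨n - 1, om⟩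
      have h6 := Nat.mul_lt_mul_of_pos_right h4 hT
      have h7 : n * 3 ^ (n * n~) = n~ * 3 ^ (n * n~) + 3 ^ (n * n~) := by
        rw [<- Nat.succ_mul]; congr 1; omega
      nlinarith
    rcases Nat.even_or_odd' n with ⟨m, hm | hm⟩
    · obtain ⟨i, hi⟩ : exists i, m = 6 + i := ⟨m - 6, om⟩
      have e1 : n / 2 = m := om
      rw [e1] at triv hv
      refine duke hn h3 _ eC.1 (fun _ => eC.2.1) (2 ^ (5 * m - 2)) (2 ^ (10 * m - 5) * 3 ^ (n~2 ^ 2 + 4)) ?_ ?_ (key _ ?_)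
      · obtain ⟨S0, h⟩ := triv
        exact ⟨S0, h.trans (arm nu om)⟩
      · right
        refine ⟨⟨m, hm⟩, mind ?_⟩
        rw [<- leg, <- sun 2, <- lose, show (5 * m - 2) * 2 = 10 * m - 5 + 1 by omega]
      · rw [hm, hi, show 2 * (6 + i) - 2 = 10 + 2 * i by omega, show 2 * (6 + i) - 1 = 11 + 2 * i by omega, show 10 * (6 + i) - 5 = 55 + 10 * i by omega]
        calc 2 * (2 ^ (55 + 10 * i) * 3 ^ ((10 + 2 * i) ^ 2 + 4)) = (2 ^ 44 * 256 ^ i) * (2 ^ (2 * (6 + i)) * 3 ^ ((10 + 2 * i) ^ 2 + 4)) := by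
              rw [show (256 : Nat) = 2 ^ 8 by norm_num, <- leg]
              rw [<- sun 2, <- lose, <- eye, <- sun, <- eye]; congr 2; ring
          _ <= (3 ^ 28 * 729 ^ i) * (2 ^ (2 * (6 + i)) * 3 ^ ((10 + 2 * i) ^ 2 + 4)) := car _ (bed nu (tea nu _))
          _ = _ := by
              rw [show (729 : Nat) = 3 ^ 6 by norm_num, <- leg, <- eye, mul_left_comm, <- eye]; congr 2; ring
    · obtain ⟨i, hi⟩ : exists i, m = 4 + i := ⟨m - 4, om⟩
      have e1 : n / 2 = m := om
      rw [e1] at triv hv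
      refine duke hn h3 _ eC.1 (fun h => om) (2 ^ (5 * m - 1)) _ ?_ (rice rug) (key _ ?_)
      · obtain ⟨S0, h⟩ := triv
        exact ⟨S0, h.trans (arm nu om)⟩
      · rw [hm, hi, show 2 * (4 + i) + 1 - 2 = 7 + 2 * i by omega, show 2 * (4 + i) + 1 - 1 = 8 + 2 * i by omega, show 5 * (4 + i) - 1 = 19 + 5 * i by omega]
        calc 2 * ((2 ^ (19 + 5 * i)) ^ 2 * 3 ^ ((7 + 2 * i) ^ 2 + 4)) = (2 ^ 30 * 256 ^ i) * (2 ^ (2 * (4 + i) + 1) * 3 ^ ((7 + 2 * i) ^ 2 + 4)) := by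
              rw [show (256 : Nat) = 2 ^ 8 by norm_num, <- leg, <- leg]
              rw [<- sun 2, <- lose, <- eye, <- sun, <- eye]; congr 2; ring
          _ <= (3 ^ 19 * 729 ^ i) * (2 ^ (2 * (4 + i) + 1) * 3 ^ ((7 + 2 * i) ^ 2 + 4)) := car _ (bed nu (tea nu _))
          _ = _ := by
              rw [show (729 : Nat) = 3 ^ 6 by norm_num, <- leg, <- eye, mul_left_comm, <- eye]; congr 2; ring
end
section
theorem page (hn : 2 <= n) (h2 : qF = 2) (D : Nat -> Nat)
    (hD : forall e l, 2 <= e -> 2 <= l -> l * e <= n -> bus 2 1 (n - l * e) * bus 2 e (l * e) <= D e)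
    (hsum : ∑ e ∈ jury 2 n, tower 2 n D e < 2 ^ (n * n~)) : Fin13 F n := by
  have : Fact (coal 2) := ⟨kick⟩
  refine asmG13 hn 2 1 (by rw [h2, nose]) 0 rug (fun h => absurd (by rw [h2]) h) 0 0 rug rug 1 brain ?_ 1 (rice (by rw [h2])) D (by rwa [h2]) ?_
  · intro p hp _ _ hp1
    rw [h2] at hp1
    exact absurd (Nat.dvd_one.1 hp1) hp.one_lt.ne'
  · rw [h2]
    norm_num
    exact hsum
theorem two_small13 (hn : n = 3 \/ n = 5 \/ n = 6 \/ n = 7 \/ n = 8 \/ n = 9) (h2 : qF = 2) : Fin13 F n := by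
  refine page om h2 (fun e => if n = 5 then 180 else if n <= 7 then (if e = 2 then 181440 else 3528) else if n = 8 then 2 ^ 32 else 2 ^ 44) ?_ ?_
  · intro e l he hl hle
    have h3 : l <= 4 := by nlinarith [show n <= 9 by omega]
    have h4 : e <= 4 := by nlinarith [show n <= 9 by omega]
    rcases hn with rfl | rfl | rfl | rfl | rfl | rfl <;> interval_cases e <;> interval_cases l <;> norm_num at hle <;> norm_num [bus, rat]
  · rcases hn with rfl | rfl | rfl | rfl | rfl | rfl <;> rw [<- Finset.Ico_succ_right_eq_Icc, Order.succ_eq_add_one, Finset.sum_Ico_eq_sum_range] <;>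
      norm_num [tower, deer, bus, lake, rat]
theorem two_big13 (hn : 10 <= n) (h2 : qF = 2) : Fin13 F n := by
  set h := n / 2 with hh
  have hn2 : 10 * n <= n * n := car n hn
  have hs : n ^ 2 = n * n := gun n
  refine page om h2 (fun _ => 2 ^ (n * n - 5 * n + h + 4)) ?_ ?_
  · intro e l he hl hle
    refine (bed (fee ..) (fee ..)).trans ?_
    rw [<- eye, Nat.mul_div_cancel _ om, duck]
    refine arm om ?_
    have h4 : 4 <= l * e := bed hl he
    have h5 : 2 * (l * e * l) <= (l * e) * (l * e) := by nlinarith [lamb (l * e * l)]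
    have h6 : 9 * n + 2 * ((n - l * e) * (n - l * e) + l * e * l) <= 2 * (n * n) + 8 := by
      set u := l * e
      obtain ⟨t, ht⟩ := ear hle
      obtain ⟨v, hv⟩ := ear h4
      have : 9 * n + 2 * (t * t) + u * u <= 2 * (n * n) + 8 := by
        rw [ht, hv]
        rw [ht, hv] at hn
        by_cases hv6 : v <= 6
        · interval_cases v <;> nlinarith
        · nlinarith
      rw [show n - u = t by omega]
      omega
    omega
  · have sq : forall t : Nat, 6 * (5 + t) < 2 ^ (5 + t) /\ (5 + t) ^ 2 <= 2 ^ (5 + t) := fun t => by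
      induction t with
      | zero => norm_num
      | succ t ih => rw [<- smoke, ocean 2]; constructor <;> nlinarith
    obtain ⟨sq1, sq2⟩ := sq (h - 5)
    rw [show 5 + (h - 5) = h by omega] at sq1 sq2
    have key : ∀ e ∈ jury 2 n, tower 2 n (fun _ => 2 ^ (n * n - 5 * n + h + 4)) e <= (3 * 2 ^ (n * n~ - h) : Nat) := by
      intro e he
      obtain ⟨he2, hen⟩ := Finset.mem_Icc.1 he
      have hgs : (deer 2 e : Real) <= ((2 ^ e : Nat) : Real) := stone.2 (by have := cash 2 e om; rw [Nat.mul_one] at this; exact this ▸ Nat.sub_le _ _)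
      have e1 : n * n~ = n * n - n := Nat.mul_sub_one n n
      have hm : n / e <= h := Nat.div_le_div_left he2 om
      have hme : n / e * e <= n := medal n e
      have p1 : ((deer 2 e : Real) - 1) * ((n / e : Nat) ^ 2 * (bus 2 1 (n - e) * bus 2 e e : Nat)) <= (2 ^ (n * n~ - h) : Nat) := by
        calc _ <= ((2 ^ e : Nat) : Real) * ((n / e : Nat) ^ 2 * (bus 2 1 (n - e) * bus 2 e e : Nat)) := egg (by linarith) pz
          _ = (2 ^ e * ((n / e) ^ 2 * (bus 2 1 (n - e) * bus 2 e e)) : Nat) := by push_cast; ring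
          _ <= _ := stone.2 ((tax _ (bed ((tea hm 2).trans sq2) (bed (fee ..) (fee ..)))).trans ?_)
        rw [<- eye, <- eye, <- eye, Nat.div_self om, duck]
        refine arm om ?_
        obtain ⟨t, ht⟩ := ear hen
        rw [show n - e = t by omega, e1]
        have : t * t + 2 * e + n + 2 * n <= n * n := by rw [ht]; rw [ht] at hn; nlinarith
        omega
      have p2 : (deer 2 e : Real) ^ (2 * (n / e)) * (3 ^ (n / e - 1) / 2 * (if 2 * e <= n then 2 ^ (n * n - 5 * n + h + 4) else 0 : Nat)) <= 2 * (2 ^ (n * n~ - h) : Nat) := by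
        have : (deer 2 e : Real) ^ (2 * (n / e)) <= (2 ^ (2 * n) : Nat) := by
          refine (bone pz hgs _).trans ?_
          rw [<- Nat.cast_pow, <- leg]
          exact stone.2 (arm om (by nlinarith))
        have h3 : (3 : Real) ^ (n / e - 1) <= (2 ^ (2 * h~) : Nat) := by
          rw [leg]; push_cast
          exact (bone nu nu _).trans (skin nu om)
        have h4 : ((if 2 * e <= n then 2 ^ (n * n - 5 * n + h + 4) else 0 : Nat) : Real) <= (2 ^ (n * n - 5 * n + h + 4) : Nat) := by split_ifs <;> simp
        calc _ <= ((2 ^ (2 * n) : Nat) : Real) * ((2 ^ (2 * h~) : Nat) / 2 * (2 ^ (n * n - 5 * n + h + 4) : Nat)) := by gcongr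
          _ = ((2 ^ (2 * n) * 2 ^ (2 * h~) * 2 ^ (n * n - 5 * n + h + 4) : Nat) : Real) / 2 := by push_cast; ring
          _ <= ((2 ^ (n * n~ - h + 2) : Nat) : Real) / 2 := by
            refine div_le_div_of_nonneg_right (stone.2 ?_) nu
            rw [<- eye, <- eye]
            exact arm om om
          _ = _ := by rw [eye]; push_cast; ring
      unfold tower
      push_cast at p1 p2 ⊢
      linarith
    refine (law _ _ _ key).trans_lt ?_
    rw [Nat.card_Icc, nsmul_eq_mul]
    have e1 : n * n~ = n * n - n := Nat.mul_sub_one n n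
    have : (n + 1 - 2) * (3 * 2 ^ (n * n~ - h)) < 2 ^ (n * n~) := by
      have h5 : 2 ^ (n * n~) = 2 ^ h * 2 ^ (n * n~ - h) := by rw [<- eye]; congr 1; omega
      rw [h5, <- sun]
      exact Nat.mul_lt_mul_of_pos_right om pz
    exact_mod_cast this
end
section
theorem pink (a : E2) : exists t : F, a * a = t • a - (lid a) • 1 /\ forall u : F, lid (1 + u • a) = 1 + u * t + u ^ 2 * lid a := by
  obtain ⟨M, rfl⟩ := Matrix.toLin'.surjective a
  refine ⟨M 0 0 + M 1 1, ?_, fun u => ?_⟩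
  · rw [snow, thigh]
    refine fish fun v => funext fun i => ?_
    fin_cases i <;> simp [oil, Matrix.mulVec, dotProduct, Fin.sum_univ_two] <;> ring
  · rw [show (1 : E2) + u • Matrix.toLin' M = Matrix.toLin' (1 + u • M) by rw [map_add, map_smul, Matrix.toLin'_one]; rfl,
      snow, snow, thigh, thigh]
    simp; ring
theorem sq2_13 (a : G2) (hd : lid a.1 = 1) (h1 : a ∉ hat G2) (h2 : a ^ 2 ∈ hat G2) : a.1 ^ 2 = (-1 : F) • 1 := by
  obtain ⟨c, hc⟩ := (moon _).1 h2
  obtain ⟨t, ht, -⟩ := pink a.1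
  rw [ice] at hc
  rw [<- gun, hd, hc, beach] at ht
  by_cases h0 : t = 0
  · rw [hc, ht, h0, wrist, zero_sub]; exact fish fun v => sm
  · refine absurd ((moon _).2 ⟨t~i * (c + 1), ?_⟩) h1
    rw [mul_smul, add_smul, beach, ht, sub_add_cancel, queen h0]
variable (F) in
def swim : G2 := plug (-1 : F) sm
theorem zc13 (g : G2) : g * swim F = swim F * g := sea.1 (fence _ _) g
theorem pencil : swim F * swim F = 1 := goal (by rw [pig]; change ((-1 : F) • (1 : E2)) * ((-1 : F) • 1) = 1; rw [elbow]; simp)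
theorem bank (hF2 : nz 2) : swim F ≠ 1 := fun h => by
  have := soft (n := 2) waist ((van Units.val h).trans (beach F (1 : E2)).symm)
  apply hF2; linear_combination -this
theorem zmem13 (S : Subgroup G2) (hS : lady 2 S) : swim F ∈ S := by
  refine hS.cen _ (fence _ _) ?_ ⟨1, by rw [nose, gun, pencil]⟩
  change lid ((-1 : F) • (1 : E2)) = 1
  rw [rude]; simp
theorem cenS13 (x : G2) (hd : lid x.1 = 1) (hx : x ∈ hat G2) : x = 1 \/ x = swim F := by
  obtain ⟨c, hc⟩ := (moon _).1 hx
  rw [hc, rude, tank, box, toe] at hd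
  rcases mul_self_eq_one_iff.1 ((gun c).symm.trans hd) with h | h
  · exact rice (goal (by rw [hc, h, beach]; rfl))
  · exact horse (goal (by rw [hc, h]; rfl))
theorem sqz13 (a : G2) (hd : lid a.1 = 1) (h1 : a ∉ hat G2) (h2 : a ^ 2 ∈ hat G2) : a * a = swim F :=
  goal (by rw [<- gun, ice]; exact sq2_13 a hd h1 h2)
theorem sqnc13 (hF2 : nz 2) (a : G2) (hd : lid a.1 = 1) (h : a * a = swim F) : a ∉ hat G2 := fun hc => by
  rcases cenS13 a hd hc with rfl | rfl
  · exact bank hF2 (by rw [<- h, tin])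
  · exact bank hF2 (by rw [<- h, pencil])
theorem brush (hF2 : nz 2) (S : Subgroup G2) (hS : lady 2 S) (h4 : 2 < cat S) :
    ∃ c ∈ S, c * c = swim F /\ ∀ g ∈ S, g * c = c * g \/ g * c = swim F * (c * g) := by
  have hf : Finite G2 := owl
  set N : Subgroup S := (hat G2).subgroupOf S
  have hN : cat N <= 2 := by
    have := sky (s := {x : S | x ∈ N}) (t := {1, ⟨swim F, zmem13 S hS⟩}) (fun x hx => by
      rcases cenS13 x.1 (hS.det _ x.2) hx with h | h
      · exact rice (beef h)
      · exact horse (beef h)) tf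
    exact this.trans ((cake _ _).trans (by rw [angry]))
  have hpg : IsPGroup 2 (S ⧸ N) := hS.pg.to_quotient N
  have hnt : Nontrivial (S ⧸ N) := by
    rw [<- Finite.one_lt_card_iff_nontrivial]
    have := Subgroup.card_eq_card_quotient_mul_card_subgroup N
    by_contra h
    have : cat (S ⧸ N) * cat N <= 1 * 2 := bed om hN
    omega
  have hcn := hpg.center_nontrivial
  have hdv : 2 ∣ cat (hat (S ⧸ N)) := by
    obtain ⟨m, hm⟩ := (hpg.to_subgroup _).exists_card_eq (G := hat (S ⧸ N))
    have := game (α := hat (S ⧸ N))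
    rw [hm] at this ⊢
    exact tree _ (by rintro rfl; simp at this)
  obtain ⟨⟨x, hx⟩, ho⟩ := dad 2 hdv
  obtain ⟨c, rfl⟩ := QuotientGroup.mk_surjective x
  have h1 : c ∉ N := fun h => by
    rw [orderOf_eq_iff waist] at ho
    exact ho.2 1 nu nu (beef (by simpa using (jump c).2 h))
  have h2 : c ^ 2 ∈ N := by
    have := van shop (knee (⟨_, hx⟩ : hat (S ⧸ N)))
    rw [ho] at this
    exact (jump _).1 (by simpa using this)
  refine ⟨c.1, c.2, sqz13 _ (hS.det _ c.2) h1 h2, fun g hg => ?_⟩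
  have h3 : (⟨g, hg⟩ * c) * (c * ⟨g, hg⟩)~i ∈ N := by
    rw [<- jump]
    have := sea.1 hx (QuotientGroup.mk ⟨g, hg⟩)
    rw [QuotientGroup.mk_mul, QuotientGroup.mk_inv, QuotientGroup.mk_mul, QuotientGroup.mk_mul, this, soul]
  rcases cenS13 (g * c.1 * (c.1 * g)~i) (hS.det _ (cab (cab hg c.2) (nurse (cab c.2 hg)))) h3 with h | h
  · exact rice (thumb.1 h)
  · exact horse (mul_inv_eq_iff_eq_mul.1 h)
theorem xeq13 (hF2 : nz 2) (a c : G2) (hd : lid (a * c).1 = 1) (haa : a * a = swim F) (hcc : c * c = swim F) (h : a * c = c * a) : a = c \/ a = swim F * c := by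
  have h1 : (a * c) * (a * c) = 1 := by
    rw [sun, <- sun c, <- h, sun a, hcc, <- sun, haa, pencil]
  have h2 : a * c ∈ hat G2 := by
    by_contra hn
    have := sqz13 _ hd hn (by rw [gun, h1]; exact horn _)
    exact bank hF2 (this.symm.trans h1)
  have hci : c~i = swim F * c := inv_eq_of_mul_eq_one_left (by rw [sun, hcc, pencil])
  rcases cenS13 _ hd h2 with h3 | h3
  · right; rw [<- hci]; exact eq_inv_of_mul_eq_one_left h3
  · left; rw [eq_mul_inv_of_mul_eq h3, hci, <- sun, pencil, tin]
theorem xcard13 (hF2 : nz 2) (S : Subgroup G2) (hS : lady 2 S) (h4 : 2 < cat S) :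
    2 * {a | a ∈ S /\ a * a = swim F}.ncard <= cat S + 4 := by
  have hf : Finite G2 := owl
  obtain ⟨c, hc, hcc, hg⟩ := brush hF2 S hS h4
  set X := {a | a ∈ S /\ a * a = swim F}
  set A := {a | a ∈ S /\ a * c = c * a}
  set B := {a | a ∈ S /\ a * c ≠ c * a}
  have hAB : A.ncard + B.ncard <= cat S := by
    rw [<- Set.ncard_union_eq (Set.disjoint_left.2 fun x h1 h2 => h2.2 h1.2) tf tf]
    exact frog S _ (by rintro x (h | h) <;> exact h.1)
  have hBA : B.ncard <= A.ncard := by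
    rcases B.eq_empty_or_nonempty with h0 | ⟨x, hx, hx'⟩
    · rw [h0]; simp
    · refine bee (fun y => x * y) ?_ (fun x _ y _ h => river h) tf
      rintro y ⟨hy, hy'⟩
      refine ⟨cab hx hy, ?_⟩
      have e1 := (hg x hx).resolve_left hx'
      have e2 := (hg y hy).resolve_left hy'
      rw [sun, e2, <- sun, zc13, sun, <- sun x, e1, sun, <- sun (swim F), pencil, tin, sun]
  have hX : X ⊆ B ∪ {c, swim F * c} := by
    rintro a ⟨ha, haa⟩
    by_cases h : a * c = c * a
    · exact horse (xeq13 hF2 a c (hS.det _ (cab ha hc)) haa hcc h)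
    · exact rice ⟨ha, h⟩
  have h1 := (sky hX tf).trans (team _ _)
  have h2 := cake c {swim F * c}
  rw [angry] at h2
  omega
theorem paint (S : Subgroup G2) (hS : lady 2 S) : play 2 S ⊆ {y | ∃ a ∈ {a | a ∈ S /\ a * a = swim F}, ∃ b ∈ {a | a ∈ S /\ a * a = swim F}, b * y = y * a} := by
  have hf : Finite G2 := owl
  rintro y ⟨a, ha, b, hb, h, h1, h2⟩
  exact ⟨a, ⟨ha, sqz13 a (hS.det _ ha) h1 h2⟩, b, ⟨hb, sqz13 b (hS.det _ hb) ((gold h 2).1 h1) (by rw [(gold h 2).2.1 h2]; exact h2)⟩, h⟩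
theorem music (hF2 : nz 2) (S : Subgroup G2) (hS : lady 2 S) (h4 : 2 < cat S) (C : Nat)
    (hC : ∀ a ∈ S, a * a = swim F -> {y | a * y = y * a}.ncard <= C) : 8 * (play 2 S).ncard <= (cat S + 4) ^ 2 * C := by
  have hf : Finite G2 := owl
  set X := {a | a ∈ S /\ a * a = swim F}
  have hz : ∀ a ∈ X, swim F * a ∈ X := fun a ha => ⟨cab (zmem13 S hS) ha.1, by rw [sun, <- sun a, zc13, sun, ha.2, pencil, box]⟩
  have h := dcount13 (X ×ˢ X) C (fun ab hab => hC _ hab.1.1 hab.1.2) (play 2 S) 2 (fun y hy => by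
    obtain ⟨a, ha, b, hb, h⟩ := paint S hS hy
    have hne : (a, b) ≠ (swim F * a, swim F * b) := fun h => bank hF2 (fresh.1 (van Prod.fst h).symm)
    refine (Set.ncard_pair hne).symm.le.trans (sky ?_ tf)
    rintro _ (rfl | rfl)
    exacts [⟨⟨ha, hb⟩, h⟩, ⟨⟨hz a ha, hz b hb⟩, by simp only; rw [sun, h, <- sun, <- sun, zc13]⟩])
  rw [wife, <- gun] at h
  have h3 := car C (tea (xcard13 hF2 S hS h4) 2)
  rw [door, sun] at h3
  change _ * (X.ncard ^ 2 * C) <= _ at h3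
  omega
theorem north (hq4 : cat F % 4 = 3) (a : G2) (ha : a * a = swim F) : {y | a * y = y * a}.ncard <= cat F ^ 2 - 1 := by
  have := sell F
  have h := small 2 a.1 (-1) (by rw [gun, <- pig, ha]; rfl) (fun c hc => by
    have := FiniteField.isSquare_neg_one_iff (F := F).1 ⟨c, by rw [<- hc, gun]⟩
    rw [<- cup] at this; exact this hq4) (by unfold Nat.ModEq; omega)
  rw [bridge]
  refine h.trans (by simp [bus])
theorem juice (hF2 : (2 : F) ≠ 0) (hq4 : cat F % 4 = 1) (a : G2) (hd : lid a.1 = 1) (ha : a * a = swim F) : {y | a * y = y * a}.ncard <= (cat F - 1) ^ 2 := by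
  have := sell F
  have hf : Finite G2 := owl
  obtain ⟨d, hd⟩ := FiniteField.isSquare_neg_one_iff (F := F).2 (by rw [<- cup]; omega)
  have hd0 : d ≠ 0 := by rintro rfl; simp at hd
  have hb : (d • a.1) ^ 2 = 1 := by
    rw [fire, gun, gun, <- pig, ha, <- hd]
    change (-1 : F) • ((-1 : F) • (1 : E2)) = 1
    rw [nerve]; simp
  have hm : (d • a.1 + 1) * (d • a.1 - 1) = 0 := by rw [add_mul, crime, crime, <- gun, hb]; simp
  have hk : forall c : F, d • a.1 ≠ c • 1 := fun c hc => sqnc13 hF2 a ‹_› ha ((moon _).2 ⟨d~i * c, by rw [mul_smul, <- hc, queen hd0]⟩)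
  have h := plane 2 (d • a.1) hb (mod_cast hF2) om
  have hs := win (d • a.1 - 1)
  rw [toe] at hs
  have hr0 : fox F (red (d • a.1 - 1)) ≠ 0 := fun h0 => by
    rw [sand, foot, hip] at h0
    exact hk 1 (by rw [h0, beach])
  have hk0 : fox F (bat (d • a.1 - 1)) ≠ 0 := fun h0 => by
    rw [sand, dawn] at h0
    have := LinearMap.range_eq_top.1 (LinearMap.ker_eq_bot_iff_range_eq_top.1 (dawn.2 h0))
    refine hk (-1) (fish fun v => ?_)
    obtain ⟨w, rfl⟩ := this v
    have := tub hm w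
    rw [oil, LinearMap.add_apply] at this
    simpa using eq_neg_of_add_eq_zero_left this
  have hz2 : orderOf (cat F : ZMod 2) = 1 := by
    rw [chest, <- head, steel]; unfold Nat.ModEq; omega
  rw [show fox F (red (d • a.1 - 1)) = 1 by omega, show fox F (bat (d • a.1 - 1)) = 1 by omega, hz2,
    show bus (cat F) 1 1 = cat F - 1 by simp [bus], <- gun] at h
  refine ride (sky ?_ tf) h
  intro y hy
  simp only [hill] at hy ⊢
  rw [men, boat, <- pig, hy, pig]
theorem n2odd13 (p : Nat) [hp : Fact p.Prime] (hp2 : p ≠ 2) (hpF : nz p) (hq : ndv p) (h1 : p ∣ qF - 1)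
    (S : Subgroup G2) (hS : lady p S) : ((play p S).ncard : Real) <= (p~R - 1) * (4 * ((qF : Real) - 1) ^ 2) := by
  have hf : Finite G2 := owl
  have hb := black p rug hpF hq h1 S hS.pg 0 0 (by intros; omega) (fun h => absurd ((pot hp.out kick).1 h) hp2) om
    ((hard p S 0).trans sm)
  have hmod : (qF : ZMod p) = 1 := by
    have := (saw qF~ p).2 h1
    rwa [jar mouse, head, hip] at this
  have hm := house p hp2 hpF hq (S ⊔ night p F 2) (dark p S hS.pg)
  rw [hmod, cold, toe, duck] at hm
  have g1 : bus qF 1 1 = qF - 1 := by simp [bus]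
  have h5 := hb.trans (room (car _ (tea hm 2)) 0)
  rw [show 2 - 1 = 1 from rfl, g1, show (2 * p~) ^ 2 * (qF~ * qF~) + 0 = p~ * (p~ * (4 * qF~ ^ 2)) by ring] at h5
  have h6 := stone (α := Real).2 (Nat.le_of_mul_le_mul_left h5 (by have := hp.out.two_le; omega))
  rwa [mile, mile, Nat.cast_pow, jar hp.out.pos, jar mouse, head] at h6
end
theorem wt13 {G : Type*} [Fintype G] (f : G -> Nat) (K s t : Nat) (hK : ∑ y, f y <= K) (E N : Set G) (hE : ∀ y ∈ E, s <= f y) (hN : ∀ y ∈ N, s + t <= f y) :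
    s * E.ncard + t * N.ncard <= K := by
  classical
  refine ride ?_ hK
  have h : ∀ (A : Set G) (m : Nat), m * A.ncard = ∑ y, if y ∈ A then m else 0 := fun A m => by
    rw [Finset.sum_ite, Finset.sum_const_zero, tooth, Finset.sum_const, lung, bid, <- lion]; simp
  rw [h, h, <- Finset.sum_add_distrib]
  refine rain fun y _ => ?_
  by_cases h1 : y ∈ E <;> by_cases h2 : y ∈ N <;> simp only [h1, h2, if_true, if_false]
  · exact hN y h2
  · exact hE y h1
  · exact (room (lamb s) t).trans (hN y h2)
  · simp
section
theorem cent2_13 (a : G2) (ha : a ∉ hat G2) : {y | a * y = y * a}.ncard <= qF ^ 2 := by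
  have hf : Finite G2 := owl
  have : exists v, LinearIndependent F ![v, a.1 v] := by
    by_contra! h
    exact ha ((moon _).2 (LinearMap.exists_eq_smul_id_of_forall_notLinearIndependent h))
  obtain ⟨v, hv⟩ := this
  have hsp := hv.span_eq_top_of_card_eq_finrank (by rw [toe]; rfl)
  have hc : qF ^ 2 = (Set.univ : Set (Fin 2 -> F)).ncard := by rw [Set.ncard_univ, Nat.card_fun, Nat.card_fin]
  rw [hc]
  refine bee (fun y => y.1 v) (fun _ _ => Set.mem_univ _) ?_ tf
  intro x hx y hy h
  refine goal (LinearMap.ext_on_range (v := ![v, a.1 v]) hsp fun i => ?_)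
  have hh : forall x : G2, a * x = x * a -> x.1 (a.1 v) = a.1 (x.1 v) := fun x hx => by
    rw [<- oil, <- oil, <- pig, <- pig, hx]
  fin_cases i
  · exact h
  · simp only [Fin.mk_one, Matrix.cons_val_one, Matrix.cons_val_fin_one]
    rw [hh x hx, hh y hy]; exact van a.1 h
theorem asmN13 (r k : Nat) [hr : Fact r.Prime] (hk : qF = r ^ k) (B2 : Nat) (c1 : Real) (hc1 : 0 <= c1)
    (hB2 : ¬ 2 ∣ qF -> nz 2 -> forall S : Subgroup G2, lady 2 S -> 2 * (play 2 S).ncard <= B2)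
    (hB1 : forall p : Nat, [Fact p.Prime] -> p ≠ 2 -> nz p -> ¬ p ∣ qF -> p ∣ qF - 1 -> forall S : Subgroup G2, lady p S -> ((play p S).ncard : Real) <= (p~R - 1) * c1)
    (M j W J : Nat) (hM : qF - 1 = 2 ^ j * M) (hW : qF + 1 = 2 ^ J * W)
    (hsum : B2~R / 2 + (M~R - 1) * c1 + (W~R - 1) * ((qF : Real) ^ 2 - 1) < ((qF : Real) - 1) ^ 2 * (qF : Real) ^ 2) : Fin13 F 2 := by
  intro H
  refine asm13 rug r k hk H (B2 / 2) pz (fun h => ⟨default, ?_⟩) c1 0 hc1 rug 1 brain ?_ M j hM (fun _ => 0) (deer qF)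
    (fun e => if e = 2 then W else deer qF e) (fun e => if e = 2 then J else 0) (fun e _ => cash _ _ mouse) ?_ (by intros; nlinarith) ?_
  · have := hB2 (blue r k hk h).1 (blue r k hk h).2 _ (wall 2 default)
    rw [le_div_iff₀ waist, bid]; exact_mod_cast this
  · intro p hp hp2 hpr hp1 S0
    have : Fact p.Prime := ⟨hp⟩
    have h1 : ndv p := by
      rw [hk]
      exact fun h => hpr ((pot hp hr.out).1 (hp.dvd_of_dvd_pow h))
    rw [mul_zero, tooth]
    refine hB1 p hp2 (fun h0 => h1 ?_) h1 hp1 _ (wall p S0)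
    have : CharP F p := (son hp).2 h0
    have := sell F
    obtain ⟨m, -, hm⟩ := FiniteField.card F p
    rw [cup, hm]
    exact tree p m.ne_zero
  · intro e he
    by_cases h : e = 2
    · subst h; simp [deer, lake, <- hW, add_comm]
    · simp [h]
  · rw [show jury 2 2 = ({2} : Finset Nat) from rfl, Finset.sum_singleton]
    have e1 : ((qF ^ 2 - 1 : Nat) : Real) = (qF : Real) ^ 2 - 1 := by rw [jar (wood _ _ mouse)]; simp
    have g0 : bus qF 1 0 = 1 := by simp [bus]
    have g1 : bus qF 2 2 = qF ^ 2 - 1 := by simp [bus]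
    norm_num [g0, g1, e1]
    norm_num at hsum
    linarith
theorem two13 (r k : Nat) [hr : Fact r.Prime] (hk : qF = r ^ k) (hq : 4 <= qF) (h7 : qF ≠ 7) : Fin13 F 2 := by
  set q := qF with hqd
  have hq' : (4 : Real) <= q := mod_cast hq
  have hodd : forall p : Nat, [Fact p.Prime] -> p ≠ 2 -> nz p -> ¬ p ∣ q -> p ∣ q - 1 -> forall S : Subgroup G2, lady p S -> ((play p S).ncard : Real) <= (p~R - 1) * (4 * (q~R - 1) ^ 2) :=
    fun p _ h1 h2 h3 h4 S hS => n2odd13 p h1 h2 h3 h4 S hS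
  have e1 : q ^ 2 - 1 = (q + 1) * q~ := Nat.sq_sub_sq q 1
  have hS2 : ¬ 2 ∣ q -> forall S : Subgroup G2, lady 2 S -> cat S = 2 ^ (bow 2 (q + 1) + bow 2 q~) := fun h S hS => by
    rw [town rug om h S hS, <- hqd, e1, bow.mul om om]; simp
  have hp2 : forall m, m % 4 = 2 -> bow 2 m = 1 := fun m hm => by
    obtain ⟨t, rfl⟩ : exists t, m = 2 * t := ⟨m / 2, om⟩
    rw [bow.mul nu om, cool, bow.eq_zero_of_not_dvd om]
  rcases Nat.even_or_odd' q with ⟨m, hm | hm⟩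
  · refine asmN13 r k hk 0 _ pz (fun h => absurd ⟨m, hm⟩ h) hodd q~ 0 (q + 1) 0 (by simp [hqd]) (by simp [hqd]) ?_
    rw [<- hqd]
    push_cast [jar (show 1 <= q by omega)]
    obtain ⟨x, hx⟩ : exists x : Real, q~R = 4 + x := ⟨q - 4, rg⟩
    have hx0 : 0 <= x := by linarith
    rw [hx, <- ash]; ring_nf; positivity
  have ho : ¬ 2 ∣ q := om
  by_cases h4 : q % 4 = 1
  · have h5 : (5 : Real) <= q := mod_cast (by omega : 5 <= q)
    refine asmN13 r k hk ((q + 1) ^ 2 * q~ ^ 2) _ pz (fun _ hF2 S hS => ?_) hodd (q~ / 4) 2 ((q + 1) / 2) 1 om om ?_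
    · have hc := hS2 ho S hS
      rw [hp2 _ om] at hc
      have hd := hair om (pow_padicValNat_dvd (p := 2) (n := q - 1))
      have hd2 : 1 <= bow 2 q~ := one_le_padicValNat_of_dvd om om
      have hd3 := arm waist hd2
      rw [eye, nose] at hc
      have := music hF2 S hS (by rw [hc]; omega) (q~ ^ 2) (fun a ha h => juice hF2 h4 a (hS.det _ ha) h)
      have h6 : (cat S + 4) ^ 2 <= (2 * (q + 1)) ^ 2 := tea om 2
      have := this.trans (car _ h6)
      rw [door, sun] at this
      omega
    · rw [<- hqd]
      obtain ⟨t, ht⟩ : exists t, q = 4 * t + 5 := ⟨(q - 5) / 4, om⟩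
      rw [ht, show (4 * t + 5 - 1) / 4 = t + 1 by omega, show (4 * t + 5 + 1) / 2 = 2 * t + 3 by omega, show 4 * t + 5 - 1 = 4 * t + 4 by omega]
      push_cast
      have ht0 : (0 : Real) <= t := pz
      rw [<- ash]; ring_nf; positivity
  · have h3 : q % 4 = 3 := om
    obtain ⟨W, hW⟩ := pow_padicValNat_dvd (p := 2) (n := q + 1)
    set s := 2 ^ bow 2 (q + 1) with hs
    have hWo : ¬ 2 ∣ W := fun h => pow_succ_padicValNat_not_dvd (p := 2) (n := q + 1) om (by
      obtain ⟨w, rfl⟩ := h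
      exact ⟨w, by rw [ocean, sun]; exact hW⟩)
    have hs4 : 4 ∣ s := by
      have : Nat.Coprime 4 W := (Nat.Coprime.pow_left 2 ((coal.coprime_iff_not_dvd kick).2 hWo) : Nat.Coprime (2 ^ 2) W)
      exact this.dvd_of_dvd_mul_right (by rw [<- hW]; omega)
    refine asmN13 r k hk ((s + 2) ^ 2 * (q ^ 2 - 1)) _ pz (fun _ hF2 S hS => ?_) hodd (q~ / 2) 1 W _ om hW ?_
    · have hc := hS2 ho S hS
      rw [hp2 q~ om, eye, nose, <- hs] at hc
      have : 0 < s := pz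
      have := music hF2 S hS (by rw [hc]; omega) (q ^ 2 - 1) (fun a ha h => north h3 a h)
      rw [hc, show s * 2 + 4 = 2 * (s + 2) by ring, door, sun] at this
      omega
    · rw [<- hqd]
      have hW' : q~R + 1 = s * W := mod_cast hW
      obtain ⟨t, ht⟩ : exists t, q = 2 * t + 1 := ⟨m, hm⟩
      have e5 : ((q ^ 2 - 1 : Nat) : Real) = q~R ^ 2 - 1 := by rw [jar (wood _ _ om)]; simp
      have e6 : ((q~ / 2 : Nat) : Real) = (q~R - 1) / 2 := by rw [ht, show (2 * t + 1 - 1) / 2 = t by omega]; push_cast; ring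
      rw [mile, e5, e6]
      push_cast
      by_cases hW1 : W = 1
      · have hq15 : 15 <= q := by
          rw [hW1, box] at hW
          by_contra hlt
          have : q = 11 := om
          rw [this] at hW
          have h8 : (3 : Nat) ∣ 2 ^ bow 2 (q + 1) := ⟨4, by rw [<- hs, <- hW]⟩
          have := (pot face kick).1 (face.dvd_of_dvd_pow h8)
          omega
        rw [hW1] at hW' ⊢
        have h15 : (15 : Real) <= q := mod_cast hq15
        rw [show s~R = q + 1 by rw [hW']; simp]
        obtain ⟨x, hx⟩ : exists x : Real, q~R = 15 + x := ⟨q - 15, rg⟩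
        have hx0 : 0 <= x := by linarith
        rw [hx, <- ash, head]; ring_nf; positivity
      · have hW3 : 3 <= W := by rcases W with _ | _ | _ | W <;> omega
        have h11 : (11 : Real) <= q := mod_cast (by omega : 11 <= q)
        have hs3 : 3 * s~R <= q + 1 := mod_cast (by nlinarith : 3 * s <= q + 1)
        have hs0 : 4 <= s := hair pz hs4
        have hW4 : 4 * W~R <= q + 1 := mod_cast (by nlinarith : 4 * W <= q + 1)
        have hs' : (0 : Real) <= s := pz
        have b1 : (s~R + 2) ^ 2 <= ((q~R + 7) / 3) ^ 2 := bone pz (by linarith) 2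
        have b2 : (W~R - 1) <= (q~R - 3) / 4 := by linarith
        have hq1 : (0 : Real) <= q~R ^ 2 - 1 := by nlinarith
        have b3 := egg b1 hq1
        have b4 := egg b2 hq1
        refine rose (new (new (div_le_div_of_nonneg_right b3 waist.le) rug) b4) ?_
        obtain ⟨x, hx⟩ : exists x : Real, q~R = 11 + x := ⟨q - 11, rg⟩
        have hx0 : 0 <= x := by linarith
        rw [hx, <- ash]; ring_nf; positivity
end
section
theorem e7three13 (hq : qF = 7) (p : Nat) [hp : Fact p.Prime] (hp2 : p ≠ 2) (hpq : ndv p) (h1 : p ∣ qF - 1)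
    (S : Subgroup G2) (hS : lady p S) : ((play p S).ncard : Real) <= (p~R - 1) * 49 := by
  have hf : Finite G2 := owl
  have hp3 : p = 3 := by
    rw [hq] at h1
    have := hair nu h1
    have := hp.out.two_le
    interval_cases p <;> first | rfl | exact absurd rfl hp2 | omega | exact absurd hp.out (by decide)
  subst hp3
  have hc := valley waist 3 hpq S hS
  have v6 : bow 3 6 = 1 := by rw [show 6 = 3 * 2 from rfl, bow.mul nu nu, cool, bow.eq_zero_of_not_dvd nu]
  have v48 : bow 3 48 = 1 := by rw [show 48 = 3 * 16 from rfl, bow.mul nu nu, cool, bow.eq_zero_of_not_dvd nu]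
  rw [hq, show girl 2 = {0, 1} from rfl, Finset.prod_pair nu] at hc
  norm_num at hc
  rw [show 288 = 6 * 48 from rfl, bow.mul nu nu, v6, v48] at hc
  set A : Set G2 := {a | a ∈ S /\ a ∉ hat G2 /\ a ^ 3 ∈ hat G2}
  have hA : A.ncard <= 2 := by
    have h := frog S (insert 1 A) (by rintro x (rfl | h); exacts [horn _, h.1])
    rw [tiger (fun h => h.2.1 (horn _)) tf] at h
    omega
  have h := milk 3 A (qF ^ 2) (fun a ha => ⟨ha.2.1, ha.2.2, fun i h0 hi =>
    ⟨S.pow_mem ha.1 i, fun h => ha.2.1 (gate 3 a ha.2.2 i h0 hi h), by rw [<- leg, bid, leg]; exact pound _ ha.2.2 _⟩, cent2_13 a ha.2.1⟩)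
  have hE : play 3 S ⊆ {y | ∃ a ∈ A, ∃ b ∈ A, b * y = y * a} := by
    rintro y ⟨a, ha, b, hb, h, h1, h2⟩
    exact ⟨a, ⟨ha, h1, h2⟩, b, ⟨hb, (gold h 3).1 h1, by rw [(gold h 3).2.1 h2]; exact h2⟩, h⟩
  have h2 := sky hE tf
  have h3 : A.ncard ^ 2 * qF ^ 2 <= 2 ^ 2 * 7 ^ 2 := bed (tea hA 2) (by rw [hq])
  have h4 : (play 3 S).ncard <= 98 := om
  have h5 : ((play 3 S).ncard : Real) <= 98 := mod_cast h4
  norm_num; linarith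
theorem e7two13 (hq : qF = 7) (hF2 : nz 2) (S : Subgroup G2) (hS : lady 2 S) : 2 * (play 2 S).ncard <= 3264 := by
  have hf : Finite G2 := owl
  have hft : Fintype G2 := sell _
  have hch : CharP F 7 := by
    have := sell F
    have : Fact (coal 7) := ⟨nu⟩
    exact sour (by rw [<- cup]; exact hq)
  have hSc : cat S = 16 := by
    rw [town rug om om S hS, hq]
    norm_num
    rw [show 48 = 2 ^ 4 * 3 from rfl, bow.mul nu nu, bow.prime_pow, bow.eq_zero_of_not_dvd nu]
    norm_num
  obtain ⟨c, hc, hcc, hg⟩ := brush hF2 S hS om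
  have hXle := xcard13 hF2 S hS om
  have hz1 : swim F ≠ 1 := bank hF2
  have hzz : swim F * swim F = 1 := pencil
  have hzc : forall g : G2, g * swim F = swim F * g := zc13
  have hzS := zmem13 S hS
  have hEX := paint S hS
  have hsm : ∀ (t : F) (a : G2), lid a.1 = 1 -> a * a = swim F -> a.1 * a.1 = t • a.1 - lid a.1 • 1 -> t = 0 := by
    intro t a hd h h1
    rw [<- pig, h, hd] at h1
    change (-1 : F) • (1 : E2) = _ at h1
    have h2 : t • a.1 = 0 := by rw [sub_eq_iff_eq_add.1 h1.symm, <- add_smul]; simp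
    exact (cloud.1 h2).resolve_right a.ne_zero
  obtain ⟨g, hgc, hgd⟩ : exists g : G2, g * c = c * g /\ lid g.1 = 3 := by
    obtain ⟨t, ht, hu⟩ := pink c.1
    have h0 := hsm t c (hS.det _ hc) hcc ht
    have h3 : lid (1 + (3 : F) • c.1) = 3 := by
      have h7 : ((7 : Nat) : F) = 0 := CharP.cast_eq_zero F 7
      push_cast at h7
      rw [hu, h0, hS.det _ hc]; linear_combination h7
    have h30 : (3 : F) ≠ 0 := fun h => absurd ((CharP.cast_eq_zero_iff F 7 3).1 (mod_cast h)) nu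
    obtain ⟨g, hg⟩ := (LinearMap.isUnit_iff_isUnit_det _).2 (by rw [h3]; exact h30.isUnit : IsUnit (lid (1 + (3 : F) • c.1)))
    refine ⟨g, goal ?_, by rw [hg, h3]⟩
    rw [pig, pig, hg, add_mul, mul_add, men, boat, tin, box]
  have hn48 : forall a : G2, a * a = swim F -> {y | a * y = y * a}.ncard <= 48 := fun a ha => (north om a ha).trans (by rw [hq]; norm_num)
  have hxe := fun a c hd h1 h2 h3 => xeq13 hF2 a c hd h1 h2 h3
  have hcs : forall a : G2, lid a.1 = 1 -> (forall t : F, a.1 * a.1 = t • a.1 - lid a.1 • 1 -> t = 0) -> a * a = swim F := fun a hd h => by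
    obtain ⟨t, ht, -⟩ := pink a.1
    rw [h t ht, hd, wrist, zero_sub, beach] at ht
    exact goal (by rw [pig, ht]; exact fish fun v => by simp [swim, plug])
  generalize swim F = z at *
  set X := {a | a ∈ S /\ a * a = z}
  have km : forall k1 k2 y1 y2 : G2, (forall g, g * k2 = k2 * g) -> y1 * c = k1 * (c * y1) -> y2 * c = k2 * (c * y2) -> y1 * y2 * c = k2 * k1 * (c * (y1 * y2)) := by
    intro k1 k2 y1 y2 h h1 h2
    rw [sun, h2, <- sun, h, sun, <- sun y1, h1]; group
  have ki : forall k y : G2, (forall g, g * k = k * g) -> k * k = 1 -> y * c = k * (c * y) -> y~i * c = k * (c * y~i) := by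
    intro k y h h1 h2
    have : c = y~i * (k * (c * y)) := by rw [<- h2]; group
    calc y~i * c = (k * k) * (y~i * (c * y) * y~i) := by rw [h1]; group
      _ = k * ((k * y~i) * (c * y) * y~i) := by group
      _ = k * ((y~i * (k * (c * y))) * y~i) := by rw [<- h y~i]; group
      _ = k * (c * y~i) := by rw [<- this]
  have h1c : forall g : G2, g * 1 = 1 * g := fun g => by rw [box, tin]
  set Nc : Set G2 := {y | y * c = c * y \/ y * c = z * (c * y)} with hNc
  have hk : ∀ y ∈ Nc, exists k : G2, (forall g, g * k = k * g) /\ k * k = 1 /\ (k = 1 \/ k = z) /\ y * c = k * (c * y) := by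
    rintro y (h | h)
    · exact ⟨1, h1c, tin 1, rice rfl, by rw [tin, h]⟩
    · exact ⟨z, hzc, hzz, horse rfl, h⟩
  set C1 : Set G2 := {y | lid y.1 = 1 /\ y * c = c * y}
  set C2 : Set G2 := {y | lid y.1 = 1 /\ y * c = z * (c * y)}
  have hdm : forall x y : G2, lid (x * y).1 = lid x.1 * lid y.1 := fun x y => by rw [pig, pan]
  have hinj : forall A : Set G2, (∀ y ∈ A, lid y.1 = 1) -> ((fun x : G2 × Nat => x.1 * g ^ x.2) '' (A ×ˢ (girl 6 : Set Nat))).ncard = A.ncard * 6 := by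
    intro A hA
    rw [Set.ncard_image_of_injOn, wife, lion, Finset.card_range]
    have hlt : forall i j, i < j -> j < 6 -> (3 : F) ^ i ≠ 3 ^ j := by
      intro i j hij hj h
      have h2 : (((3 ^ j - 3 ^ i : Nat)) : F) = 0 := by
        rw [jar (arm nu hij.le)]; push_cast; rw [h, sub_self]
      rw [CharP.cast_eq_zero_iff F 7] at h2
      interval_cases j <;> interval_cases i <;> revert h2 <;> norm_num
    rintro ⟨x, i⟩ ⟨hx, hi⟩ ⟨y, j⟩ ⟨hy, hj⟩ h
    simp only [Finset.coe_range, Set.mem_Iio] at hi hj h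
    have h2 : (3 : F) ^ i = 3 ^ j := by
      have := van (fun x : G2 => lid x.1) h
      simp only [pig, ice, pan, rich, hA x hx, hA y hy, hgd, tin] at this
      exact this
    have h3 : i = j := by
      rcases lt_trichotomy i j with h4 | h4 | h4
      exacts [absurd h2 (hlt i j h4 hj), h4, absurd h2.symm (hlt j i h4 hi)]
    subst h3
    rw [star h]
  have hgi : forall i : Nat, g ^ i * c = c * g ^ i := fun i => ((show Commute g c from hgc).pow_left i).eq
  have hC1 : C1.ncard <= 8 := by
    have h1 := hinj C1 (fun y h => h.1)
    have h2 := hn48 c hcc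
    have h3 := sky (s := (fun x : G2 × Nat => x.1 * g ^ x.2) '' (C1 ×ˢ (girl 6 : Set Nat))) (t := {y | c * y = y * c}) (by
      rintro _ ⟨⟨x, i⟩, ⟨hx, -⟩, rfl⟩
      simp only [hill]
      rw [sun, hgi, <- sun, <- sun, hx.2]) tf
    omega
  have hC2 : C2.ncard <= 8 := by
    rcases C2.eq_empty_or_nonempty with h0 | ⟨x, hx, hx'⟩
    · rw [h0]; simp
    · refine ride (bee (fun y => x * y) ?_ (fun x _ y _ h => river h) tf) hC1
      rintro y ⟨hy, hy'⟩
      have := km _ _ _ _ hzc hx' hy'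
      rw [hzz, tin] at this
      exact ⟨by rw [hdm, hx, hy, tin], this⟩
  have hS1 : (S : Set G2).ncard = 16 := hSc
  have hN : 96 <= Nc.ncard := by
    have h1 := hinj S (fun y h => hS.det _ h)
    rw [hS1] at h1
    refine h1.symm.le.trans (sky ?_ tf)
    rintro _ ⟨⟨x, i⟩, ⟨hx, -⟩, rfl⟩
    refine (hg x hx).imp (fun h => ?_) (fun h => ?_) <;> simp only
    · rw [sun, hgi, <- sun, h, sun]
    · rw [sun, hgi, <- sun, h]; group
  have hSC : (S : Set G2) = C1 ∪ C2 := by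
    refine Set.eq_of_subset_of_ncard_le (fun x hx => (hg x hx).imp (fun h => ⟨hS.det _ hx, h⟩) (fun h => ⟨hS.det _ hx, h⟩)) ?_ tf
    have := team C1 C2
    omega
  have hSeq : ∀ y ∈ Nc, lid y.1 = 1 -> y ∈ S := fun y hy hd => by
    change y ∈ (S : Set G2)
    rw [hSC]; exact hy.imp (fun h => ⟨hd, h⟩) (fun h => ⟨hd, h⟩)
  set Y : Set G2 := {a | a ∈ S /\ a * c = z * (c * a)}
  have hY : Y.ncard = 8 := by
    have h1 := sky (s := Y) (t := C2) (fun y hy => ⟨hS.det _ hy.1, hy.2⟩) tf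
    have h2 := sky (s := (S : Set G2)) (t := C1 ∪ Y) (fun x hx => (hg x hx).imp (fun h => ⟨hS.det _ hx, h⟩) (fun h => ⟨hx, h⟩)) tf
    have := team C1 Y
    omega
  have hYX : Y ⊆ X := by
    rintro a ⟨ha, ha'⟩
    refine ⟨ha, hcs a (hS.det _ ha) fun t ht => ?_⟩
    have h1 := van Units.val (km _ _ _ _ hzc ha' ha')
    rw [hzz, tin, pig, pig, pig, pig, ht, sub_mul, crime, men, boat, men, boat, tin, box, sub_left_inj] at h1
    by_contra h0
    have h2 : a * c = c * a := goal (smul_right_injective _ h0 h1)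
    rw [ha', fresh] at h2
    exact hz1 h2
  have hXY : ∀ a ∈ X, a ∈ Y \/ a = c \/ a = z * c := fun a ha => by
    rcases hg a ha.1 with h | h
    · exact horse (hxe a c (hS.det _ (cab ha.1 hc)) ha.2 hcc h)
    · exact rice ⟨ha.1, h⟩
  have hX10 : X.ncard <= 10 := om
  have hsum := dsum13 (Y ×ˢ X) 48 (fun ab hab => hn48 _ (hYX hab.1).2)
  have h8 : ∀ y ∈ Nc, 2 + 6 <= {ab : G2 × G2 | ab ∈ Y ×ˢ X /\ ab.2 * y = y * ab.1}.ncard := by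
    intro y hy
    obtain ⟨k, k1, k2, -, hky⟩ := hk y hy
    rw [show 2 + 6 = Y.ncard from hY.symm, <- nice Y (f := fun a => (a, y * a * y~i)) (fun a b h => van Prod.fst h)]
    refine sky ?_ tf
    rintro _ ⟨a, ha, rfl⟩
    have e1 := km _ _ _ _ k1 (km _ _ _ _ hzc hky ha.2) (ki k y k1 k2 hky)
    rw [k1 z, <- sun k k z, k2, tin] at e1
    refine ⟨⟨ha, hYX ⟨hSeq _ (horse e1) ?_, e1⟩⟩, by simp only; group⟩
    rw [hdm, hdm, hS.det _ ha.1, box, <- hdm, soul]; simp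
  have := wt13 _ 3840 2 6 (hsum.trans (car 48 (show _ <= 80 by rw [wife, hY]; omega))) (play 2 S) Nc ?_ h8
  · omega
  intro y hy
  obtain ⟨a, ha, b, hb, h⟩ := hEX hy
  have hpair : ∀ a ∈ Y, ∀ b ∈ X, b * y = y * a -> 2 <= {ab : G2 × G2 | ab ∈ Y ×ˢ X /\ ab.2 * y = y * ab.1}.ncard := by
    intro a ha b hb h
    have hne : (a, b) ≠ (z * a, z * b) := fun h => hz1 (fresh.1 (van Prod.fst h).symm)
    refine (Set.ncard_pair hne).symm.le.trans (sky ?_ tf)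
    rintro _ (rfl | rfl)
    · exact ⟨⟨ha, hb⟩, h⟩
    · refine ⟨⟨⟨cab hzS ha.1, ?_⟩, cab hzS hb.1, ?_⟩, ?_⟩ <;> simp only
      · rw [sun, ha.2, <- sun c, hzc c, <- sun, <- sun, <- sun, <- sun]
      · rw [sun, <- sun b, hzc, sun, hb.2, hzz, box]
      · rw [sun, h, <- sun, <- sun, hzc]
  rcases hXY a ha with h1 | h1
  · exact hpair a h1 b hb h
  obtain ⟨k, k1, k2, k3, rfl⟩ : exists k : G2, (forall g, g * k = k * g) /\ k * k = 1 /\ (k = 1 \/ k = z) /\ a = k * c := by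
    rcases h1 with rfl | rfl
    exacts [⟨1, h1c, tin 1, rice rfl, (tin _).symm⟩, ⟨z, hzc, hzz, horse rfl, rfl⟩]
  rcases hXY b hb with h2 | h2
  · have hy' : y * c = k * (b * y) := by rw [h, <- sun, <- k1 y, sun, <- sun k, k2, tin]
    have e1 : y~i * c * y * c = z * (c * (y~i * c * y)) := by
      have e2 : c = k * (y~i * b * y) := by
        rw [<- sun, <- sun, <- k1, sun y~i, sun, sun, <- hy']; group
      have e3 := hzc c
      have e4 : b * c = z * (c * b) := h2.2
      calc y~i * c * y * c = y~i * c * y * (k * (y~i * b * y)) := by rw [<- e2]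
        _ = (y~i * c * y * k) * (y~i * b * y) := by group
        _ = k * (y~i * (c * b) * y) := by rw [k1]; group
        _ = k * (y~i * ((z * z) * (c * b)) * y) := by rw [hzz, tin]
        _ = k * ((y~i * z) * (z * (c * b)) * y) := by group
        _ = k * z * (y~i * (b * c) * y) := by rw [hzc, <- e4]; group
        _ = z * (k * (y~i * b * y) * (y~i * c * y)) := by rw [hzc]; group
        _ = _ := by rw [<- e2]
    refine hpair (y~i * c * y) ⟨hSeq _ (horse e1) ?_, e1⟩ c ⟨hc, hcc⟩ (by group)
    rw [hdm, hdm, hS.det _ hc, box, <- hdm, inv_mul_cancel]; simp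
  · refine ride nu (h8 y ?_)
    have hy' : y * c = k * (b * y) := by rw [h, <- sun, <- k1 y, sun, <- sun k, k2, tin]
    have : y * c = k * b * y := by rw [hy', sun]
    rcases k3 with rfl | rfl <;> rcases h2 with rfl | rfl
    · left; rw [this, tin]
    · right; rw [this, tin, sun]
    · right; rw [this, sun]
    · left; rw [this, <- sun k, k2, tin]
theorem two7_13 (hq : qF = 7) : Fin13 F 2 := by
  have : Fact (coal 7) := ⟨nu⟩
  refine asmN13 7 1 (by simpa using hq) 3264 49 nu (fun _ hF2 S hS => e7two13 hq hF2 S hS)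
    (fun p _ h1 h2 h3 h4 S hS => e7three13 hq p h1 h3 h4 S hS) 3 1 1 3 (by rw [hq]; norm_num) (by rw [hq]; norm_num) ?_
  rw [hq]; norm_num
end
section
theorem ord13 (p q e : Nat) (he : e.Prime \/ e = 4) (h1 : (q : ZMod p) ^ e = 1) (h2 : (q : ZMod p) ^ (if e = 4 then 2 else 1) ≠ 1) : orderOf (q : ZMod p) = e := by
  rcases he with he | rfl
  · rw [young (by rintro rfl; revert he; norm_num), nose] at h2
    have := Fact.mk he
    exact orderOf_eq_prime h1 h2
  · have := Fact.mk kick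
    exact orderOf_eq_prime_pow (p := 2) (n := 1) (by simpa using h2) (by simpa using h1)
theorem e42_13 (hq : qF = 2) : exists S0 : Sylow 3 (lip (Fin 4) F),
      ((play 3 ((S0 : Subgroup (lip (Fin 4) F)).map (drive F 4))).ncard) <= 3384 := by
  have : Fact (coal 3) := ⟨nu⟩
  have hf : Finite (E4)ˣ := owl
  have hch : CharP F 2 := by
    have := sell F
    have : Fact (coal 2) := ⟨nu⟩
    exact sour (by rw [<- cup]; exact hq)
  have h2 : (1 : F) + 1 = 0 := CharTwo.add_self_eq_zero 1
  have hneg : (-1 : F) = 1 := CharTwo.neg_eq 1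
  have h3 : ((3 : Nat) : F) ≠ 0 := by push_cast; rw [show (3 : F) = 1 by linear_combination h2]; exact one_ne_zero
  have hq3 : ndv 3 := by rw [hq]; norm_num
  have ho : orderOf (qF : ZMod 3) = 2 := by rw [hq]; exact ord13 3 2 2 (rice kick) (by decide) (by decide)
  let g : lip (Fin 4) F := ⟨!![0,1,0,0;1,1,0,0;0,0,1,0;0,0,0,1], by
    simp [Matrix.det_succ_row_zero, judge, Fin.succAbove]; exact hneg⟩
  have hg3 : g ^ 3 = 1 := by
    apply beef
    rw [ocean, gun]
    change !![0,1,0,0;1,1,0,0;0,0,1,0;0,0,0,(1:F)] * !![0,1,0,0;1,1,0,0;0,0,1,0;0,0,0,(1:F)] * !![0,1,0,0;1,1,0,0;0,0,1,0;0,0,0,(1:F)] = 1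
    ext i j
    fin_cases i <;> fin_cases j <;> simp [Matrix.mul_apply, judge, h2]
  obtain ⟨S0, hS0⟩ := IsPGroup.exists_le_sylow (p := 3) (P := goat g) (by
    rintro ⟨y, hy⟩
    refine ⟨1, beef ?_⟩
    obtain ⟨i, rfl⟩ := wheel.1 hy
    change (g ^ i) ^ (3 ^ 1) = 1
    rw [nose, <- cop, <- _root_.zpow_mul, bid, _root_.zpow_mul, cop, hg3, _root_.one_zpow])
  refine ⟨S0, ?_⟩
  have hS := wall 3 S0
  have hx : drive F 4 g ∈ (S0 : Subgroup (lip (Fin 4) F)).map (drive F 4) := Subgroup.mem_map_of_mem _ (hS0 (mad g))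
  generalize (S0 : Subgroup (lip (Fin 4) F)).map (drive F 4) = S at *
  have hM : drive F 4 g ∈ bean 3 S := by
    refine ⟨hx, ?_, ?_⟩
    · rw [<- ice, <- rich, hg3, tank]; rfl
    · rw [ho]
      let φ : (Fin 2 -> F) →ₗ[F] (Fin 4 -> F) := (!![1,0;0,1;0,0;0,0] : Matrix (Fin 4) (Fin 2) F).mulVecLin
      have hr : red ((drive F 4 g).1 - 1) = red φ := by
        have e : forall v : Fin 4 -> F, ((drive F 4 g).1 - 1) v = g.1 *ᵥ v - v := fun v => rfl
        ext w
        constructor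
        · rintro ⟨v, rfl⟩
          refine ⟨![-v 0 + v 1, v 0], ?_⟩
          rw [e]
          ext i
          fin_cases i <;> simp [φ, g, Matrix.mulVec, dotProduct, judge]
          ring
        · rintro ⟨v, rfl⟩
          refine ⟨![v 1, v 0 + v 1, 0, 0], ?_⟩
          rw [e]
          ext i
          fin_cases i <;> simp [φ, g, Matrix.mulVec, dotProduct, judge]
      rw [hr, LinearMap.finrank_range_of_inj, toe]
      intro u v h
      have h0 := congrFun h 0
      have h1 := congrFun h 1
      simp [φ, Matrix.mulVec, dotProduct, judge] at h0 h1
      ext i; fin_cases i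
      exacts [h0, h1]
  have g1 : bus 2 1 2 = 6 := by simp [bus, rat]
  have g2 : bus 2 2 2 = 3 := by simp [bus, rat]
  have g3 : bus 2 2 4 = 180 := by simp [bus, rat]
  have g0 : bus 2 1 0 = 1 := by simp [bus]
  have hsub := dress 3 nu nu h3 hq3 (by rw [hq]; norm_num) S hS.pg 2 ho 180 (by
    intro l hl hle
    obtain rfl : l = 2 := om
    rw [hq, show 4 - 2 * 2 = 0 from rfl, g0, show 2 * 2 = 4 from rfl, g3])
  have hmf := coat 3 nu h3 hq3 S
  have hcd : cat S = 9 := by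
    have := valley nu 3 hq3 S hS
    rw [hq] at this
    norm_num [rat] at this
    rw [show 315 = 3 ^ 2 * 35 from rfl, bow.mul nu nu, bow.prime_pow, bow.eq_zero_of_not_dvd nu] at this
    simpa using this
  set A : Set (E4)ˣ := {a | a ∈ S /\ a ∉ hat (E4)ˣ /\ a ^ 3 ∈ hat (E4)ˣ /\ {y | a * y = y * a}.ncard <= 180 /\ a ∉ bean 3 S}
  set x := drive F 4 g
  have hx1 : x ≠ 1 := fun h => (hmf x hM).1 (h ▸ horn _)
  have hx2 := (hmf x hM).2.2.1 2 nu nu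
  have hA : A.ncard <= 6 := by
    have h := frog S (insert 1 (insert x (insert (x ^ 2) A))) (by
      rintro y (rfl | rfl | rfl | h)
      exacts [horn _, hM.1, hx2.1, h.1])
    rw [tiger _ tf, tiger _ tf, tiger (fun h => h.2.2.2.2 hx2) tf] at h
    · omega
    · rintro (h | h)
      · exact hx1 (mul_eq_left.1 (by rw [<- gun, <- h]))
      · exact h.2.2.2.2 hM
    · rintro (h | h | h)
      · exact hx1 h.symm
      · exact (hmf _ hx2).1 (h ▸ horn _)
      · exact h.2.1 (horn _)
  have hcA := milk 3 A 180 (by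
    rintro a ⟨h1, h2, h3, h4, h5⟩
    refine ⟨h2, h3, fun i h0 hi => ⟨S.pow_mem h1 i, fun h => h2 (gate 3 a h3 i h0 hi h), ?_, ?_, ?_⟩, h4⟩
    · rw [<- leg, bid, leg]; exact pound _ h3 _
    · exact ride (sky (fun y hy => deep 3 a h3 i h0 hi y hy) tf) h4
    · intro hm
      apply h5
      have h6 := (hmf _ hm).2.2.1 i h0 hi
      interval_cases i
      · simpa using hm
      · have h7 := hm.2.1
        rw [<- leg, show 2 * 2 = 3 + 1 from rfl, ocean] at h6
        have h8 : a ^ 3 = 1 := by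
          obtain ⟨c, hc⟩ := (moon _).1 h3
          have hc0 : c = 1 := by
            have : c ≠ 0 := by
              rintro rfl
              exact (a ^ 3).ne_zero (by rw [hc, wrist])
            have := sell F
            have h9 := buy c ‹_›
            rw [<- cup, hq] at h9
            simpa using h9
          exact goal (by rw [hc, hc0, beach]; rfl)
        rwa [h8, tin] at h6)
  have hcM := quiet 3 nu h3 hq3 S
  have hMc := house 3 nu h3 hq3 S hS.pg
  rw [ho, toe] at hMc
  rw [ho, hq, g1, g2] at hcM
  have hfin := (sky (s := play 3 S) (t := {y | ∃ a ∈ bean 3 S, ∃ b ∈ bean 3 S, b * y = y * a} ∪ {y | ∃ a ∈ A, ∃ b ∈ A, b * y = y * a}) (fun y hy =>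
    (hsub y hy).imp_right fun ⟨a, ha, b, hb, h, h4, h5, h6, h7⟩ => by
      have hs := gold h 3
      refine ⟨a, ⟨ha, h4, h5, h6, h7⟩, b, ⟨hb, hs.1 h4, by rw [hs.2.1 h5]; exact h5, hs.2.2.trans h6, fun hm => h7 ⟨ha, ?_, ?_⟩⟩, h⟩
      · rw [<- ice, <- hs.2.1 h5, ice, hm.2.1]
      · have := loud h 1
        rw [beach, beach] at this
        rw [<- this, hm.2.2]) tf).trans (team _ _)
  have h10 := car 180 (tea hA 2)
  have h11 := car (6 * 3) (tea hMc 2)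
  norm_num at h10 h11 hcA hcM
  omega
theorem four2_13 (hq : cat F = 2) : Fin13 F 4 := by
  intro H
  have : Fact (coal 2) := ⟨nu⟩
  have hch : CharP F 2 := by
    have := sell F
    exact sour (by rw [<- cup]; exact hq)
  have h357 : forall p, p.Prime -> p ∣ cat (cow (Fin 4) F) -> p ≠ 2 -> p = 3 \/ p = 5 \/ p = 7 := by
    intro p hp hd h2
    have h1 := hd.trans (Subgroup.card_quotient_dvd_card (hat (lip (Fin 4) F)))
    have h3 := slcard13 (F := F) (n := 4) nu
    rw [snake, hq] at h3
    norm_num [rat] at h3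
    rw [h3, show 20160 = 2 ^ 6 * (3 ^ 2 * (5 * 7)) from rfl, hp.dvd_mul, hp.dvd_mul, hp.dvd_mul] at h1
    have e : forall r, r.Prime -> p ∣ r -> p = r := fun r hr h => (pot hp hr).1 h
    rcases h1 with h | h | h | h
    exacts [absurd (e 2 kick (hp.dvd_of_dvd_pow h)) h2, rice (e 3 nu (hp.dvd_of_dvd_pow h)), horse (rice (e 5 nu h)), horse (horse (e 7 nu h))]
  have g0 : bus 2 1 0 = 1 := by simp [bus]
  have g1 : bus 2 1 1 = 1 := by simp [bus]
  have g4 : bus 2 4 4 = 15 := by simp [bus]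
  have g3 : bus 2 3 3 = 7 := by simp [bus]
  refine red13 nu 2 1 (by rw [hq]; norm_num) H (fun p => if p = 3 then 3384 else 60) ?_ ?_
  · intro p hp hd h2
    have hpF : forall m, p = 2 * m + 1 -> (p : F) ≠ 0 := fun m h => by
      rw [h]; push_cast; rw [show (2 : F) = 0 from CharTwo.two_eq_zero, thief, liver]; exact one_ne_zero
    rcases h357 p hp hd h2 with rfl | rfl | rfl
    · obtain ⟨S0, h⟩ := e42_13 hq
      exact ⟨S0, by rw [if_pos rfl]; exact_mod_cast h⟩
    · have : Fact (coal 5) := ⟨hp⟩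
      refine ⟨default, ?_⟩
      have h := (ebd13 (n := 4) (F := F) nu 5 nu (hpF 2 rfl) (by rw [hq]; norm_num) (by rw [hq]; norm_num) _ (wall 5 default) 4
        (by rw [hq]; exact ord13 5 2 4 (horse rfl) (by decide) (by decide)) 0 15 (by rw [hq]; norm_num) (by intros; omega)).2
      rw [hq, show 4 - 4 = 0 from rfl, g0, g4] at h
      norm_num at h ⊢
      exact h
    · have : Fact (coal 7) := ⟨hp⟩
      refine ⟨default, ?_⟩
      have h := (ebd13 (n := 4) (F := F) nu 7 nu (hpF 3 rfl) (by rw [hq]; norm_num) (by rw [hq]; norm_num) _ (wall 7 default) 3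
        (by rw [hq]; exact ord13 7 2 3 (rice nu) (by decide) (by decide)) 0 7 (by rw [hq]; norm_num) (by intros; omega)).2
      rw [hq, show 4 - 3 = 1 from rfl, g1, g3] at h
      norm_num at h ⊢
      linarith
  · refine (maid (t := {3, 5, 7}) ?_ ?_).trans_lt ?_
    · intro p hp
      rw [Finset.mem_erase, Nat.mem_primeFactors] at hp
      simpa using h357 p hp.2.1 hp.2.2.1 hp.1
    · intros; split_ifs <;> norm_num
    · rw [hq]; norm_num
end
theorem d1_13 : forall x : Matrix (Fin 2) (Fin 2) (ZMod 3), x * x = -1 -> forall y : Matrix (Fin 2) (Fin 2) (ZMod 3), y * y = -1 ->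
    (x * y) * (x * y) = -1 \/ x * y = 1 \/ x * y = -1 := by decide +kernel
theorem d2_13 : Fintype.card {x : Matrix (Fin 2) (Fin 2) (ZMod 3) // x * x = -1} = 6 := by decide +kernel
section
theorem poet {V : Type*} [AddCommGroup V] [Module F V] (a b : dog F V) : a * -b = -(a * b) := mul_neg a b
theorem song {V : Type*} [AddCommGroup V] [Module F V] (a b : dog F V) : -a * b = -(a * b) := neg_mul a b
theorem police {V : Type*} [AddCommGroup V] [Module F V] (a : dog F V) : - -a = a := neg_neg a
theorem inv13 {V : Type*} [AddCommGroup V] [Module F V] [Module.Finite F V] (hF : nz 2) (t : dog F V) (ht : t * t = 1) :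
    lid t = (-1) ^ fox F (red t~) /\ (fox F (red t~) = 0 -> t = 1) /\
      (fox F (red t~) = fox F V -> t = -1) := by
  have h1 : forall v, t (t v) = v := fun v => van (fun f : dog F V => f v) ht
  have h2 : ∀ v ∈ red t~, t v = -v := by
    rintro _ ⟨v, rfl⟩
    simp [h1]
  refine ⟨?_, fun h => ?_, fun h => ?_⟩
  · rw [LinearMap.det_eq_det_mul_det (red t~) t (fun v hv => by rw [happy, h2 v hv]; exact Submodule.neg_mem _ hv)]
    have e1 : t.restrict (fun v hv => by rw [h2 v hv]; exact Submodule.neg_mem _ hv : ∀ v ∈ red t~, t v ∈ red t~) = (-1 : F) • LinearMap.id := by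
      ext v; simpa using h2 v.1 v.2
    have e2 : (red t~).mapQ (red t~) t (fun v hv => by rw [happy, h2 v hv]; exact Submodule.neg_mem _ hv) = LinearMap.id := by
      ext v
      simp only [LinearMap.comp_apply, Submodule.mkQ_apply, Submodule.mapQ_apply, LinearMap.id_apply]
      exact (Submodule.Quotient.eq _).2 ⟨v, rfl⟩
    rw [e2, LinearMap.det_id, box]
    refine (van lid e1).trans ?_
    rw [rude, LinearMap.det_id, box]
  · rw [sand, foot] at h
    exact hip.1 h
  · have := Submodule.eq_top_of_finrank_eq h
    ext v
    simpa using h2 v (this ▸ Submodule.mem_top)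
def boy (a b c d : E2) : dog F V4 :=
  (a.comp (LinearMap.fst F _ _) + b.comp (LinearMap.snd F _ _)).prod (c.comp (LinearMap.fst F _ _) + d.comp (LinearMap.snd F _ _))
theorem pond (a b c d a' b' c' d' : E2) : boy a b c d * boy a' b' c' d' = boy (a * a' + b * c') (a * b' + b * d') (c * a' + d * c') (c * b' + d * d') := by
  refine fish fun ⟨v, w⟩ => Prod.ext ?_ ?_ <;> simp [boy] <;> abel
theorem lily : boy (1 : E2) 0 0 1 = 1 := by
  refine fish fun ⟨v, w⟩ => Prod.ext ?_ ?_ <;> simp [boy]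
theorem loan : boy (-1 : E2) 0 0 (-1) = -1 := by
  refine fish fun ⟨v, w⟩ => Prod.ext ?_ ?_ <;> simp [boy]
theorem corn (a b c d a' b' c' d' : E2) : boy a b c d = boy a' b' c' d' ↔ a = a' /\ b = b' /\ c = c' /\ d = d' := by
  constructor
  · intro h
    have h1 : forall v w, boy a b c d (v, w) = boy a' b' c' d' (v, w) := fun v w => by rw [h]
    have h1 : forall v w, a v + b w = a' v + b' w /\ c v + d w = c' v + d' w := fun v w => ⟨van Prod.fst (h1 v w), van Prod.snd (h1 v w)⟩
    refine ⟨fish fun v => ?_, fish fun v => ?_, fish fun v => ?_, fish fun v => ?_⟩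
    · simpa using (h1 v 0).1
    · simpa using (h1 0 v).1
    · simpa using (h1 v 0).2
    · simpa using (h1 0 v).2
  · rintro ⟨rfl, rfl, rfl, rfl⟩; rfl
def iron (a d : G2) : GV := ⟨boy a 0 0 d, boy a~i.1 0 0 d~i.1, by simp [pond, lily], by simp [pond, lily]⟩
def cook (a d : G2) : GV := ⟨boy 0 a d 0, boy 0 d~i.1 a~i.1 0, by simp [pond, lily], by simp [pond, lily]⟩
def dance (a b d : G2) : GV := ⟨boy a b 0 d, boy a~i.1 (-(a~i.1 * b * d~i.1)) 0 d~i.1, by simp [pond, lily, poet, <- sun], by simp [pond, lily, song, sun]⟩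
theorem dd13 (a d a' d' : G2) : iron a d * iron a' d' = iron (a * a') (d * d') := goal (by simp [iron, pond])
theorem ds13 (a d a' d' : G2) : iron a d * cook a' d' = cook (a * a') (d * d') := goal (by simp [iron, cook, pond])
theorem sdd13 (a d a' d' : G2) : cook a d * iron a' d' = cook (a * d') (d * a') := goal (by simp [iron, cook, pond])
theorem ss13 (a d a' d' : G2) : cook a d * cook a' d' = iron (a * d') (d * a') := goal (by simp [iron, cook, pond])
theorem bear (a : G2) : a.1 ≠ 0 := fun h => by
  have := a.mul_inv
  rw [h, thief] at this
  exact ship this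
theorem movie {a d a' d' : G2} (h : iron a d = iron a' d') : a = a' /\ d = d' := by
  have := (corn ..).1 (van Units.val h)
  exact ⟨goal this.1, goal this.2.2.2⟩
theorem sd_inj13 {a d a' d' : G2} (h : cook a d = cook a' d') : a = a' /\ d = d' := by
  have := (corn ..).1 (van Units.val h)
  exact ⟨goal this.2.1, goal this.2.2.1⟩
theorem photo {a d a' d' : G2} : iron a d ≠ cook a' d' := fun h =>
  bear _ ((corn ..).1 (van Units.val h)).1
def beer (P : Subgroup G2) : Subgroup GV where
  carrier := {t | ∃ a ∈ P, ∃ d ∈ P, t = iron a d \/ t = cook a d}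
  one_mem' := ⟨1, horn _, 1, horn _, rice (goal (by simp [iron, lily]))⟩
  mul_mem' := by
    rintro _ _ ⟨a, ha, d, hd, rfl | rfl⟩ ⟨a', ha', d', hd', rfl | rfl⟩
    · exact ⟨_, cab ha ha', _, cab hd hd', rice (dd13 ..)⟩
    · exact ⟨_, cab ha ha', _, cab hd hd', horse (ds13 ..)⟩
    · exact ⟨_, cab ha hd', _, cab hd ha', horse (sdd13 ..)⟩
    · exact ⟨_, cab ha hd', _, cab hd ha', rice (ss13 ..)⟩
  inv_mem' := by
    rintro _ ⟨a, ha, d, hd, rfl | rfl⟩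
    · exact ⟨_, nurse ha, _, nurse hd, rice (goal rfl)⟩
    · exact ⟨_, nurse hd, _, nurse ha, horse (goal rfl)⟩
theorem wr_card13 (P : Subgroup G2) : cat (beer P) = 2 * cat P ^ 2 := by
  have hb : Function.Bijective (fun x : Bool × P × P => (⟨if x.1 then iron x.2.1 x.2.2 else cook x.2.1 x.2.2, x.2.1, x.2.1.2, x.2.2, x.2.2.2, by
      rcases x.1 with _ | _; exacts [horse rfl, rice rfl]⟩ : beer P)) := by
    constructor
    · rintro ⟨i, a, d⟩ ⟨i', a', d'⟩ h
      have h := van shop h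
      rcases i with _ | _ <;> rcases i' with _ | _
      · have := sd_inj13 h; exact Prod.ext rfl (Prod.ext (beef this.1) (beef this.2))
      · exact absurd h.symm photo
      · exact absurd h photo
      · have := movie h; exact Prod.ext rfl (Prod.ext (beef this.1) (beef this.2))
    · rintro ⟨_, a, ha, d, hd, rfl | rfl⟩
      · exact ⟨(true, ⟨a, ha⟩, ⟨d, hd⟩), rfl⟩
      · exact ⟨(false, ⟨a, ha⟩, ⟨d, hd⟩), rfl⟩
  rw [<- ball (Equiv.ofBijective _ hb), uncle, uncle]
  simp [gun]
def debt : Set G2 := {x | x.1 * x.1 = -1}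
theorem phi13 (h3 : qF = 3) : Nonempty (E2 ≃+* Matrix (Fin 2) (Fin 2) (ZMod 3)) := by
  have := sell F
  have e := ZMod.ringEquivOfPrime F face (by rw [<- cup, h3])
  exact ⟨((LinearMap.toMatrixAlgEquiv' (R := F) (n := Fin 2)).toRingEquiv).trans e.symm.mapMatrix⟩
theorem brown (h3 : cat F = 3) : (debt (F := F)).ncard = 6 := by
  obtain ⟨φ⟩ := phi13 h3
  rw [<- jaw, <- d2_13, <- cup]
  refine ball ⟨fun x => ⟨φ x.1.1, by rw [<- pan, x.2, ankle, tank]⟩, fun x => ⟨⟨φ.symm x.1, -φ.symm x.1, ?_, ?_⟩, ?_⟩, fun x => ?_, fun x => ?_⟩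
  · rw [poet, <- pan, x.2, ankle, tank, police]
  · rw [song, <- pan, x.2, ankle, tank, police]
  · show φ.symm x.1 * φ.symm x.1 = -1
    rw [<- pan, x.2, ankle, tank]
  · exact beef (goal sm)
  · simp
theorem Xmul13 (h3 : qF = 3) (x y : G2) (hx : x ∈ debt) (hy : y ∈ debt) : x * y ∈ debt \/ (x * y).1 = 1 \/ (x * y).1 = -1 := by
  obtain ⟨φ⟩ := phi13 h3
  have := d1_13 (φ x.1) (by rw [<- pan, hx, ankle, tank]) (φ y.1) (by rw [<- pan, hy, ankle, tank])
  rw [<- pan, <- pan, <- tank φ, <- ankle, φ.injective.eq_iff, φ.injective.eq_iff, φ.injective.eq_iff] at this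
  exact this
def wine (h3 : qF = 3) : Subgroup G2 where
  carrier := {x | x ∈ debt \/ x.1 = 1 \/ x.1 = -1}
  one_mem' := horse (rice rfl)
  mul_mem' := by
    rintro x y (hx | hx | hx) (hy | hy | hy)
    · exact Xmul13 h3 x y hx hy
    all_goals simp only [debt, hill, pig] at *
    all_goals simp [hx, hy, poet, song, police]
  inv_mem' := by
    rintro x (hx | hx | hx)
    · left
      have h1 : x~i.1 = -x.1 := by
        rw [<- box x~i.1, <- police (1 : E2), <- (show x.1 * x.1 = -1 from hx), poet, <- sun, Units.inv_mul, tin]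
      show x~i.1 * x~i.1 = -1
      rw [h1, poet, song, police]; exact hx
    · right; left
      rw [<- box x~i.1, <- hx, Units.inv_mul, hx]
    · right; right
      rw [<- box x~i.1, <- police (1 : E2), <- hx, poet, Units.inv_mul, hx, police]
theorem sport (h3 : cat F = 3) : cat (wine h3) = 2 ^ 3 := by
  have : Finite G2 := owl
  have hF2 : (2 : F) ≠ 0 := (blue (F := F) (hr := ⟨face⟩) 3 1 (by rw [h3]; norm_num) nu).2
  let n : G2 := ⟨-1, -1, by simp [poet, police], by simp [poet, police]⟩
  have h11 : (1 : E2) ≠ -1 := fun h => hF2 (by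
    have := congrFun (tub h 1) 0
    simp at this; linear_combination this)
  have e : ((wine h3 : Subgroup G2) : Set G2) = insert 1 (insert n debt) := by
    ext x
    show (x ∈ debt \/ x.1 = 1 \/ x.1 = -1) ↔ (x = 1 \/ x = n \/ x ∈ debt)
    rw [ton, ton]
    tauto
  rw [<- SetLike.coe_sort_coe, jaw, e, tiger, tiger, brown h3]
  · norm_num
  · intro h
    have h : (-1 : E2) * -1 = -1 := h
    rw [poet, box, police] at h; exact h11 h
  · intro h
    rcases Set.mem_insert_iff.1 h with h | h
    · exact h11 (van Units.val h)
    · have h : (1 : E2) * 1 = -1 := h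
      rw [box] at h; exact h11 h
end
section
def walk (P : Subgroup G2) : Set GV := {t | t ∈ beer P /\ t.1 * t.1 = -1}
def crab (P : Subgroup G2) : Set GV := {t | t ∈ beer P /\ lid t.1 = 1 /\ t.1 * t.1 = 1 /\ t.1 ≠ 1 /\ t.1 ≠ -1}
theorem det_dg13 (a d : G2) : lid (iron a d).1 = lid a.1 * lid d.1 := by
  rw [<- LinearMap.det_prodMap]
  congr 1
  refine fish fun ⟨v, w⟩ => Prod.ext ?_ ?_ <;> simp [boy, iron]
theorem A1c13 (h3 : qF = 3) (P : Subgroup G2) (hP : cat P = 16) : (walk P).ncard <= 52 := by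
  have hf : Finite GV := owl
  have hf : Finite G2 := owl
  let n : G2 := ⟨-1, -1, by simp [poet, police], by simp [poet, police]⟩
  have hs : walk P ⊆ (fun x : G2 × G2 => iron x.1 x.2) '' (debt ×ˢ debt) ∪ (fun a => cook a (a~i * n)) '' (P : Set G2) := by
    rintro _ ⟨⟨a, ha, d, hd, rfl | rfl⟩, h⟩
    · rw [<- pig, dd13, <- loan] at h
      have h := (corn ..).1 h
      exact rice ⟨(a, d), ⟨h.1, h.2.2.2⟩, rfl⟩
    · rw [<- pig, ss13, <- loan] at h
      have h := (corn ..).1 h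
      have h1 : a * d = n := goal h.1
      exact horse ⟨a, ha, by simp only; rw [<- h1, king]⟩
  refine (sky hs tf).trans ((team _ _).trans ?_)
  have h1 := salad (f := fun x : G2 × G2 => iron x.1 x.2) (ant (debt ×ˢ debt))
  have h2 := salad (f := fun a => cook a (a~i * n)) (ant (P : Set G2))
  rw [wife, brown h3] at h1
  rw [<- jaw (P : Set G2)] at h2
  change _ <= cat P at h2
  omega
theorem A2c13 (h3 : qF = 3) (P : Subgroup G2) (hP : cat P = 16) (hF2 : nz 2) : (crab P).ncard <= 34 := by
  have hf : Finite GV := owl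
  have hf : Finite G2 := owl
  let n : G2 := ⟨-1, -1, by simp [poet, police], by simp [poet, police]⟩
  have hm : (-1 : F) ≠ 1 := fun h => hF2 (by linear_combination -h)
  have key : ∀ a ∈ P, a.1 * a.1 = 1 -> (a = 1 /\ lid a.1 = 1) \/ (a = n /\ lid a.1 = 1) \/ (a ∈ meat P /\ lid a.1 = -1) := by
    intro a ha h
    obtain ⟨h1, h2, h4⟩ := inv13 hF2 a.1 h
    have h5 := Submodule.finrank_le (red (a.1 - 1))
    rw [toe] at h4 h5
    obtain h6 | h6 | h6 : fox F (red (a.1 - 1)) = 0 \/ fox F (red (a.1 - 1)) = 1 \/ fox F (red (a.1 - 1)) = 2 := om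
    · exact rice ⟨goal (h2 h6), by rw [h1, h6, pow_zero]⟩
    · exact horse (horse ⟨⟨ha, by rw [gun, h], h6⟩, by rw [h1, h6, nose]⟩)
    · exact horse (rice ⟨goal (h4 h6), by rw [h1, h6]; norm_num⟩)
  have hs : crab P ⊆ ({iron 1 n, iron n 1} ∪ (fun x : G2 × G2 => iron x.1 x.2) '' (meat P ×ˢ meat P)) ∪ (fun a => cook a a~i) '' (P : Set G2) := by
    rintro _ ⟨⟨a, ha, d, hd, rfl | rfl⟩, hdet, h, h1, h2⟩
    · rw [<- pig, dd13, <- lily] at h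
      have h := (corn ..).1 h
      rw [det_dg13] at hdet
      left
      obtain ⟨h5, h6⟩ | ⟨h5, h6⟩ | ⟨h5, h6⟩ := key a ha h.1 <;> obtain ⟨h7, h8⟩ | ⟨h7, h8⟩ | ⟨h7, h8⟩ := key d hd h.2.2.2 <;> rw [h6, h8] at hdet
      · exact absurd (by rw [h5, h7]; exact lily) h1
      · rw [h5, h7]; exact rice (rice rfl)
      · exact absurd (by simpa using hdet) hm
      · rw [h5, h7]; exact rice (horse rfl)
      · exact absurd (by rw [h5, h7]; exact loan) h2
      · exact absurd (by simpa using hdet) hm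
      · exact absurd (by simpa using hdet) hm
      · exact absurd (by simpa using hdet) hm
      · exact horse ⟨(a, d), ⟨h5, h7⟩, rfl⟩
    · rw [<- pig, ss13, <- lily] at h
      have h := (corn ..).1 h
      have h1 : a * d = 1 := goal h.1
      exact horse ⟨a, ha, by simp only; rw [inv_eq_of_mul_eq_one_right h1]⟩
  refine (sky hs tf).trans ((team _ _).trans ((room (team _ _) _).trans ?_))
  have h1 := salad (f := fun x : G2 × G2 => iron x.1 x.2) (ant (meat P ×ˢ meat P))
  have h2 := salad (f := fun a => cook a a~i) (ant (P : Set G2))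
  have h4 := bowl hF2 P (IsPGroup.of_card (n := 4) (by rw [hP]; norm_num)) (by rw [h3]; norm_num)
  rw [h3, toe] at h4
  have h5 : (meat P).ncard * (meat P).ncard <= 4 * 4 := bed om om
  have h6 := cake (iron 1 n) {iron n (1 : G2)}
  rw [angry] at h6
  rw [wife] at h1
  rw [<- jaw (P : Set G2)] at h2
  change _ <= cat P at h2
  omega
def rent (i : Bool) : GV := if i then cook 1 1 else 1
theorem D13 (h3 : qF = 3) : 442368 <= (Set.range fun x : (Bool × Bool) × G2 × G2 × G2 => rent x.1.1 * dance x.2.1 x.2.2.1 x.2.2.2 * rent x.1.2).ncard := by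
  have hf : Finite GV := owl
  have hf : Finite G2 := owl
  have hg : cat G2 = 48 := by rw [thick, snake, h3]; norm_num [rat]
  have hi : park fun x : (Bool × Bool) × G2 × G2 × G2 => rent x.1.1 * dance x.2.1 x.2.2.1 x.2.2.2 * rent x.1.2 := by
    have e : ∀ i j (a b d : G2), (rent i * dance a b d * rent j).1 = bif i then (bif j then boy d 0 b a else boy 0 d a b) else (bif j then boy b a d 0 else boy a b 0 d) := by
      intro i j a b d
      cases i <;> cases j <;> simp [rent, dance, cook, pond]
    rintro ⟨⟨i, j⟩, a, b, d⟩ ⟨⟨i', j'⟩, a', b', d'⟩ h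
    have h := van Units.val h
    simp only [e] at h
    cases i <;> cases j <;> cases i' <;> cases j' <;> simp only [cond_true, cond_false, corn] at h <;> obtain ⟨h1, h2, h4, h5⟩ := h <;>
      first
      | exact absurd h1 (bear _)
      | exact absurd h1.symm (bear _)
      | exact absurd h2 (bear _)
      | exact absurd h2.symm (bear _)
      | exact absurd h4 (bear _)
      | exact absurd h4.symm (bear _)
      | exact absurd h5 (bear _)
      | exact absurd h5.symm (bear _)
      | (simp only [Prod.mk.injEq, ton, h1, h2, h4, h5, and_self, true_and])
  rw [<- Set.image_univ, nice _ hi, Set.ncard_univ, uncle, uncle, uncle, uncle, hg]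
  simp
end
section
open scoped Pointwise
theorem cj13 {V : Type*} [AddCommGroup V] [Module F V] (g h : (dog F V)ˣ) (hh : h.1 * h.1 = -1) : (g * h * g~i).1 * (g * h * g~i).1 = -1 := by
  rw [<- pig, show g * h * g~i * (g * h * g~i) = g * (h * h) * g~i by group, pig, pig, pig, hh, poet, song, box, ounce]
theorem ns13 {V : Type*} [AddCommGroup V] [Module F V] (a : dog F V) : (-1 : F) • a = -a := neg_one_smul F a
theorem six13 (h3 : qF = 3) (P : Subgroup G2) (hP : debt ⊆ (P : Set G2)) (y : GV)
    (hy : y ∈ Set.range fun x : (Bool × Bool) × G2 × G2 × G2 => rent x.1.1 * dance x.2.1 x.2.2.1 x.2.2.2 * rent x.1.2) :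
    6 <= {ab : GV × GV | ab ∈ walk P ×ˢ walk P /\ ab.2 * y = y * ab.1}.ncard := by
  have hf : Finite GV := owl
  obtain ⟨⟨⟨i, j⟩, a, b, d⟩, rfl⟩ := hy
  rw [<- brown h3]
  have hs : forall i, rent i ∈ beer P := fun i => by
    rcases i with _ | _
    exacts [horn _, ⟨1, horn _, 1, horn _, horse rfl⟩]
  have hA : ∀ x ∈ debt, ∀ y ∈ debt, iron x y ∈ walk P := fun x hx y hy => ⟨⟨x, hP hx, y, hP hy, rice rfl⟩, by
    rw [<- pig, dd13, <- loan]; exact (corn ..).2 ⟨hx, rfl, rfl, hy⟩⟩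
  have hc : ∀ s ∈ beer P, ∀ t ∈ walk P, s * t * s~i ∈ walk P := fun s hs t ht => ⟨cab (cab hs ht.1) (nurse hs), cj13 s t ht.2⟩
  refine bee (fun h => ((rent j)~i * iron (a~i * h * a~i~i) (b~i * h * b~i~i) * (rent j)~i~i,
    rent i * iron h ((d * b~i) * h * (d * b~i)~i) * (rent i)~i)) ?_ ?_ tf
  · intro h hh
    refine ⟨⟨hc _ (nurse (hs j)) _ (hA _ (cj13 _ _ hh) _ (cj13 _ _ hh)), hc _ (hs i) _ (hA _ hh _ (cj13 _ _ hh))⟩, ?_⟩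
    have e : iron h ((d * b~i) * h * (d * b~i)~i) * dance a b d = dance a b d * iron (a~i * h * a~i~i) (b~i * h * b~i~i) := by
      refine goal ?_
      rw [pig, pig]
      simp [iron, dance, pond, sun]
    simp only
    have e2 := van (fun z => rent i * z * rent j) e
    simp only [sun, king, inv_inv, mul_inv_cancel_left] at e2 ⊢
    exact e2
  · intro h _ h' _ e
    have e := (Prod.mk.inj e).2
    exact (movie (river (star e))).1
theorem cenV13 (a : GV) (h : a ∈ hat GV) : exists c : F, a.1 = c • 1 := by
  let ei : (Fin 4 -> F) ≃ₗ[F] V4 := LinearEquiv.ofFinrankEq _ _ sm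
  let f : (dog F (Fin 4 -> F))ˣ ≃* GV := Units.mapEquiv (LinearEquiv.conjRingEquiv ei).toMulEquiv
  obtain ⟨g, rfl⟩ := f.surjective a
  obtain ⟨c, hc⟩ := (moon _).1 ((truck f g).1 h)
  refine ⟨c, fish fun v => ?_⟩
  show ei (g.1 (ei.symm v)) = c • v
  rw [hc]; simp
theorem e43_13 (h3 : cat F = 3) (S : Subgroup (dog F (Fin 4 -> F))ˣ) (hS : lady 2 S) : (play 2 S).ncard <= 8234496 := by
  have hf4 : Finite GV := owl
  have hf2 : Finite G2 := owl
  have hf : Finite (dog F (Fin 4 -> F))ˣ := owl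
  have h2p : Fact (coal 2) := ⟨kick⟩
  have hF2 : (2 : F) ≠ 0 := (blue (F := F) (hr := ⟨face⟩) 3 1 (by rw [h3]; norm_num) nu).2
  have pv : forall a b c : Nat, c = 2 ^ a * b -> ¬ 2 ∣ b -> c.factorization 2 = a := fun a b c h hb => by
    have hb0 : b ≠ 0 := fun h0 => hb (h0 ▸ dvd_zero 2)
    rw [Nat.factorization_def _ kick, h, bow.mul pz hb0, bow.prime_pow, bow.eq_zero_of_not_dvd hb, tooth]
  have hg : cat G2 = 48 := by rw [thick, snake, h3]; norm_num [rat]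
  let ei : (Fin 4 -> F) ≃ₗ[F] V4 := LinearEquiv.ofFinrankEq _ _ sm
  let f : (dog F (Fin 4 -> F))ˣ ≃* GV := Units.mapEquiv (LinearEquiv.conjRingEquiv ei).toMulEquiv
  have hgV : cat GV = 24261120 := by
    rw [<- ball f.toEquiv, thick, snake, h3]; norm_num [rat]
  obtain ⟨P0, hP0⟩ := (IsPGroup.of_card (sport h3)).exists_le_sylow
  have hPc := P0.card_eq_multiplicity
  obtain ⟨P, hPP⟩ : exists P : Subgroup G2, P = P0 := ⟨_, rfl⟩
  rw [<- hPP] at hP0 hPc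
  rw [hg, pv 4 3 48 rfl nu] at hPc
  norm_num at hPc
  let T : Sylow 2 GV := Sylow.ofCard (beer P) (by rw [wr_card13, hPc, hgV, pv 9 47385 24261120 rfl nu]; norm_num)
  obtain ⟨T1, hT1⟩ := (hS.pg.map f.toMonoidHom).exists_le_sylow
  obtain ⟨g, hgT⟩ := navy GV T1 T
  refine ((chair 2 S f).trans (long 2 _ g)).trans ?_
  obtain ⟨S', hS'⟩ : exists S' : Subgroup GV, S' = (S.map f.toMonoidHom).map (gray g).toMonoidHom := ⟨_, rfl⟩
  rw [<- hS']
  have hST : ∀ a ∈ S', a ∈ beer P /\ lid a.1 = 1 := by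
    rw [hS']
    rintro _ ⟨_, ⟨s, hs, rfl⟩, rfl⟩
    constructor
    · have : (T : Subgroup GV) = gray g • (T1 : Subgroup GV) := by rw [<- hgT]; rfl
      show _ ∈ (T : Subgroup GV)
      rw [this]
      exact Subgroup.smul_mem_pointwise_smul _ _ _ (hT1 ⟨s, hs, rfl⟩)
    · show lid (g * f s * g~i).1 = 1
      rw [pig, pig, pan, pan, mul_right_comm, <- pan, ounce, tank, tin]
      exact (LinearMap.det_conj s.1 ei).trans (hS.det s hs)
  clear hS' hS
  have hnP : forall x : E2, x = -1 -> exists n : G2, n.1 = -1 /\ n ∈ P := fun _ _ => ⟨⟨-1, -1, by simp [poet, police], by simp [poet, police]⟩, rfl, hP0 (horse (horse rfl))⟩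
  obtain ⟨m, hm, hmP⟩ := hnP _ rfl
  have hM : (iron m m).1 = -1 := by
    rw [<- loan]; exact (corn ..).2 ⟨hm, rfl, rfl, hm⟩
  have hMT : iron m m ∈ beer P := ⟨m, hmP, m, hmP, rice rfl⟩
  generalize iron m m = M at hM hMT
  have hM1 : M ≠ 1 := fun h => hF2 (by
    rw [h, aunt] at hM
    have := congrFun (van Prod.fst (tub hM (1, 1))) 0
    simp at this; linear_combination this)
  have hMa : forall a : GV, (M * a).1 = -a.1 := fun a => by rw [pig, hM, song, tin]
  have hMM : forall a : GV, (M * a).1 * (M * a).1 = a.1 * a.1 := fun a => by rw [hMa, song, poet, police]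
  have hMc : forall a : GV, M * a = a * M := fun a => goal (by rw [hMa, pig, hM, poet, box])
  have hA1 : ∀ a ∈ walk P, M * a ∈ walk P := fun a ha => ⟨cab hMT ha.1, by rw [hMM, ha.2]⟩
  have hfr : fox F V4 = 4 := sm
  have hA2 : ∀ a ∈ crab P, M * a ∈ crab P := fun a ha => ⟨cab hMT ha.1, by
    rw [hMa, <- ns13, rude, hfr, ha.2.1]; norm_num, by rw [hMM, ha.2.2.1],
    by rw [hMa]; exact fun h => ha.2.2.2.2 (by rw [<- h, police]), by rw [hMa]; exact fun h => ha.2.2.2.1 (neg_injective h)⟩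
  have two : forall A : Set GV, (∀ a ∈ A, M * a ∈ A) -> forall y a b, a ∈ A -> b ∈ A -> b * y = y * a -> 2 <= {ab : GV × GV | ab ∈ A ×ˢ A /\ ab.2 * y = y * ab.1}.ncard := by
    intro A hA y a b ha hb h
    refine (Set.ncard_pair (a := (a, b)) (b := (M * a, M * b)) ?_).symm.le.trans (sky ?_ tf)
    · intro h; exact hM1 (fresh.1 (Prod.mk.inj h).1.symm)
    · rintro _ (rfl | rfl)
      · exact ⟨⟨ha, hb⟩, h⟩
      · exact ⟨⟨hA a ha, hA b hb⟩, by simp only; rw [sun, h, <- sun, hMc, sun]⟩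
  have := sell GV
  have cu : forall a : GV, {y | a * y = y * a} = {y : GV | a.1 * y.1 = y.1 * a.1} := fun a => by
    ext y; rw [hill, ton]; rfl
  have k1 := dsum13 (walk P ×ˢ walk P) 5760 (by
    rintro ⟨a, b⟩ ⟨ha, -⟩
    rw [cu]
    have := small 2 a.1 (-1 : F) (by rw [gun, ha.2, ns13]) (fun c hc => ?_) (by rw [h3]; rfl)
    · rw [h3, hfr] at this
      exact this.trans (by norm_num [bus, rat])
    · have hc0 : c ≠ 0 := by rintro rfl; norm_num at hc
      have := sell F
      have h9 := buy c hc0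
      rw [<- cup, h3, hc] at h9
      exact hF2 (by linear_combination -h9))
  have k2 := dsum13 (crab P ×ˢ crab P) 2304 (by
    rintro ⟨a, b⟩ ⟨⟨-, hd, h1, h2, h4⟩, -⟩
    rw [cu]
    have := plane 2 a.1 (by rw [gun, h1]) (mod_cast hF2) (by rw [h3]; norm_num)
    obtain ⟨i1, i2, i3⟩ := inv13 hF2 a.1 h1
    have i4 := win (a.1 - 1)
    rw [hfr] at i3 i4
    rw [hd] at i1
    have hm1 : (-1 : F) ≠ 1 := fun h => hF2 (by linear_combination -h)
    have i5 : fox F (red (a.1 - 1)) = 2 := by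
      have j0 := fun h => h2 (i2 h)
      have j4 := fun h => h4 (i3 h)
      generalize fox F (red (a.1 - 1)) = k at *
      have : k <= 4 := om
      interval_cases k
      · exact absurd rfl j0
      · exact absurd (by simpa using i1.symm) hm1
      · rfl
      · exact absurd (by linear_combination -i1) hm1
      · exact absurd rfl j4
    rw [i5] at i4 this
    rw [h3, show fox F (bat (a.1 - 1)) = 2 by omega, show ((3 : Nat) : ZMod 2) = 1 from rfl, cold] at this
    exact this.trans (by norm_num [bus, rat]))
  have c1 := A1c13 h3 P hPc
  have c2 := A2c13 h3 P hPc hF2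
  have k := wt13 (fun y : GV => {ab : GV × GV | ab ∈ walk P ×ˢ walk P /\ ab.2 * y = y * ab.1}.ncard + {ab : GV × GV | ab ∈ crab P ×ˢ crab P /\ ab.2 * y = y * ab.1}.ncard) (2704 * 5760 + 1156 * 2304) 2 4
    (by rw [Finset.sum_add_distrib]; exact Nat.add_le_add (k1.trans (car _ (by rw [wife]; exact bed c1 c1))) (k2.trans (car _ (by rw [wife]; exact bed c2 c2)))) (play 2 S') _ ?_ (fun y hy => (six13 h3 P (fun x hx => hP0 (rice hx)) y hy).trans (Nat.le_add_right _ _))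
  · have c3 := D13 h3
    omega
  · rintro y ⟨a, ha, b, hb, h, hnc, hc⟩
    have hs := (gold h 2).2.1 hc
    have hn1 := (gold h 2).1 hnc
    obtain ⟨c, hcc⟩ := cenV13 _ hc
    have e1 : a.1 * a.1 = c • 1 := by rw [<- pig, <- gun, hcc]
    have e2 : b.1 * b.1 = c • 1 := by rw [<- pig, <- gun, hs, hcc]
    have hc0 : c ≠ 0 := by
      rintro rfl
      rw [wrist] at hcc
      have := (a ^ 2).mul_inv
      rw [hcc, thief] at this
      exact ship this
    have := sell F
    have h9 := buy c hc0
    rw [<- cup, h3] at h9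
    have nc : forall a : GV, a ∉ hat GV -> a.1 ≠ 1 /\ a.1 ≠ -1 := fun a ha => ⟨fun h => ha (by rw [goal (h.trans aunt.symm)]; exact horn _), fun h => ha (by
      rw [goal (h.trans hM.symm)]; exact sea.2 fun x => (hMc x).symm)⟩
    rcases sq_eq_sq_iff_eq_or_eq_neg.1 (h9.trans (sheep 2).symm) with rfl | rfl
    · rw [beach] at e1 e2
      exact (two _ hA2 y a b ⟨(hST a ha).1, (hST a ha).2, e1, nc a hnc⟩ ⟨(hST b hb).1, (hST b hb).2, e2, nc b hn1⟩ h).trans (Nat.le_add_left _ _)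
    · rw [ns13] at e1 e2
      exact (two _ hA1 y a b ⟨(hST a ha).1, e1⟩ ⟨(hST b hb).1, e2⟩ h).trans (Nat.le_add_right _ _)
theorem four3_13 (h3 : qF = 3) : Fin13 F 4 := by
  intro H
  have : Fact (coal 3) := ⟨face⟩
  refine asm13 nu 3 1 (by rw [h3, nose]) H 8234496 nu (fun _ => ⟨default, ?_⟩) 0 0 rug rug 1 brain ?_ 1 1 (by rw [h3]; norm_num)
    (fun _ => 5760) (deer 3) (fun e => if e = 2 then 1 else deer 3 e) (fun e => if e = 2 then 2 else 0) (fun e _ => by rw [h3]; exact cash _ _ nu) ?_ ?_ ?_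
  · exact_mod_cast e43_13 h3 _ (wall 2 default)
  · intro p hp hp2 _ hp1
    rw [h3] at hp1
    exact absurd ((pot hp kick).1 hp1) hp2
  · intro e _
    by_cases h : e = 2
    · subst h; simp [deer, lake]
    · simp [h]
  · intro e l h1 h2 h4
    obtain rfl : e = 2 := by nlinarith
    obtain rfl : l = 2 := om
    rw [h3]; norm_num [bus, rat]
  · rw [h3, show jury 2 4 = ({2, 3, 4} : Finset Nat) from rfl]
    norm_num [bus, deer, rat, lake]
end
section
theorem prize (N : Subgroup (lip (Fin 2) F)) [N.Normal] (h : IsSimpleGroup (cow (Fin 2) F)) (h1 : ¬ N <= hat (lip (Fin 2) F))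
    (h2 : N ⊔ hat (lip (Fin 2) F) ≠ ⊤) : False := by
  have hn : (N.map (mat (hat (lip (Fin 2) F)))).Normal := Subgroup.Normal.map inferInstance _ (QuotientGroup.mk'_surjective _)
  rcases h.eq_bot_or_eq_top_of_normal _ hn with h | h
  · rw [Subgroup.map_eq_bot_iff, QuotientGroup.ker_mk'] at h
    exact h1 h
  · apply h2
    have := van (Subgroup.comap (mat (hat (lip (Fin 2) F)))) h
    rwa [Subgroup.comap_map_eq, QuotientGroup.ker_mk', Subgroup.comap_top] at this
theorem n22_13 (hq : cat F = 2) (h : IsSimpleGroup (cow (Fin 2) F)) : False := by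
  have := pipe (F := F) (n := 2)
  have hc : cat (lip (Fin 2) F) = 6 := by
    have := slcard13 (F := F) (n := 2) nu
    rw [snake, hq] at this
    norm_num [rat] at this
    exact this
  have h0 : hat (lip (Fin 2) F) = ⊥ := by
    rw [goose]
    intro A hA
    obtain ⟨r, hr, hA⟩ := poor.1 hA
    have hr0 : r ≠ 0 := by rintro rfl; simp at hr
    have := sell F
    have h9 := buy r hr0
    rw [<- cup, hq] at h9
    rw [show r = 1 by simpa using h9, tank] at hA
    exact Subgroup.mem_bot.2 (beef hA.symm)
  have : Fact (coal 3) := ⟨face⟩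
  obtain ⟨P, hP⟩ := Sylow.exists_subgroup_card_pow_prime (G := (lip (Fin 2) F)) 3 (n := 1) (by rw [hc]; norm_num)
  have hi : P.index = 2 := by
    have := P.card_mul_index
    rw [hP, hc] at this; omega
  have := Subgroup.normal_of_index_eq_two hi
  refine prize P h ?_ ?_ <;> rw [h0]
  · rw [le_bot_iff]; rintro rfl; simp at hP
  · rw [sup_bot_eq]; rintro rfl; simp at hi
theorem n23_13 (h3 : cat F = 3) (h : IsSimpleGroup (cow (Fin 2) F)) : False := by
  have hf : Finite (dog F (Fin 2 -> F))ˣ := owl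
  have := pipe (F := F) (n := 2)
  have hF2 : (2 : F) ≠ 0 := (blue (F := F) (hr := ⟨face⟩) 3 1 (by rw [h3]; norm_num) nu).2
  have hc : cat (lip (Fin 2) F) = 24 := by
    have := slcard13 (F := F) (n := 2) nu
    rw [snake, h3] at this
    norm_num [rat] at this
    omega
  have hQ : (wine h3).Normal := ⟨by
    rintro x (hx | hx | hx) g
    · exact rice (cj13 g x hx)
    · right; left
      rw [pig, pig, hx, box, ounce]
    · right; right
      rw [pig, pig, hx, poet, song, box, ounce]⟩
  refine prize ((wine h3).comap (drive F 2)) h ?_ ?_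
  · intro hle
    let g : (lip (Fin 2) F) := ⟨!![0, 1; -1, 0], by simp [thigh]⟩
    have hg : drive F 2 g ∈ wine h3 := by
      left
      show (drive F 2 g).1 * (drive F 2 g).1 = -1
      refine fish fun v => ?_
      show g.1 *ᵥ (g.1 *ᵥ v) = -v
      ext i
      fin_cases i <;> simp [g, Matrix.mulVec, dotProduct, judge]
    obtain ⟨r, hr, hA⟩ := poor.1 (hle hg)
    have := congrFun (congrFun hA 0) 1
    simp [g] at this
  · intro ht
    have hz : hat (lip (Fin 2) F) <= (wine h3).comap (drive F 2) := by
      intro A hA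
      obtain ⟨r, hr, hA⟩ := poor.1 hA
      right
      have e : (drive F 2 A).1 = r • 1 := by
        refine fish fun v => ?_
        show A.1 *ᵥ v = r • v
        rw [<- hA]
        simp
      rw [e]
      rcases sq_eq_sq_iff_eq_or_eq_neg.1 (hr.trans (sheep 2).symm) with rfl | rfl
      · left; rw [beach]
      · right; rw [ns13]
    rw [sup_eq_left.2 hz] at ht
    have h1 : forall s : (lip (Fin 2) F), drive F 2 s ∈ wine h3 := fun s => by
      have : s ∈ (wine h3).comap (drive F 2) := ht ▸ Subgroup.mem_top s
      exact this
    have h2 := club (fun s : (lip (Fin 2) F) => (⟨drive F 2 s, h1 s⟩ : wine h3)) (fun a b h => coin (van shop h))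
    rw [hc, sport] at h2
    norm_num at h2
theorem all13 {n : Nat} (hn : 2 <= n) (hs : IsSimpleGroup (cow (Fin n) F)) : Fin13 F n := by
  have := sell F
  obtain ⟨r, hch⟩ := CharP.exists F
  obtain ⟨k, hr, hk⟩ := FiniteField.card F r
  rw [<- cup] at hk
  have : Fact r.Prime := ⟨hr⟩
  have h1 : 1 < qF := game
  obtain hq | hq | hq : qF = 2 \/ qF = 3 \/ 4 <= qF := om
  · obtain rfl | rfl | h | h : n = 2 \/ n = 4 \/ (n = 3 \/ n = 5 \/ n = 6 \/ n = 7 \/ n = 8 \/ n = 9) \/ 10 <= n := om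
    exacts [(n22_13 hq hs).elim, four2_13 hq, two_small13 h hq, two_big13 h hq]
  · obtain rfl | rfl | rfl | h : n = 2 \/ n = 3 \/ n = 4 \/ 5 <= n := om
    exacts [(n23_13 hq hs).elim, three13 r k hk hq.ge, four3_13 hq, forest h hq]
  · obtain rfl | rfl | rfl | h : n = 2 \/ n = 3 \/ n = 4 \/ 5 <= n := om
    · by_cases h7 : qF = 7
      exacts [two7_13 h7, two13 r k hk hq h7]
    exacts [three13 r k hk om, four13 r k hk hq, big13 h r k hk hq]
end
end
/-- Theorem 5.1(i) (together with Lemma 4.2 for `n = 2`): if `G = PSLₙ(q)` (`n ≥ 2`)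
is simple, then `∑_{p ∈ π(G)} Q_p(G) < 1`, where `Q_p(G)` is the probability that
`H_p ⊓ H_p^x ≠ 1` for a uniformly random `x ∈ G` and a Sylow `p`-subgroup `H_p`. -/
theorem stmt13 (n q : ℕ) (hn : 2 ≤ n)
    (F : Type*) [Field F] [Fintype F] (hF : Fintype.card F = q)
    (hsimple : IsSimpleGroup (ProjectiveSpecialLinearGroup (Fin n) F))
    (H : (p : ℕ) → p ∈ (Nat.card (ProjectiveSpecialLinearGroup (Fin n) F)).primeFactors →
      Sylow p (ProjectiveSpecialLinearGroup (Fin n) F)) :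
    ∑ p ∈ (Nat.card (ProjectiveSpecialLinearGroup (Fin n) F)).primeFactors.attach,
        (Nat.card {x : ProjectiveSpecialLinearGroup (Fin n) F |
            (H p.1 p.2 : Subgroup (ProjectiveSpecialLinearGroup (Fin n) F)) ⊓
              Subgroup.map (MulAut.conj x⁻¹).toMonoidHom
                (H p.1 p.2 : Subgroup (ProjectiveSpecialLinearGroup (Fin n) F)) ≠ ⊥} : ℚ)
          / (Nat.card (ProjectiveSpecialLinearGroup (Fin n) F) : ℚ)
      < 1 := by
  exact all13 hn hsimple H
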